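/- For every integer Δ ≥ 1 and all reals d, δ, α > 0 there exist η, μ > 0 and n₀ ∈ ℕ such that the following holds for every integer n ≥ n₀. Let 𝐆 = (G_c : c ∈ 𝒞) be a graph collection on a common vertex set V of size n which is (d,η)-dense, with |𝒞| ≥ δn, such that Σ_{c∈𝒞} d_{G_c}(v) ≥ α|𝒞|n for every v ∈ V and e(G_c) ≥ αn² for every c ∈ 𝒞. Then 𝐆 contains a transversal copy of every μ-separable graph H on n vertices with Δ(H) ≤ Δ and e(H) = |𝒞|. -/

import Mathlib

open Finset
open scoped Classical

/-- Number of ordered pairs `(x,y) ∈ A × B` with `{x,y}` an edge of `G`. -/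
noncomputable def pairCount {V : Type*} (G : SimpleGraph V) (A B : Finset V) : ℕ :=
  ((A ×ˢ B).filter (fun p => G.Adj p.1 p.2)).card

/-- Number of neighbours of `v` in `B`. -/
noncomputable def degIn {V : Type*} (G : SimpleGraph V) (v : V) (B : Finset V) : ℕ :=
  (B.filter (fun w => G.Adj v w)).card

/-- Degree of `v` in `G`. -/
noncomputable def degOf {V : Type*} [Fintype V] (G : SimpleGraph V) (v : V) : ℕ :=
  ((univ : Finset V).filter (fun w => G.Adj v w)).card

/-- Number of edges of `G`. -/
noncomputable def edgeCnt {V : Type*} [Fintype V] (G : SimpleGraph V) : ℕ :=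
  ((univ : Finset (Sym2 V)).filter (fun e => e ∈ G.edgeSet)).card

/-- Number of edges of `H` with one endpoint in `A` and the other in `B`. -/
noncomputable def eBetween {W : Type*} [Fintype W] (H : SimpleGraph W) (A B : Finset W) : ℕ :=
  ((univ : Finset (Sym2 W)).filter
    (fun e => e ∈ H.edgeSet ∧ ∃ x ∈ A, ∃ y ∈ B, e = s(x, y))).card

/-- A graph `H` on `h` vertices is `μ`-separable if there is `X ⊆ V(H)` with `|X| ≤ μ h`
such that every connected component of `H - X` has at most `μ h` vertices. -/
def Separable {W : Type*} [Fintype W] (H : SimpleGraph W) (μ : ℝ) : Prop :=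
  ∃ X : Finset W, (X.card : ℝ) ≤ μ * (Fintype.card W : ℝ) ∧
    ∀ K : (SimpleGraph.induce ((↑X : Set W)ᶜ) H).ConnectedComponent,
      (K.supp.ncard : ℝ) ≤ μ * (Fintype.card W : ℝ)

/-- A transversal copy of `H` in the graph collection `G`. -/
def HasTransversal {V C W : Type*} (G : C → SimpleGraph V) (H : SimpleGraph W) : Prop :=
  ∃ (τ : W → V) (σ : Sym2 W → C),
    Function.Injective τ ∧ Set.InjOn σ H.edgeSet ∧
    ∀ x y, H.Adj x y → (G (σ s(x, y))).Adj (τ x) (τ y)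

/-- Density of a collection of bipartite graphs. -/
noncomputable def colDensity {V C : Type*} (G : C → SimpleGraph V)
    (A B : Finset V) (D : Finset C) : ℝ :=
  (∑ c ∈ D, (pairCount (G c) A B : ℝ)) / ((D.card : ℝ) * (A.card : ℝ) * (B.card : ℝ))

/-- `(ε,d)`-regularity of a collection of bipartite graphs with parts `V₁, V₂`
and colour set `D`. -/
def ColReg {V C : Type*} (ε d : ℝ) (G : C → SimpleGraph V)
    (V₁ V₂ : Finset V) (D : Finset C) : Prop :=
  d ≤ colDensity G V₁ V₂ D ∧
  ∀ V₁' ⊆ V₁, ∀ V₂' ⊆ V₂, ∀ D' ⊆ D,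
    ε * (V₁.card : ℝ) ≤ (V₁'.card : ℝ) → ε * (V₂.card : ℝ) ≤ (V₂'.card : ℝ) →
    ε * (D.card : ℝ) ≤ (D'.card : ℝ) →
    |colDensity G V₁' V₂' D' - colDensity G V₁ V₂ D| < ε

/-- `(ε,d)`-superregularity of a collection of bipartite graphs. -/
def ColSuperReg {V C : Type*} (ε d : ℝ) (G : C → SimpleGraph V)
    (V₁ V₂ : Finset V) (D : Finset C) : Prop :=
  ColReg ε d G V₁ V₂ D ∧
  (∀ v ∈ V₁, d * (V₂.card : ℝ) * (D.card : ℝ) ≤ ∑ c ∈ D, (degIn (G c) v V₂ : ℝ)) ∧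
  (∀ v ∈ V₂, d * (V₁.card : ℝ) * (D.card : ℝ) ≤ ∑ c ∈ D, (degIn (G c) v V₁ : ℝ)) ∧
  (∀ c ∈ D, d * (V₁.card : ℝ) * (V₂.card : ℝ) ≤ (pairCount (G c) V₁ V₂ : ℝ))

/-- `(ε,d)`-half-superregularity of a collection of bipartite graphs. -/
def ColHalfSuperReg {V C : Type*} (ε d : ℝ) (G : C → SimpleGraph V)
    (V₁ V₂ : Finset V) (D : Finset C) : Prop :=
  (∀ V₁' ⊆ V₁, ∀ V₂' ⊆ V₂, ∀ D' ⊆ D,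
    ε * (V₁.card : ℝ) ≤ (V₁'.card : ℝ) → ε * (V₂.card : ℝ) ≤ (V₂'.card : ℝ) →
    ε * (D.card : ℝ) ≤ (D'.card : ℝ) →
    d * (D'.card : ℝ) * (V₁'.card : ℝ) * (V₂'.card : ℝ) ≤
      ∑ c ∈ D', (pairCount (G c) V₁' V₂' : ℝ)) ∧
  (∀ v ∈ V₁, d * (V₂.card : ℝ) * (D.card : ℝ) ≤ ∑ c ∈ D, (degIn (G c) v V₂ : ℝ)) ∧
  (∀ v ∈ V₂, d * (V₁.card : ℝ) * (D.card : ℝ) ≤ ∑ c ∈ D, (degIn (G c) v V₁ : ℝ)) ∧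
  (∀ c ∈ D, d * (V₁.card : ℝ) * (V₂.card : ℝ) ≤ (pairCount (G c) V₁ V₂ : ℝ))

/-- `(ε,d)`-half-superregularity of a bipartite graph (given by an adjacency relation)
with parts `V₁, V₂`. -/
def BipHalfSuper {V : Type*} (ε d : ℝ) (A : V → V → Prop) (V₁ V₂ : Finset V) : Prop :=
  (∀ U₁ ⊆ V₁, ∀ U₂ ⊆ V₂,
    ε * (V₁.card : ℝ) ≤ (U₁.card : ℝ) → ε * (V₂.card : ℝ) ≤ (U₂.card : ℝ) →
    d * (U₁.card : ℝ) * (U₂.card : ℝ) ≤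
      (((U₁ ×ˢ U₂).filter (fun p => A p.1 p.2)).card : ℝ)) ∧
  (∀ x ∈ V₁, d * (V₂.card : ℝ) ≤ ((V₂.filter (fun y => A x y)).card : ℝ)) ∧
  (∀ y ∈ V₂, d * (V₁.card : ℝ) ≤ ((V₁.filter (fun x => A x y)).card : ℝ))

/-- Number of ordered triples `(x₁,x₂,x₃) ∈ U₁ × U₂ × U₃` with `{x₁,x₂,x₃}` an edge. -/
noncomputable def tripCount {V : Type*} (E : Set (Finset V)) (U₁ U₂ U₃ : Finset V) : ℕ :=
  ((U₁ ×ˢ U₂ ×ˢ U₃).filter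
    (fun p => ({p.1, p.2.1, p.2.2} : Finset V) ∈ E)).card

/-- Density of the triple `(U₁,U₂,U₃)` in a `3`-graph. -/
noncomputable def tripDensity {V : Type*} (E : Set (Finset V)) (U₁ U₂ U₃ : Finset V) : ℝ :=
  (tripCount E U₁ U₂ U₃ : ℝ) / ((U₁.card : ℝ) * (U₂.card : ℝ) * (U₃.card : ℝ))

/-- Degree of a vertex in a hypergraph: the number of edges containing it. -/
noncomputable def hDeg {V : Type*} [Fintype V] (E : Set (Finset V)) (v : V) : ℕ :=
  ((univ : Finset (Finset V)).filter (fun e => e ∈ E ∧ v ∈ e)).card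

/-- Weak `(ε,d)`-regularity of a 3-partite triple in a 3-graph. -/
def TripReg {V : Type*} (ε d : ℝ) (E : Set (Finset V)) (V₁ V₂ V₃ : Finset V) : Prop :=
  d ≤ tripDensity E V₁ V₂ V₃ ∧
  ∀ U₁ ⊆ V₁, ∀ U₂ ⊆ V₂, ∀ U₃ ⊆ V₃,
    ε * (V₁.card : ℝ) ≤ (U₁.card : ℝ) → ε * (V₂.card : ℝ) ≤ (U₂.card : ℝ) →
    ε * (V₃.card : ℝ) ≤ (U₃.card : ℝ) →
    |tripDensity E U₁ U₂ U₃ - tripDensity E V₁ V₂ V₃| < ε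

/-- Weak `(ε,d)`-half-superregularity of a 3-partite triple in a 3-graph. -/
def TripHalfSuper {V : Type*} (ε d : ℝ) (E : Set (Finset V)) (V₁ V₂ V₃ : Finset V) : Prop :=
  (∀ U₁ ⊆ V₁, ∀ U₂ ⊆ V₂, ∀ U₃ ⊆ V₃,
    ε * (V₁.card : ℝ) ≤ (U₁.card : ℝ) → ε * (V₂.card : ℝ) ≤ (U₂.card : ℝ) →
    ε * (V₃.card : ℝ) ≤ (U₃.card : ℝ) →
    d * (U₁.card : ℝ) * (U₂.card : ℝ) * (U₃.card : ℝ) ≤ (tripCount E U₁ U₂ U₃ : ℝ)) ∧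
  (∀ x ∈ V₁, d * (V₂.card : ℝ) * (V₃.card : ℝ) ≤ (tripCount E {x} V₂ V₃ : ℝ)) ∧
  (∀ y ∈ V₂, d * (V₁.card : ℝ) * (V₃.card : ℝ) ≤ (tripCount E V₁ {y} V₃ : ℝ)) ∧
  (∀ z ∈ V₃, d * (V₁.card : ℝ) * (V₂.card : ℝ) ≤ (tripCount E V₁ V₂ {z} : ℝ))

/-- A copy of the 1-expansion of `H` in a 3-graph with edge set `E`. -/
def HasExpansionCopy {V W : Type*} (E : Set (Finset V)) (H : SimpleGraph W) : Prop :=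
  ∃ (ρv : W → V) (ρe : Sym2 W → V),
    Function.Injective ρv ∧ Set.InjOn ρe H.edgeSet ∧
    (∀ x, ∀ e ∈ H.edgeSet, ρv x ≠ ρe e) ∧
    ∀ x y, H.Adj x y → ({ρv x, ρv y, ρe s(x, y)} : Finset V) ∈ E

/-- Number of edges (as functions picking one vertex per part) inside the sets `U i`. -/
noncomputable def kCount {V : Type*} {k : ℕ} (E : Set (Fin k → V)) (U : Fin k → Finset V) : ℕ :=
  ((Fintype.piFinset U).filter (fun e => e ∈ E)).card

/-- Density of a `k`-tuple in a `k`-partite `k`-graph. -/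
noncomputable def kDensity {V : Type*} {k : ℕ} (E : Set (Fin k → V)) (U : Fin k → Finset V) : ℝ :=
  (kCount E U : ℝ) / ∏ i, ((U i).card : ℝ)

/-- Degree of `x` as a vertex of the `i`-th part of a `k`-partite `k`-graph. -/
noncomputable def kDegAt {V : Type*} [Fintype V] {k : ℕ} (E : Set (Fin k → V))
    (i : Fin k) (x : V) : ℕ :=
  ((univ : Finset (Fin k → V)).filter (fun e => e ∈ E ∧ e i = x)).card

/-- Weak ε-regularity of a `k`-tuple in a `k`-partite `k`-graph. -/
def KTupleReg {V : Type*} {k : ℕ} (ε : ℝ) (E : Set (Fin k → V)) (Wp : Fin k → Finset V) : Prop :=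
  ∀ U : Fin k → Finset V, (∀ i, U i ⊆ Wp i) →
    (∀ i, ε * ((Wp i).card : ℝ) ≤ ((U i).card : ℝ)) →
    |kDensity E U - kDensity E Wp| < ε

/-- Weak `(ε,d)`-regularity of a `k`-partite `k`-graph with parts `P`. -/
def KReg {V : Type*} {k : ℕ} (ε d : ℝ) (E : Set (Fin k → V)) (P : Fin k → Finset V) : Prop :=
  d ≤ kDensity E P ∧
  ∀ U : Fin k → Finset V, (∀ i, U i ⊆ P i) →
    (∀ i, ε * ((P i).card : ℝ) ≤ ((U i).card : ℝ)) →
    |kDensity E U - kDensity E P| < ε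

/-- Weak `(ε,d)`-superregularity of a `k`-partite `k`-graph with parts `P`. -/
def KSuper {V : Type*} [Fintype V] {k : ℕ} (ε d : ℝ) (E : Set (Fin k → V))
    (P : Fin k → Finset V) : Prop :=
  KReg ε d E P ∧
  ∀ i, ∀ x ∈ P i, d * (∏ j, ((P j).card : ℝ)) / ((P i).card : ℝ) ≤ (kDegAt E i x : ℝ)

/-- Weak `(ε,d)`-half-superregularity of a `k`-partite `k`-graph with parts `P`. -/
def KHalfSuper {V : Type*} [Fintype V] {k : ℕ} (ε d : ℝ) (E : Set (Fin k → V))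
    (P : Fin k → Finset V) : Prop :=
  (∀ U : Fin k → Finset V, (∀ i, U i ⊆ P i) →
    (∀ i, ε * ((P i).card : ℝ) ≤ ((U i).card : ℝ)) →
    d ≤ kDensity E U) ∧
  ∀ i, ∀ x ∈ P i, d * (∏ j, ((P j).card : ℝ)) / ((P i).card : ℝ) ≤ (kDegAt E i x : ℝ)

/-- An `R`-template: vertex clusters `Vc`, colour clusters `Cc i j` (one for each
edge `ij` of `R`), and for each colour `c ∈ Cc i j` a bipartite graph `Ge c i j`
with parts `Vc i`, `Vc j`.  The graph `G_c` of the collection is the union of the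
`Ge c i j` over the edges `ij` of `R` whose colour cluster contains `c`. -/
structure GTemplate (V C : Type*) (r : ℕ) where
  R : SimpleGraph (Fin r)
  Vc : Fin r → Finset V
  Cc : Fin r → Fin r → Finset C
  Ge : C → Fin r → Fin r → SimpleGraph V
  Cc_symm : ∀ i j, Cc i j = Cc j i
  Ge_symm : ∀ c i j, Ge c i j = Ge c j i
  Vc_disj : ∀ i j, i ≠ j → Disjoint (Vc i) (Vc j)
  Cc_support : ∀ i j, ¬ R.Adj i j → Cc i j = ∅
  Ge_support : ∀ c i j, c ∉ Cc i j → Ge c i j = ⊥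
  Ge_bipartite : ∀ c i j x y, (Ge c i j).Adj x y →
    (x ∈ Vc i ∧ y ∈ Vc j) ∨ (x ∈ Vc j ∧ y ∈ Vc i)

namespace GTemplate

variable {V C : Type*} {r : ℕ}

/-- The graph `G_c` of the template: the union of the bipartite pieces. -/
noncomputable def Gc (T : GTemplate V C r) (c : C) : SimpleGraph V :=
  ⨆ i, ⨆ j, T.Ge c i j

/-- `T` is an `R`-template with parameters `(m, ε, d, δ)`. -/
def IsParam (T : GTemplate V C r) (m ε d δ : ℝ) : Prop :=
  (∀ j, m ≤ ((T.Vc j).card : ℝ) ∧ ((T.Vc j).card : ℝ) ≤ m / δ) ∧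
  (∀ i j, T.R.Adj i j → δ * m ≤ ((T.Cc i j).card : ℝ)) ∧
  (∀ i j, T.R.Adj i j →
    ColReg ε d (fun c => T.Ge c i j) (T.Vc i) (T.Vc j) (T.Cc i j))

/-- `T` is a super `R`-template with parameters `(m, ε, d, δ)`. -/
def IsSuperParam (T : GTemplate V C r) (m ε d δ : ℝ) : Prop :=
  (∀ j, m ≤ ((T.Vc j).card : ℝ) ∧ ((T.Vc j).card : ℝ) ≤ m / δ) ∧
  (∀ i j, T.R.Adj i j → δ * m ≤ ((T.Cc i j).card : ℝ)) ∧
  (∀ i j, T.R.Adj i j →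
    ColSuperReg ε d (fun c => T.Ge c i j) (T.Vc i) (T.Vc j) (T.Cc i j))

/-- `T` is a half-super `R`-template with parameters `(m, ε, d, δ)`. -/
def IsHalfSuperParam (T : GTemplate V C r) (m ε d δ : ℝ) : Prop :=
  (∀ j, m ≤ ((T.Vc j).card : ℝ) ∧ ((T.Vc j).card : ℝ) ≤ m / δ) ∧
  (∀ i j, T.R.Adj i j → δ * m ≤ ((T.Cc i j).card : ℝ)) ∧
  (∀ i j, T.R.Adj i j →
    ColHalfSuperReg ε d (fun c => T.Ge c i j) (T.Vc i) (T.Vc j) (T.Cc i j))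

/-- `T` is a semi-super `R`-template with parameters `(m, ε, d, δ)`. -/
def IsSemiSuperParam (T : GTemplate V C r) (m ε d δ : ℝ) : Prop :=
  T.IsParam m ε d δ ∧
  ∀ i j, T.R.Adj i j →
    (∀ v ∈ T.Vc i, d * ((T.Vc j).card : ℝ) * ((T.Cc i j).card : ℝ) ≤
      ∑ c ∈ T.Cc i j, (degIn (T.Ge c i j) v (T.Vc j) : ℝ)) ∧
    (∀ v ∈ T.Vc j, d * ((T.Vc i).card : ℝ) * ((T.Cc i j).card : ℝ) ≤
      ∑ c ∈ T.Cc i j, (degIn (T.Ge c i j) v (T.Vc i) : ℝ))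

/-- The template is rainbow: the colour clusters are pairwise disjoint. -/
def Rainbow (T : GTemplate V C r) : Prop :=
  ∀ i j k l, T.R.Adj i j → T.R.Adj k l → s(i, j) ≠ s(k, l) →
    Disjoint (T.Cc i j) (T.Cc k l)

/-- Adjacency in the `l`-thick graph of the template, between clusters `i` and `j`. -/
def ThickAdj (T : GTemplate V C r) (l : ℝ) (i j : Fin r) (x y : V) : Prop :=
  l * ((T.Cc i j).card : ℝ) ≤
    (((T.Cc i j).filter (fun c => (T.Ge c i j).Adj x y)).card : ℝ)

end GTemplate

/-- lower-density: all but at most `s` vertices have relative degree `≥ θ` into each set of size `≥ s` -/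
def LD {V : Type} [Fintype V] (J : SimpleGraph V) (s θ : ℝ) : Prop :=
  ∀ B : Finset V, s ≤ (B.card : ℝ) →
    (((univ : Finset V).filter
      (fun v => ((B.filter (fun w => J.Adj v w)).card : ℝ) < θ * (B.card : ℝ))).card : ℝ) ≤ s

/-- pairs contained in at least a `θ` proportion of the graphs with colour in `D` -/
def thick {V C : Type} (G : C → SimpleGraph V) (θ : ℝ) (D : Finset C) : SimpleGraph V where
  Adj x y := x ≠ y ∧ θ * (D.card : ℝ) ≤ ((D.filter (fun c => (G c).Adj x y)).card : ℝ)
  symm := ⟨by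
    rintro x y ⟨h1, h2⟩
    refine ⟨h1.symm, ?_⟩
    simpa only [SimpleGraph.adj_comm] using h2⟩
  loopless := ⟨fun x h => h.1 rfl⟩

theorem gel_aux {V W : Type} [Fintype V] [Nonempty V] [Fintype W] (H : SimpleGraph W) (Δ : ℕ)
    (hdeg : ∀ w, degOf H w ≤ Δ) (J : W → W → SimpleGraph V) (hJs : ∀ u w, J u w = J w u)
    (θ s : ℝ) (hθ0 : 0 < θ) (hθ1 : θ ≤ 1) (hJ : ∀ u w, LD (J u w) s θ)
    (T : W → Finset V) (Q : Finset W)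
    (hs : ∀ w, s ≤ θ ^ Δ * ((T w).card : ℝ))
    (hT : ∀ w ∈ Q, (Δ : ℝ) * s + ((Q.filter (fun u => ¬ Disjoint (T u) (T w))).card : ℝ)
      < θ ^ Δ * ((T w).card : ℝ)) (Q' : Finset W) : Q' ⊆ Q →
    ∃ τ : W → V, Set.InjOn τ (Q' : Set W) ∧ (∀ w ∈ Q', τ w ∈ T w) ∧
      (∀ u ∈ Q', ∀ w ∈ Q', H.Adj u w → (J u w).Adj (τ u) (τ w)) ∧
      ∀ w, w ∉ Q' → θ ^ (Q'.filter (fun u => H.Adj u w)).card * ((T w).card : ℝ) ≤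
        (((T w).filter (fun v => ∀ u ∈ Q', H.Adj u w → (J u w).Adj (τ u) v)).card : ℝ) := by
  induction Q' using Finset.induction_on with
  | empty =>
    intro _
    exact ⟨fun _ => Classical.arbitrary V, by simp⟩
  | insert q Q' hq ih =>
    intro hsub
    obtain ⟨τ, hinj, hmem, hadj, hcand⟩ := ih (fun x hx => hsub (mem_insert_of_mem hx))
    have hqQ : q ∈ Q := hsub (mem_insert_self _ _)
    set cand : W → Finset V := fun w =>
      (T w).filter (fun v => ∀ u ∈ Q', H.Adj u w → (J u w).Adj (τ u) v) with hcd
    have hdeg' : ∀ w, (Q'.filter (fun u => H.Adj u w)).card ≤ Δ := by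
      intro w
      refine le_trans (card_le_card ?_) (hdeg w)
      intro u hu
      simp only [mem_filter, mem_univ, true_and] at hu ⊢
      exact hu.2.symm
    have hcandΔ : ∀ w, w ∉ Q' → θ ^ Δ * ((T w).card : ℝ) ≤ ((cand w).card : ℝ) := by
      intro w hw
      refine le_trans ?_ (hcand w hw)
      exact mul_le_mul_of_nonneg_right (pow_le_pow_of_le_one hθ0.le hθ1 (hdeg' w)) (by positivity)
    -- bad sets
    set bad : W → Finset V := fun w => (univ : Finset V).filter
      (fun v => (((cand w).filter (fun y => (J q w).Adj v y)).card : ℝ) < θ * ((cand w).card : ℝ))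
      with hbad
    have hbadc : ∀ w, w ∉ Q' → ((bad w).card : ℝ) ≤ s := fun w hw =>
      hJ q w (cand w) (le_trans (hs w) (hcandΔ w hw))
    set NB : Finset W := (univ : Finset W).filter (fun w => H.Adj q w ∧ w ∉ Q') with hNB
    have hNBc : NB.card ≤ Δ := by
      refine le_trans (card_le_card ?_) (hdeg q)
      intro u hu
      simp only [hNB, mem_filter, mem_univ, true_and] at hu ⊢
      exact hu.1
    have hs0 : 0 ≤ s := by
      have := hbadc q hq
      exact le_trans (by positivity) this
    set used : Finset V := (Q.filter (fun u => ¬ Disjoint (T u) (T q))).image τ with hused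
    have hexists : ∃ v ∈ cand q, v ∉ used ∧ ∀ w ∈ NB, v ∉ bad w := by
      by_contra hcon
      push Not at hcon
      have hsubset : cand q ⊆ used ∪ NB.biUnion bad := by
        intro v hv
        by_cases hvu : v ∈ used
        · exact mem_union_left _ hvu
        · obtain ⟨w, hw1, hw2⟩ := hcon v hv hvu
          exact mem_union_right _ (mem_biUnion.2 ⟨w, hw1, hw2⟩)
      have h1 : ((cand q).card : ℝ) ≤ (used.card : ℝ) + ((NB.biUnion bad).card : ℝ) := by
        exact_mod_cast le_trans (card_le_card hsubset) (card_union_le _ _)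
      have h2 : ((NB.biUnion bad).card : ℝ) ≤ Δ * s := by
        calc ((NB.biUnion bad).card : ℝ) ≤ ∑ w ∈ NB, ((bad w).card : ℝ) := by
              exact_mod_cast card_biUnion_le
          _ ≤ ∑ w ∈ NB, s := sum_le_sum (fun w hw => hbadc w (by
              simp only [hNB, mem_filter] at hw; exact hw.2.2))
          _ = NB.card * s := by simp
          _ ≤ Δ * s := by
              have : (NB.card : ℝ) ≤ Δ := by exact_mod_cast hNBc
              exact mul_le_mul_of_nonneg_right this hs0
      have h3 : (used.card : ℝ) ≤ ((Q.filter (fun u => ¬ Disjoint (T u) (T q))).card : ℝ) := by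
        exact_mod_cast card_image_le
      have h4 := hT q hqQ
      have h5 := hcandΔ q hq
      linarith
    obtain ⟨v, hv1, hv2, hv3⟩ := hexists
    have hvT : v ∈ T q := (mem_filter.1 hv1).1
    have hvadj := (mem_filter.1 hv1).2
    have hne : ∀ u ∈ Q', u ≠ q := fun u hu h => hq (h ▸ hu)
    have hvnew : ∀ u ∈ Q', τ u ≠ v := by
      intro u hu h
      apply hv2
      rw [hused, mem_image]
      refine ⟨u, mem_filter.2 ⟨hsub (mem_insert_of_mem hu), ?_⟩, h⟩
      rw [Finset.not_disjoint_iff]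
      exact ⟨v, h ▸ hmem u hu, hvT⟩
    refine ⟨Function.update τ q v, ?_, ?_, ?_, ?_⟩
    · intro x hx y hy hxy
      simp only [coe_insert, Set.mem_insert_iff, mem_coe] at hx hy
      rcases hx with rfl | hx <;> rcases hy with rfl | hy
      · rfl
      · rw [Function.update_self, Function.update_of_ne (hne y hy)] at hxy
        exact absurd hxy.symm (hvnew y hy)
      · rw [Function.update_self, Function.update_of_ne (hne x hx)] at hxy
        exact absurd hxy (hvnew x hx)
      · rw [Function.update_of_ne (hne x hx), Function.update_of_ne (hne y hy)] at hxy
        exact hinj hx hy hxy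
    · intro w hw
      rcases mem_insert.1 hw with rfl | hw
      · rw [Function.update_self]; exact hvT
      · rw [Function.update_of_ne (hne w hw)]; exact hmem w hw
    · intro u hu w hw huw
      rcases mem_insert.1 hu with hu' | hu' <;> rcases mem_insert.1 hw with hw' | hw'
      · rw [hu', hw'] at huw
        exact absurd huw (H.loopless.irrefl _)
      · rw [hu', Function.update_self, Function.update_of_ne (hne w hw'), hJs]
        rw [hu'] at huw
        exact (hvadj w hw' huw.symm).symm
      · rw [hw', Function.update_self, Function.update_of_ne (hne u hu')]
        rw [hw'] at huw
        exact hvadj u hu' huw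
      · rw [Function.update_of_ne (hne u hu'), Function.update_of_ne (hne w hw')]
        exact hadj u hu' w hw' huw
    · intro w hw
      have hwq : w ≠ q := fun h => hw (h ▸ mem_insert_self _ _)
      have hwQ' : w ∉ Q' := fun h => hw (mem_insert_of_mem h)
      have hc := hcand w hwQ'
      by_cases hqw : H.Adj q w
      · have e1 : ((insert q Q').filter (fun u => H.Adj u w)).card
            = (Q'.filter (fun u => H.Adj u w)).card + 1 := by
          rw [filter_insert, if_pos hqw, card_insert_of_notMem]
          simp [hq]
        have hvb := hv3 w (by simp [hNB, hqw, hwQ'])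
        have hvb' : θ * ((cand w).card : ℝ) ≤
            (((cand w).filter (fun y => (J q w).Adj v y)).card : ℝ) := by
          by_contra hh
          exact hvb (by simp only [hbad, mem_filter, mem_univ, true_and]; exact not_le.1 hh)
        rw [e1, pow_succ]
        calc θ ^ (Q'.filter (fun u => H.Adj u w)).card * θ * ((T w).card : ℝ)
            = θ * (θ ^ (Q'.filter (fun u => H.Adj u w)).card * ((T w).card : ℝ)) := by ring
          _ ≤ θ * ((cand w).card : ℝ) := mul_le_mul_of_nonneg_left hc hθ0.le
          _ ≤ _ := hvb'
          _ ≤ _ := by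
            norm_cast
            apply card_le_card
            intro y hy
            simp only [hcd, mem_filter] at hy ⊢
            refine ⟨hy.1.1, ?_⟩
            intro u hu huw
            rcases mem_insert.1 hu with rfl | hu
            · rw [Function.update_self]; exact hy.2
            · rw [Function.update_of_ne (hne u hu)]; exact hy.1.2 u hu huw
      · have e1 : ((insert q Q').filter (fun u => H.Adj u w))
            = (Q'.filter (fun u => H.Adj u w)) := by
          rw [filter_insert, if_neg hqw]
        rw [e1]
        refine le_trans hc ?_
        norm_cast
        apply card_le_card
        intro y hy
        simp only [hcd, mem_filter] at hy ⊢
        refine ⟨hy.1, ?_⟩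
        intro u hu huw
        rcases mem_insert.1 hu with rfl | hu
        · exact absurd huw hqw
        · rw [Function.update_of_ne (hne u hu)]; exact hy.2 u hu huw

/-- extension of a partial embedding `(E, τ₀)` to `E ∪ Q`, respecting target sets -/
theorem gelP {V W : Type} [Fintype V] [Nonempty V] [Fintype W] (H : SimpleGraph W) (Δ : ℕ)
    (hdeg : ∀ w, degOf H w ≤ Δ) (J : W → W → SimpleGraph V) (hJs : ∀ u w, J u w = J w u)
    (θ s : ℝ) (hθ0 : 0 < θ) (hθ1 : θ ≤ 1) (hJ : ∀ u w, LD (J u w) s θ)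
    (T : W → Finset V) (E Q : Finset W) (hEQ : Disjoint E Q)
    (τ₀ : W → V) (hτ₀ : Set.InjOn τ₀ (E : Set W))
    (hs : ∀ w, s ≤ θ ^ Δ * ((T w).card : ℝ))
    (hT : ∀ w ∈ Q, (Δ : ℝ) * s + ((Q.filter (fun u => ¬ Disjoint (T u) (T w))).card : ℝ)
      < θ ^ Δ * ((T w).card : ℝ))
    (hTE : ∀ w ∈ Q, ∀ v ∈ T w, ∀ u ∈ E, τ₀ u ≠ v ∧ (H.Adj u w → (J u w).Adj (τ₀ u) v)) :
    ∃ τ : W → V, Set.InjOn τ ((E ∪ Q : Finset W) : Set W) ∧ (∀ w ∈ E, τ w = τ₀ w) ∧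
      (∀ w ∈ Q, τ w ∈ T w) ∧
      (∀ u ∈ Q, ∀ w ∈ E ∪ Q, H.Adj u w → (J u w).Adj (τ u) (τ w)) ∧
      ∀ w, w ∉ Q → θ ^ Δ * ((T w).card : ℝ) ≤
        (((T w).filter (fun v => ∀ u ∈ Q, H.Adj u w → (J u w).Adj (τ u) v)).card : ℝ) := by
  obtain ⟨τ, h1, h2, h3, h4⟩ := gel_aux H Δ hdeg J hJs θ s hθ0 hθ1 hJ T Q hs hT Q (Subset.refl _)
  have hne : ∀ w ∈ Q, w ∉ E := fun w hw hE => (Finset.disjoint_left.1 hEQ) hE hw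
  refine ⟨fun w => if w ∈ E then τ₀ w else τ w, ?_, ?_, ?_, ?_, ?_⟩
  · intro x hx y hy hxy
    simp only [coe_union, Set.mem_union, mem_coe] at hx hy
    by_cases hxE : x ∈ E <;> by_cases hyE : y ∈ E
    · simp only [hxE, hyE, if_true] at hxy
      exact hτ₀ hxE hyE hxy
    · simp only [hxE, hyE, if_true, if_false] at hxy
      have hyQ := hy.resolve_left hyE
      exact absurd hxy (hTE y hyQ _ (h2 y hyQ) x hxE).1
    · simp only [hxE, hyE, if_true, if_false] at hxy
      have hxQ := hx.resolve_left hxE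
      exact absurd hxy.symm (hTE x hxQ _ (h2 x hxQ) y hyE).1
    · simp only [hxE, hyE, if_false] at hxy
      exact h1 (hx.resolve_left hxE) (hy.resolve_left hyE) hxy
  · intro w hw; simp [hw]
  · intro w hw; simp only [hne w hw, if_false]; exact h2 w hw
  · intro u hu w hw huw
    simp only [hne u hu, if_false]
    by_cases hwE : w ∈ E
    · simp only [hwE, if_true]
      rw [hJs]
      exact ((hTE u hu _ (h2 u hu) w hwE).2 huw.symm).symm
    · simp only [hwE, if_false]
      exact h3 u hu w ((mem_union.1 hw).resolve_left hwE) huw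
  · intro w hw
    refine le_trans (mul_le_mul_of_nonneg_right
      (pow_le_pow_of_le_one hθ0.le hθ1 ?_) (by positivity)) (le_trans (h4 w hw) ?_)
    · refine le_trans (card_le_card ?_) (hdeg w)
      intro u hu
      simp only [mem_filter, mem_univ, true_and] at hu ⊢
      exact hu.2.symm
    · norm_cast
      apply card_le_card
      intro y hy
      simp only [mem_filter] at hy ⊢
      refine ⟨hy.1, ?_⟩
      intro u hu huw
      simp only [hne u hu, if_false]
      exact hy.2 u hu huw

/-- thick graphs of dense collections are lower-dense -/
theorem thick_LD {V C : Type} [Fintype V] (G : C → SimpleGraph V) (a η n s : ℝ)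
    (D : Finset C) (ha : 0 < a) (hs : 0 < s)
    (hdense : ∀ A B : Finset V, ∀ C' : Finset C,
        a * (C'.card : ℝ) * (A.card : ℝ) * (B.card : ℝ) - η * n ^ 3 ≤
          ∑ c ∈ C', (pairCount (G c) A B : ℝ))
    (hD : η * n ^ 3 < a / 2 * (D.card : ℝ) * s * s) : LD (thick G (a / 4) D) s (a / 4) := by
  intro B hB
  set A := (univ : Finset V).filter
      (fun v => ((B.filter (fun w => (thick G (a/4) D).Adj v w)).card : ℝ) < a / 4 * (B.card : ℝ))
    with hA
  by_contra hcon
  push Not at hcon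
  have h1 := hdense A B D
  have key : ∑ c ∈ D, (pairCount (G c) A B : ℝ) ≤ a / 2 * (D.card : ℝ) * A.card * B.card := by
    have e1 : ∑ c ∈ D, (pairCount (G c) A B : ℝ)
        = ∑ x ∈ A, ∑ y ∈ B, ((D.filter (fun c => (G c).Adj x y)).card : ℝ) := by
      have : ∀ c ∈ D, (pairCount (G c) A B : ℝ)
          = ∑ x ∈ A, ∑ y ∈ B, (if (G c).Adj x y then (1:ℝ) else 0) := by
        intro c _
        rw [pairCount, card_filter, ← sum_product']
        push_cast
        rfl
      rw [sum_congr rfl this, sum_comm]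
      refine sum_congr rfl (fun x _ => ?_)
      rw [sum_comm]
      refine sum_congr rfl (fun y _ => ?_)
      rw [card_filter]; push_cast; rfl
    rw [e1]
    have hrow : ∀ x ∈ A, ∑ y ∈ B, ((D.filter (fun c => (G c).Adj x y)).card : ℝ)
        ≤ a / 2 * (D.card : ℝ) * B.card := by
      intro x hx
      have hx2 : ((B.filter (fun w => (thick G (a/4) D).Adj x w)).card : ℝ) < a / 4 * (B.card : ℝ) := by
        simpa [hA] using hx
      have hpt : ∀ y ∈ B, ((D.filter (fun c => (G c).Adj x y)).card : ℝ) ≤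
          (if (thick G (a/4) D).Adj x y then (D.card : ℝ) else 0) + a / 4 * D.card := by
        intro y _
        split_ifs with h
        · have : ((D.filter (fun c => (G c).Adj x y)).card : ℝ) ≤ D.card := by
            exact_mod_cast card_filter_le _ _
          have h0 : 0 ≤ a / 4 * (D.card : ℝ) := by positivity
          linarith
        · by_cases hxy : x = y
          · subst hxy
            simp
            positivity
          · have : ¬ (a / 4 * (D.card : ℝ) ≤ ((D.filter (fun c => (G c).Adj x y)).card : ℝ)) :=
              fun h' => h ⟨hxy, h'⟩
            linarith
      calc _ ≤ ∑ y ∈ B, ((if (thick G (a/4) D).Adj x y then (D.card : ℝ) else 0) + a / 4 * D.card) :=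
            sum_le_sum hpt
        _ = ((B.filter (fun w => (thick G (a/4) D).Adj x w)).card : ℝ) * D.card
            + B.card * (a / 4 * D.card) := by
            rw [sum_add_distrib, ← sum_filter, sum_const, sum_const]; simp
        _ ≤ a / 4 * B.card * D.card + B.card * (a / 4 * D.card) := by
            gcongr
        _ = _ := by ring
    calc _ ≤ ∑ x ∈ A, a / 2 * (D.card : ℝ) * B.card := sum_le_sum hrow
      _ = _ := by rw [sum_const]; simp; ring
  have h3 : s * s ≤ (A.card : ℝ) * B.card := mul_le_mul hcon.le hB hs.le (by positivity)
  have h4 : a / 2 * (D.card : ℝ) * (s * s) ≤ a / 2 * (D.card : ℝ) * ((A.card : ℝ) * B.card) :=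
    mul_le_mul_of_nonneg_left h3 (by positivity)
  nlinarith

/-- greedy injective choice from long lists -/
theorem list_choice {α β : Type} [Nonempty β] (S : Finset α) (L : α → Finset β)
    (h : ∀ a ∈ S, S.card ≤ (L a).card) :
    ∃ f : α → β, (∀ a ∈ S, f a ∈ L a) ∧ Set.InjOn f (S : Set α) := by
  induction S using Finset.induction_on with
  | empty => exact ⟨fun _ => Classical.arbitrary β, by simp⟩
  | insert q S hq ih =>
    obtain ⟨f, hf1, hf2⟩ := ih (fun a ha => by
      have := h a (mem_insert_of_mem ha)
      rw [card_insert_of_notMem hq] at this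
      omega)
    have h1 : (S.image f).card < (L q).card := by
      have h2 := h q (mem_insert_self _ _)
      rw [card_insert_of_notMem hq] at h2
      have := card_image_le (s := S) (f := f)
      omega
    obtain ⟨v, hv1, hv2⟩ := exists_mem_notMem_of_card_lt_card h1
    have hne : ∀ u ∈ S, u ≠ q := fun u hu e => hq (e ▸ hu)
    have hvn : ∀ u ∈ S, f u ≠ v := fun u hu e => hv2 (mem_image.2 ⟨u, hu, e⟩)
    refine ⟨Function.update f q v, ?_, ?_⟩
    · intro w hw
      rcases mem_insert.1 hw with rfl | hw'
      · rw [Function.update_self]; exact hv1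
      · rw [Function.update_of_ne (hne w hw')]; exact hf1 w hw'
    · intro x hx y hy hxy
      simp only [coe_insert, Set.mem_insert_iff, mem_coe] at hx hy
      rcases hx with rfl | hx <;> rcases hy with rfl | hy
      · rfl
      · rw [Function.update_self, Function.update_of_ne (hne y hy)] at hxy
        exact absurd hxy.symm (hvn y hy)
      · rw [Function.update_self, Function.update_of_ne (hne x hx)] at hxy
        exact absurd hxy (hvn x hx)
      · rw [Function.update_of_ne (hne x hx), Function.update_of_ne (hne y hy)] at hxy
        exact hf2 hx hy hxy

/-- number of related pairs -/
noncomputable def eR {α β : Type} (F : α → β → Prop) (A : Finset α) (B : Finset β) : ℝ :=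
  ∑ x ∈ A, ((B.filter (fun y => F x y)).card : ℝ)

theorem eR_nonneg {α β : Type} (F : α → β → Prop) (A : Finset α) (B : Finset β) : 0 ≤ eR F A B :=
  sum_nonneg (fun _ _ => by positivity)

theorem eR_le {α β : Type} (F : α → β → Prop) (A : Finset α) (B : Finset β) :
    eR F A B ≤ A.card * B.card := by
  unfold eR
  calc _ ≤ ∑ x ∈ A, (B.card : ℝ) := sum_le_sum (fun x _ => by exact_mod_cast card_filter_le _ _)
    _ = _ := by simp

theorem eR_split {α β : Type} (F : α → β → Prop) (A A' : Finset α) (B B' : Finset β)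
    (hA : A' ⊆ A) (hB : B' ⊆ B) :
    eR F A B = eR F A' B' + eR F (A \ A') B' + eR F A (B \ B') := by
  unfold eR
  have h1 : ∀ x, ((B.filter (fun y => F x y)).card : ℝ) = ((B'.filter (fun y => F x y)).card : ℝ)
      + (((B \ B').filter (fun y => F x y)).card : ℝ) := by
    intro x
    rw [← Nat.cast_add, ← card_union_of_disjoint, ← filter_union, union_sdiff_of_subset hB]
    exact disjoint_filter_filter disjoint_sdiff
  rw [sum_congr rfl (fun x _ => h1 x), sum_add_distrib, ← sum_sdiff hA]
  ring

theorem densInc (ε d0 : ℝ) (hε : 0 < ε) (hε1 : ε ≤ 1) (hd0 : 0 < d0) (hd1 : d0 ≤ 1) :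
    ∃ c : ℝ, 0 < c ∧ c ≤ 1 ∧ ∀ (α β : Type) (F : α → β → Prop) (X : Finset α) (Y : Finset β),
      X.Nonempty → Y.Nonempty → d0 * X.card * Y.card ≤ eR F X Y →
      ∃ X' ⊆ X, ∃ Y' ⊆ Y, X'.Nonempty ∧ Y'.Nonempty ∧ c * X.card ≤ X'.card ∧ c * Y.card ≤ Y'.card ∧
        ∀ X'' ⊆ X', ∀ Y'' ⊆ Y', ε * X'.card ≤ (X''.card : ℝ) → ε * Y'.card ≤ (Y''.card : ℝ) →
          d0 / 2 * X''.card * Y''.card ≤ eR F X'' Y'' := by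
  set σ : ℝ := ε ^ 2 / 4 with hσ
  have hσ0 : 0 < σ := by positivity
  have hσ1 : σ ≤ 1 / 4 := by rw [hσ]; nlinarith
  have hc0 : 0 < d0 ^ (1 / σ) := Real.rpow_pos_of_pos hd0 _
  refine ⟨d0 ^ (1 / σ), hc0, Real.rpow_le_one hd0.le hd1 (by positivity), ?_⟩
  intro α β F X Y hX hY hXY
  set p : ℝ := 1 - σ with hp
  set 𝒮 := (X.powerset ×ˢ Y.powerset).filter (fun q => q.1.Nonempty ∧ q.2.Nonempty) with h𝒮
  obtain ⟨⟨A, B⟩, hAB, hmax⟩ := exists_max_image 𝒮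
    (fun q => eR F q.1 q.2 / ((q.1.card : ℝ) * q.2.card) ^ p)
    ⟨(X, Y), by simp [h𝒮, hX, hY]⟩
  simp only [h𝒮, mem_filter, mem_product, mem_powerset] at hAB hmax
  obtain ⟨⟨hAX, hBY⟩, hAne, hBne⟩ := hAB
  have hA0 : (0 : ℝ) < A.card := by exact_mod_cast hAne.card_pos
  have hB0 : (0 : ℝ) < B.card := by exact_mod_cast hBne.card_pos
  have hX0 : (0 : ℝ) < X.card := by exact_mod_cast hX.card_pos
  have hY0 : (0 : ℝ) < Y.card := by exact_mod_cast hY.card_pos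
  set M : ℝ := (A.card : ℝ) * B.card with hM
  set N : ℝ := (X.card : ℝ) * Y.card with hN
  have hM0 : 0 < M := by positivity
  have hN0 : 0 < N := by positivity
  have hMp : 0 < M ^ p := Real.rpow_pos_of_pos hM0 _
  have hNp : 0 < N ^ p := Real.rpow_pos_of_pos hN0 _
  have hAXc : (A.card : ℝ) ≤ X.card := by exact_mod_cast card_le_card hAX
  have hBYc : (B.card : ℝ) ≤ Y.card := by exact_mod_cast card_le_card hBY
  have hMN : M ≤ N := mul_le_mul hAXc hBYc hB0.le hX0.le
  have hMsplit : M ^ σ * M ^ p = M := by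
    rw [← Real.rpow_add hM0]; simp [hp]
  have hNsplit : N ^ σ * N ^ p = N := by
    rw [← Real.rpow_add hN0]; simp [hp]
  have hΦ : d0 * N ^ σ ≤ eR F A B / M ^ p := by
    have h := hmax (X, Y) ⟨⟨Subset.refl _, Subset.refl _⟩, hX, hY⟩
    refine le_trans ?_ h
    rw [le_div_iff₀ hNp]
    calc d0 * N ^ σ * N ^ p = d0 * (N ^ σ * N ^ p) := by ring
      _ = d0 * X.card * Y.card := by rw [hNsplit, hN]; ring
      _ ≤ _ := hXY
  have heAB : d0 * N ^ σ * M ^ p ≤ eR F A B := by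
    rwa [le_div_iff₀ hMp] at hΦ
  have hcN : d0 ^ (1 / σ) * N ≤ M := by
    have h1 : d0 * N ^ σ ≤ M ^ σ := by
      have h2 : d0 * N ^ σ * M ^ p ≤ M ^ σ * M ^ p := by
        rw [hMsplit]; exact le_trans heAB (eR_le F A B)
      exact le_of_mul_le_mul_right h2 hMp
    have h3 : (d0 ^ (1 / σ) * N) ^ σ ≤ M ^ σ := by
      rw [Real.mul_rpow hc0.le hN0.le, ← Real.rpow_mul hd0.le]
      rw [one_div_mul_cancel hσ0.ne', Real.rpow_one]
      exact h1
    exact (Real.rpow_le_rpow_iff (by positivity) hM0.le hσ0).1 h3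
  have hDe : d0 * M ≤ eR F A B := by
    refine le_trans ?_ heAB
    have : M ^ σ ≤ N ^ σ := Real.rpow_le_rpow hM0.le hMN hσ0.le
    calc d0 * M = d0 * (M ^ σ * M ^ p) := by rw [hMsplit]
      _ ≤ d0 * (N ^ σ * M ^ p) := by gcongr
      _ = _ := by ring
  have heb : ∀ A' ⊆ A, ∀ B' ⊆ B, eR F A' B' ≤ eR F A B * ((A'.card : ℝ) * B'.card / M + σ) := by
    intro A' hA' B' hB'
    have hz0 : 0 ≤ (A'.card : ℝ) * B'.card / M := by positivity
    rcases A'.eq_empty_or_nonempty with rfl | hA'ne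
    · have : eR F ∅ B' = 0 := by simp [eR]
      rw [this]
      have := eR_nonneg F A B
      positivity
    rcases B'.eq_empty_or_nonempty with rfl | hB'ne
    · have : eR F A' ∅ = 0 := by simp [eR]
      rw [this]
      have := eR_nonneg F A B
      positivity
    have h := hmax (A', B') ⟨⟨hA'.trans hAX, hB'.trans hBY⟩, hA'ne, hB'ne⟩
    simp only at h
    have hA'0 : (0 : ℝ) < A'.card := by exact_mod_cast hA'ne.card_pos
    have hB'0 : (0 : ℝ) < B'.card := by exact_mod_cast hB'ne.card_pos
    have hP : 0 < ((A'.card : ℝ) * B'.card) ^ p := Real.rpow_pos_of_pos (by positivity) _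
    rw [div_le_iff₀ hP] at h
    refine h.trans ?_
    rw [div_mul_eq_mul_div, mul_div_assoc, ← Real.div_rpow (by positivity) hM0.le]
    refine mul_le_mul_of_nonneg_left ?_ (eR_nonneg _ _ _)
    have h2 := Real.geom_mean_le_arith_mean2_weighted (w₁ := p) (w₂ := σ) (p₁ := (A'.card : ℝ) * B'.card / M)
      (p₂ := 1) (by rw [hp]; linarith) hσ0.le hz0 (by norm_num) (by rw [hp]; ring)
    rw [Real.one_rpow, mul_one, mul_one] at h2
    refine h2.trans ?_
    have : p * ((A'.card : ℝ) * B'.card / M) ≤ 1 * ((A'.card : ℝ) * B'.card / M) :=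
      mul_le_mul_of_nonneg_right (by rw [hp]; linarith) hz0
    linarith
  refine ⟨A, hAX, B, hBY, hAne, hBne, ?_, ?_, ?_⟩
  · have : d0 ^ (1 / σ) * X.card * B.card ≤ A.card * B.card := by
      calc d0 ^ (1 / σ) * X.card * B.card ≤ d0 ^ (1 / σ) * X.card * Y.card := by gcongr
        _ = d0 ^ (1 / σ) * N := by rw [hN]; ring
        _ ≤ _ := hcN
    exact le_of_mul_le_mul_right this hB0
  · have : A.card * (d0 ^ (1 / σ) * Y.card) ≤ A.card * B.card := by
      calc A.card * (d0 ^ (1 / σ) * Y.card) ≤ X.card * (d0 ^ (1 / σ) * Y.card) := by gcongr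
        _ = d0 ^ (1 / σ) * N := by rw [hN]; ring
        _ ≤ _ := hcN
    exact le_of_mul_le_mul_left this hA0
  · intro A'' hA'' B'' hB'' hεA hεB
    by_contra hcon
    push Not at hcon
    have hE := eR_split F A A'' B B'' hA'' hB''
    have h1 := heb (A \ A'') sdiff_subset B'' hB''
    have h2 := heb A (Subset.refl _) (B \ B'') sdiff_subset
    rw [cast_card_sdiff hA''] at h1
    rw [cast_card_sdiff hB''] at h2
    set E := eR F A B with hEdef
    have hE0 : 0 < E := lt_of_lt_of_le (by positivity) hDe
    obtain ⟨x, ea⟩ : ∃ x : ℝ, (A''.card : ℝ) = x * A.card :=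
      ⟨A''.card / A.card, by field_simp⟩
    obtain ⟨y, eb⟩ : ∃ y : ℝ, (B''.card : ℝ) = y * B.card :=
      ⟨B''.card / B.card, by field_simp⟩
    have hxε : ε ≤ x := by rw [ea] at hεA; exact le_of_mul_le_mul_right hεA hA0
    have hyε : ε ≤ y := by rw [eb] at hεB; exact le_of_mul_le_mul_right hεB hB0
    rw [ea, eb] at h1
    rw [eb] at h2
    rw [ea, eb] at hcon
    have e1 : ((A.card : ℝ) - x * A.card) * (y * B.card) / M = (1 - x) * y := by
      rw [hM]; field_simp
    have e2 : (A.card : ℝ) * (B.card - y * B.card) / M = 1 - y := by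
      rw [hM]; field_simp
    rw [e1] at h1
    rw [e2] at h2
    have h3 : eR F A'' B'' < E * (x * y / 2) := by
      refine hcon.trans_le ?_
      calc d0 / 2 * (x * A.card) * (y * B.card) = (d0 * M) * (x * y / 2) := by rw [hM]; ring
        _ ≤ E * (x * y / 2) := mul_le_mul_of_nonneg_right hDe (by
          have : 0 < x := hε.trans_le hxε
          have : 0 < y := hε.trans_le hyε
          positivity)
    have h4 : E < E * (x * y / 2 + ((1 - x) * y + σ) + (1 - y + σ)) := by
      calc E = _ := hE
        _ < _ := by linarith
    have h5 : 1 < x * y / 2 + ((1 - x) * y + σ) + (1 - y + σ) := by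
      by_contra h6
      push Not at h6
      have := mul_le_mul_of_nonneg_left h6 hE0.le
      linarith
    have h6 : ε * ε ≤ x * y := mul_le_mul hxε hyε hε.le (hε.le.trans hxε)
    have h7 : (1 - x) * y = y - x * y := by ring
    have h8 : ε * ε = ε ^ 2 := by ring
    rw [h7, hσ] at h5
    linarith

/-- selection of disjoint tuples by a potential function -/
theorem select_tuples {V π : Type} {k : ℕ} [Nonempty V] (𝒯 : Finset (Fin k → V)) (𝒬 : Finset π)
    (w : π → (Fin k → V) → ℝ) (hw : ∀ P t, 0 ≤ w P t) (ρ : ℝ) (hρ : 0 ≤ ρ) (m : ℕ)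
    (h : ∀ U : Finset V, U.card ≤ k * m →
      (𝒯.filter (fun t => ∀ a, t a ∉ U)).Nonempty ∧
      ∀ P ∈ 𝒬, ∑ t ∈ 𝒯.filter (fun t => ∀ a, t a ∉ U), w P t
        ≤ ρ * ((𝒯.filter (fun t => ∀ a, t a ∉ U)).card : ℝ)) :
    ∃ t : ℕ → (Fin k → V), (∀ i < m, t i ∈ 𝒯) ∧
      (∀ i < m, ∀ j < m, i ≠ j → ∀ a b, t i a ≠ t j b) ∧
      ∑ P ∈ 𝒬, ∏ i ∈ range m, w P (t i) ≤ ρ ^ m * (𝒬.card : ℝ) := by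
  suffices H : ∀ m' ≤ m, ∃ t : ℕ → (Fin k → V), (∀ i < m', t i ∈ 𝒯) ∧
      (∀ i < m', ∀ j < m', i ≠ j → ∀ a b, t i a ≠ t j b) ∧
      ∑ P ∈ 𝒬, ∏ i ∈ range m', w P (t i) ≤ ρ ^ m' * (𝒬.card : ℝ) from H m le_rfl
  intro m'
  induction m' with
  | zero =>
    intro _
    exact ⟨fun _ _ => Classical.arbitrary V, by simp⟩
  | succ m' ih =>
    intro hm
    obtain ⟨t, h1, h2, h3⟩ := ih (by omega)
    set U : Finset V := (range m').biUnion (fun i => univ.image (t i)) with hU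
    have hUc : U.card ≤ k * m := by
      calc U.card ≤ ∑ i ∈ range m', (univ.image (t i)).card := card_biUnion_le
        _ ≤ ∑ i ∈ range m', k := sum_le_sum (fun i _ => by
          simpa using card_image_le (s := (univ : Finset (Fin k))) (f := t i))
        _ = m' * k := by simp
        _ ≤ k * m := by rw [mul_comm]; exact Nat.mul_le_mul_left _ (by omega)
    obtain ⟨hne, hP⟩ := h U hUc
    set av := 𝒯.filter (fun t => ∀ a, t a ∉ U) with hav
    set Φ : π → ℝ := fun P => ∏ i ∈ range m', w P (t i) with hΦ
    have hΦ0 : ∀ P, 0 ≤ Φ P := fun P => prod_nonneg (fun i _ => hw _ _)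
    obtain ⟨s, hs, hs2⟩ : ∃ s ∈ av, ∑ P ∈ 𝒬, Φ P * w P s ≤ ρ * ∑ P ∈ 𝒬, Φ P := by
      apply exists_le_of_sum_le hne
      rw [sum_comm]
      calc ∑ P ∈ 𝒬, ∑ s ∈ av, Φ P * w P s = ∑ P ∈ 𝒬, Φ P * ∑ s ∈ av, w P s := by
            simp_rw [mul_sum]
        _ ≤ ∑ P ∈ 𝒬, Φ P * (ρ * av.card) :=
            sum_le_sum (fun P hp => mul_le_mul_of_nonneg_left (hP P hp) (hΦ0 P))
        _ = ∑ s ∈ av, ρ * ∑ P ∈ 𝒬, Φ P := by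
            rw [sum_const, ← sum_mul]; simp; ring
    have hsU := (mem_filter.1 hs).2
    have hne' : ∀ i < m', i ≠ m' := fun i hi => by omega
    have hUm : ∀ i < m', ∀ a, t i a ∈ U := fun i hi a =>
      mem_biUnion.2 ⟨i, mem_range.2 hi, mem_image.2 ⟨a, mem_univ _, rfl⟩⟩
    refine ⟨Function.update t m' s, ?_, ?_, ?_⟩
    · intro i hi
      rcases Nat.lt_succ_iff_lt_or_eq.1 hi with hi | rfl
      · rw [Function.update_of_ne (hne' i hi)]; exact h1 i hi
      · rw [Function.update_self]; exact (mem_filter.1 hs).1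
    · intro i hi j hj hij a b
      rcases Nat.lt_succ_iff_lt_or_eq.1 hi with hi | hi <;>
        rcases Nat.lt_succ_iff_lt_or_eq.1 hj with hj | hj
      · rw [Function.update_of_ne (hne' i hi), Function.update_of_ne (hne' j hj)]
        exact h2 i hi j hj hij a b
      · rw [hj, Function.update_of_ne (hne' i hi), Function.update_self]
        exact fun e => hsU b (e ▸ hUm i hi a)
      · rw [hi, Function.update_of_ne (hne' j hj), Function.update_self]
        exact fun e => hsU a (e ▸ hUm j hj b)
      · omega
    · have : ∀ P ∈ 𝒬, ∏ i ∈ range (m' + 1), w P (Function.update t m' s i) = Φ P * w P s := by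
        intro P _
        rw [prod_range_succ, Function.update_self]
        congr 1
        refine prod_congr rfl (fun i hi => ?_)
        rw [Function.update_of_ne (hne' i (mem_range.1 hi))]
      rw [sum_congr rfl this]
      calc _ ≤ _ := hs2
        _ ≤ ρ * (ρ ^ m' * (𝒬.card : ℝ)) := mul_le_mul_of_nonneg_left h3 hρ
        _ = _ := by ring

/-- tuples meeting `U` -/
theorem hits_card {V : Type} [Fintype V] (k : ℕ) (U : Finset V) :
    (((univ : Finset (Fin k → V)).filter (fun t => ∃ a, t a ∈ U)).card : ℝ) * Fintype.card V
      ≤ k * U.card * (Fintype.card V : ℝ) ^ k := by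
  have h1 : (univ : Finset (Fin k → V)).filter (fun t => ∃ a, t a ∈ U) ⊆
      (univ : Finset (Fin k)).biUnion (fun a => (univ : Finset (Fin k → V)).filter (fun t => t a ∈ U)) := by
    intro t ht
    obtain ⟨a, ha⟩ := (mem_filter.1 ht).2
    exact mem_biUnion.2 ⟨a, mem_univ _, mem_filter.2 ⟨mem_univ _, ha⟩⟩
  have h2 : ∀ a : Fin k, (((univ : Finset (Fin k → V)).filter (fun t => t a ∈ U)).card) * Fintype.card V
      = U.card * (Fintype.card V) ^ k := by
    intro a
    have e : (univ : Finset (Fin k → V)).filter (fun t => t a ∈ U)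
        = Fintype.piFinset (fun b => if b = a then U else univ) := by
      ext t
      simp only [mem_filter, mem_univ, true_and, Fintype.mem_piFinset]
      constructor
      · intro h b
        split_ifs with hb
        · rw [hb]; exact h
        · exact mem_univ _
      · intro h
        have := h a
        simpa using this
    rw [e, Fintype.card_piFinset, ← mul_prod_erase univ _ (mem_univ a)]
    have : ∏ b ∈ univ.erase a, (if b = a then U else univ : Finset V).card
        = ∏ b ∈ univ.erase a, Fintype.card V := by
      refine prod_congr rfl (fun b hb => ?_)
      rw [if_neg (ne_of_mem_erase hb), card_univ]
    rw [this, prod_const, card_erase_of_mem (mem_univ a), card_univ, Fintype.card_fin, if_pos rfl,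
      mul_assoc, ← pow_succ]
    have := a.pos
    congr 2
    omega
  have h3 := (card_le_card h1).trans card_biUnion_le
  have h4 : ((univ : Finset (Fin k → V)).filter (fun t => ∃ a, t a ∈ U)).card * Fintype.card V
      ≤ k * U.card * (Fintype.card V) ^ k := by
    calc _ ≤ (∑ a : Fin k, ((univ : Finset (Fin k → V)).filter (fun t => t a ∈ U)).card) * Fintype.card V :=
          Nat.mul_le_mul_right _ h3
      _ = ∑ a : Fin k, U.card * (Fintype.card V) ^ k := by
          rw [sum_mul]; exact sum_congr rfl (fun a _ => h2 a)
      _ = _ := by simp; ring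
  exact_mod_cast h4

set_option maxHeartbeats 4000000 in
/-- Absorbing structure for a dense relation between `k`-tuples and a small set. -/
theorem absorber (k : ℕ) (d0 γ : ℝ) (hd0 : 0 < d0) (hd1 : d0 ≤ 1) (hγ : 0 < γ)
    (hγd : γ ≤ d0 / 20) :
    ∃ c : ℝ, 0 < c ∧ c ≤ 1 ∧ ∀ (V Y : Type) [Fintype V] [Nonempty V] (𝒯 : Finset (Fin k → V))
      (F : (Fin k → V) → Y → Prop) (Y1 : Finset Y),
      (Y1.card : ℝ) ≤ c * Fintype.card V → 1 ≤ c * Y1.card →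
      d0 * (Fintype.card V : ℝ) ^ k * Y1.card ≤ eR F 𝒯 Y1 →
      ∃ Ys ⊆ Y1, ∃ (m r : ℕ) (t : Fin m → Fin k → V), (∀ i, t i ∈ 𝒯) ∧
        (∀ i j, i ≠ j → ∀ a b, t i a ≠ t j b) ∧ Ys.card = m + r ∧ c * Y1.card ≤ Ys.card ∧
        2 * γ * Ys.card ≤ r ∧ (r : ℝ) ≤ 6 * γ * Ys.card ∧
        ∀ Y' ⊆ Ys, Y'.card = m → ∃ f : Fin m → Y, Function.Injective f ∧
          ∀ i, f i ∈ Y' ∧ F (t i) (f i) := by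
  set K : ℕ := ⌈1 / γ⌉₊ with hK
  have hKγ : 1 ≤ K * γ := by
    have : 1 / γ ≤ K := Nat.le_ceil _
    rwa [div_le_iff₀ hγ] at this
  set lam : ℝ := 5 ^ K with hlam
  have hlam1 : (K : ℝ) ≤ lam := by
    rw [hlam]
    have : K < 5 ^ K := Nat.lt_pow_self (by norm_num)
    exact_mod_cast this.le
  have hlam0 : 0 < lam := by positivity
  have hlam11 : 1 ≤ lam := one_le_pow₀ (by norm_num)
  set ε : ℝ := 1 / (2 * lam) with hε
  have hε0 : 0 < ε := by positivity
  have hlε : lam * ε = 1 / 2 := by rw [hε]; field_simp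
  have hεγ : ε ≤ γ := by
    rw [hε, div_le_iff₀ (by positivity)]
    nlinarith
  have hγ1 : γ ≤ 1 / 20 := by linarith
  obtain ⟨c1, hc0, hc1, hDI⟩ := densInc ε d0 hε0 (by linarith) hd0 hd1
  have hden : (0:ℝ) < 2 * ((k : ℝ) ^ 2 + 1) := by positivity
  set c : ℝ := min (c1 / 2) (min (γ * c1) (c1 * d0 / (2 * ((k : ℝ) ^ 2 + 1)))) with hc
  have hcpos : 0 < c := by
    rw [hc]; refine lt_min (by positivity) (lt_min (by positivity) (by positivity))
  have hcc1 : c ≤ c1 / 2 := min_le_left _ _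
  have hcγ : c ≤ γ * c1 := (min_le_right _ _).trans (min_le_left _ _)
  have hck : c ≤ c1 * d0 / (2 * ((k : ℝ) ^ 2 + 1)) := (min_le_right _ _).trans (min_le_right _ _)
  refine ⟨c, hcpos, by linarith, ?_⟩
  intro V Y _ _ 𝒯 F Y1 hY1n hY1c hdens
  set n : ℝ := (Fintype.card V : ℝ) with hn
  have hn0 : 0 < n := by rw [hn]; exact_mod_cast Fintype.card_pos
  have hY1pos : (0:ℝ) < Y1.card := by
    by_contra h
    have : (Y1.card : ℝ) ≤ 0 := not_lt.1 h
    nlinarith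
  have hY1ne : Y1.Nonempty := card_pos.1 (by exact_mod_cast hY1pos)
  have h𝒯n : d0 * n ^ k ≤ 𝒯.card := by
    have := hdens.trans (eR_le F 𝒯 Y1)
    exact le_of_mul_le_mul_right this hY1pos
  have h𝒯le : (𝒯.card : ℝ) ≤ n ^ k := by
    have : 𝒯.card ≤ Fintype.card (Fin k → V) := card_le_univ _
    rw [Fintype.card_fun, Fintype.card_fin] at this
    rw [hn]; exact_mod_cast this
  have h𝒯pos : (0:ℝ) < 𝒯.card := lt_of_lt_of_le (by positivity) h𝒯n
  have h𝒯ne : 𝒯.Nonempty := card_pos.1 (by exact_mod_cast h𝒯pos)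
  obtain ⟨𝒯', h𝒯', Y', hY', h𝒯'ne, hY'ne, hc𝒯, hcY, hreg⟩ := hDI _ _ F 𝒯 Y1 h𝒯ne hY1ne (by
    refine le_trans ?_ hdens
    gcongr)
  set y0 : ℕ := Y'.card with hy0
  have hy0γ : 1 ≤ γ * y0 := by
    have : γ * (c1 * Y1.card) ≤ γ * y0 := by gcongr
    nlinarith
  have hy0pos : (0:ℝ) < y0 := by
    by_contra h
    have : (y0 : ℝ) ≤ 0 := not_lt.1 h
    nlinarith
  have hg0 : 0 < γ * y0 := by positivity
  have hgg : γ * (γ * y0) ≤ 1 / 20 * (γ * y0) := by gcongr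
  have hgy : γ * y0 ≤ 1 / 20 * y0 := by gcongr
  have hgd : γ * y0 ≤ d0 / 20 * y0 := by gcongr
  have hy0n : (y0 : ℝ) ≤ c * n := le_trans (by exact_mod_cast card_le_card hY') hY1n
  have h𝒯'pos : (0:ℝ) < 𝒯'.card := by exact_mod_cast h𝒯'ne.card_pos
  set bad : Finset Y → (Fin k → V) → Prop := fun P t =>
    ((P.filter (fun y => F t y)).card : ℝ) < d0 / 2 * P.card with hbad
  set 𝒬 : Finset (Finset Y) := Y'.powerset.filter (fun P => γ * y0 ≤ P.card) with h𝒬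
  have hbadc : ∀ P ∈ 𝒬, ((𝒯'.filter (bad P)).card : ℝ) ≤ ε * 𝒯'.card := by
    intro P hP
    simp only [h𝒬, mem_filter, mem_powerset] at hP
    by_contra hcon
    push Not at hcon
    have h1 := hreg (𝒯'.filter (bad P)) (filter_subset _ _) P hP.1 hcon.le (by
      refine le_trans ?_ hP.2; gcongr)
    have hne : (𝒯'.filter (bad P)).Nonempty := by
      apply card_pos.1
      have : (0:ℝ) < (𝒯'.filter (bad P)).card := lt_of_le_of_lt (by positivity) hcon
      exact_mod_cast this
    have h2 : eR F (𝒯'.filter (bad P)) P < ∑ t ∈ 𝒯'.filter (bad P), d0 / 2 * (P.card : ℝ) :=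
      sum_lt_sum_of_nonempty hne (fun t ht => (mem_filter.1 ht).2)
    rw [sum_const, nsmul_eq_mul] at h2
    linarith
  -- selection
  obtain ⟨t, ht1, ht2, ht3⟩ := select_tuples 𝒯' 𝒬 (fun P t => if bad P t then lam else 1)
    (fun P t => by split_ifs <;> positivity) 2 (by norm_num) y0 (by
    intro U hU
    set av := 𝒯'.filter (fun t => ∀ a, t a ∉ U) with hav
    have hit := hits_card (V := V) k U
    rw [← hn] at hit
    have hUr : (U.card : ℝ) ≤ k * y0 := by exact_mod_cast hU
    set hs := ((univ : Finset (Fin k → V)).filter (fun t => ∃ a, t a ∈ U)) with hhs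
    have h1 : (𝒯'.card : ℝ) ≤ av.card + hs.card := by
      have : 𝒯' ⊆ av ∪ hs := by
        intro t ht
        by_cases h : ∃ a, t a ∈ U
        · exact mem_union_right _ (mem_filter.2 ⟨mem_univ _, h⟩)
        · push Not at h
          exact mem_union_left _ (mem_filter.2 ⟨ht, h⟩)
      exact_mod_cast (card_le_card this).trans (card_union_le _ _)
    have h2 : (hs.card : ℝ) ≤ (k:ℝ) ^ 2 * c * n ^ k := by
      have : (hs.card : ℝ) * n ≤ (k:ℝ) ^ 2 * c * n ^ k * n := by
        refine hit.trans ?_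
        calc (k:ℝ) * U.card * n ^ k ≤ k * (k * (c * n)) * n ^ k := by gcongr; exact hUr.trans (by gcongr)
          _ = _ := by ring
      exact le_of_mul_le_mul_right this hn0
    have h3 : (k:ℝ) ^ 2 * c * n ^ k ≤ 𝒯'.card / 2 := by
      have e1 : c * (2 * ((k:ℝ) ^ 2 + 1)) ≤ c1 * d0 := by rwa [le_div_iff₀ hden] at hck
      have e2 : c1 * (d0 * n ^ k) ≤ 𝒯'.card := le_trans (by gcongr) hc𝒯
      have e3 : c * (2 * ((k:ℝ) ^ 2 + 1)) * n ^ k ≤ c1 * d0 * n ^ k := by gcongr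
      have e4 : 0 ≤ c * n ^ k := by positivity
      linarith
    have h4 : (𝒯'.card : ℝ) / 2 ≤ av.card := by linarith
    refine ⟨card_pos.1 (by
      have : (0:ℝ) < av.card := by linarith
      exact_mod_cast this), ?_⟩
    intro P hP
    have h5 : ∑ t ∈ av, (if bad P t then lam else 1) ≤ av.card + lam * ((𝒯'.filter (bad P)).card : ℝ) := by
      calc ∑ t ∈ av, (if bad P t then lam else 1) ≤ ∑ t ∈ av, (1 + if bad P t then lam else 0) := by
            refine sum_le_sum (fun t _ => ?_)
            split_ifs <;> linarith
        _ = av.card + lam * ((av.filter (bad P)).card : ℝ) := by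
            rw [sum_add_distrib, ← sum_filter, sum_const, sum_const]; simp; ring
        _ ≤ _ := by
            gcongr
            exact filter_subset _ _
    have h6 := hbadc P hP
    have h7 : lam * ((𝒯'.filter (bad P)).card : ℝ) ≤ lam * (ε * 𝒯'.card) := by gcongr
    have h8 : lam * (ε * 𝒯'.card) = 𝒯'.card / 2 := by rw [← mul_assoc, hlε]; ring
    linarith)
  have hb : ∀ P ∈ 𝒬, (((range y0).filter (fun i => bad P (t i))).card : ℝ) < γ * y0 := by
    intro P hP
    by_contra hcon
    push Not at hcon
    set b := ((range y0).filter (fun i => bad P (t i))).card with hbd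
    have h1 : lam ^ b ≤ 2 ^ y0 * 2 ^ y0 := by
      calc lam ^ b = ∏ i ∈ range y0, (if bad P (t i) then lam else 1) := by
            rw [prod_ite, prod_const, prod_const, one_pow, mul_one]
        _ ≤ ∑ P ∈ 𝒬, ∏ i ∈ range y0, (if bad P (t i) then lam else 1) :=
            single_le_sum (f := fun P => ∏ i ∈ range y0, (if bad P (t i) then lam else 1))
              (fun P _ => prod_nonneg (fun i _ => by split_ifs <;> positivity)) hP
        _ ≤ 2 ^ y0 * (𝒬.card : ℝ) := ht3
        _ ≤ 2 ^ y0 * 2 ^ y0 := by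
            gcongr
            have : 𝒬.card ≤ 2 ^ y0 := by
              rw [hy0, ← card_powerset]; exact card_filter_le _ _
            exact_mod_cast this
    have h2 : y0 ≤ K * b := by
      have : (y0 : ℝ) ≤ K * b := by
        have : (K:ℝ) * (γ * y0) ≤ K * b := by gcongr
        nlinarith
      exact_mod_cast this
    have h3 : (5:ℝ) ^ y0 ≤ lam ^ b := by
      rw [hlam, ← pow_mul]; exact pow_le_pow_right₀ (by norm_num) h2
    have h4 : (2:ℝ) ^ y0 * 2 ^ y0 = 4 ^ y0 := by rw [← mul_pow]; norm_num
    have h5 : (4:ℝ) ^ y0 < 5 ^ y0 := pow_lt_pow_left₀ (by norm_num) (by norm_num) (by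
      have : 0 < y0 := by exact_mod_cast hy0pos
      omega)
    linarith
  -- number of indices that are adjacent to a colour
  set nb : Y → ℕ := fun y => ((range y0).filter (fun i => F (t i) y)).card with hnb
  set P0 : Finset Y := Y'.filter (fun y => (nb y : ℝ) < d0 / 4 * y0) with hP0
  have hP0c : (P0.card : ℝ) < γ * y0 := by
    by_contra hcon
    push Not at hcon
    have hPm : P0 ∈ 𝒬 := by
      simp only [h𝒬, mem_filter, mem_powerset]; exact ⟨filter_subset _ _, hcon⟩
    have h1 := hb P0 hPm
    have hP0pos : (0:ℝ) < P0.card := lt_of_lt_of_le (by positivity) hcon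
    have hP0ne : P0.Nonempty := card_pos.1 (by exact_mod_cast hP0pos)
    have h2 : ∑ i ∈ range y0, ((P0.filter (fun y => F (t i) y)).card : ℝ) = ∑ y ∈ P0, (nb y : ℝ) := by
      simp only [hnb, card_filter]
      push_cast
      rw [sum_comm]
    have h3 : ∑ y ∈ P0, (nb y : ℝ) < ∑ y ∈ P0, d0 / 4 * (y0:ℝ) :=
      sum_lt_sum_of_nonempty hP0ne (fun y hy => (mem_filter.1 hy).2)
    rw [sum_const, nsmul_eq_mul] at h3
    have h4 : ∑ i ∈ range y0, (if bad P0 (t i) then (0:ℝ) else d0 / 2 * P0.card) ≤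
        ∑ i ∈ range y0, ((P0.filter (fun y => F (t i) y)).card : ℝ) := by
      refine sum_le_sum (fun i _ => ?_)
      split_ifs with h
      · positivity
      · exact not_lt.1 h
    have h5 : ∑ i ∈ range y0, (if bad P0 (t i) then (0:ℝ) else d0 / 2 * P0.card)
        = ((y0:ℝ) - ((range y0).filter (fun i => bad P0 (t i))).card) * (d0 / 2 * P0.card) := by
      have : (y0:ℝ) = ((range y0).filter (fun i => bad P0 (t i))).card +
          ((range y0).filter (fun i => ¬ bad P0 (t i))).card := by
        have := card_filter_add_card_filter_not (s := range y0) (fun i => bad P0 (t i))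
        rw [card_range] at this
        exact_mod_cast this.symm
      rw [sum_ite, sum_const, sum_const, this]
      simp
    have h6 : (y0:ℝ) / 2 * (d0 / 2 * P0.card) ≤
        ((y0:ℝ) - ((range y0).filter (fun i => bad P0 (t i))).card) * (d0 / 2 * P0.card) := by
      gcongr
      linarith
    linarith
  set Ys := Y' \ P0 with hYs
  have hYsY' : Ys ⊆ Y' := sdiff_subset
  have hYsc : (Ys.card : ℝ) = y0 - P0.card := by
    rw [hYs, cast_card_sdiff (filter_subset _ _)]
  have hYsQ : Ys ∈ 𝒬 := by
    simp only [h𝒬, mem_filter, mem_powerset]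
    refine ⟨hYsY', ?_⟩
    rw [hYsc]; linarith
  have hYsle : (Ys.card : ℝ) ≤ y0 := by exact_mod_cast card_le_card hYsY'
  have hYsge : (1 - γ) * y0 ≤ Ys.card := by rw [hYsc]; linarith
  set I' := (range y0).filter (fun i => ¬ bad Ys (t i)) with hI'
  have hI'c : (1 - γ) * y0 ≤ I'.card := by
    have := card_filter_add_card_filter_not (s := range y0) (fun i => bad Ys (t i))
    rw [card_range] at this
    have h2 : (((range y0).filter (fun i => bad Ys (t i))).card : ℝ) + I'.card = y0 := by
      exact_mod_cast this
    have := hb Ys hYsQ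
    linarith
  set r : ℕ := ⌈2 * γ * y0⌉₊ with hr
  have hr1 : 2 * γ * y0 ≤ r := Nat.le_ceil _
  have hr2 : (r : ℝ) < 2 * γ * y0 + 1 := Nat.ceil_lt_add_one (by positivity)
  have hry : (r:ℝ) ≤ Ys.card := by linarith
  have hry' : r ≤ Ys.card := by exact_mod_cast hry
  obtain ⟨m, hmr⟩ : ∃ m, Ys.card = m + r := ⟨Ys.card - r, by omega⟩
  have hmr' : (Ys.card : ℝ) = m + r := by exact_mod_cast hmr
  have hmI : m ≤ I'.card := by
    have : (m:ℝ) ≤ I'.card := by linarith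
    exact_mod_cast this
  obtain ⟨I, hII', hIc⟩ := exists_subset_card_eq hmI
  set ι : Fin m ↪o ℕ := I.orderEmbOfFin hIc with hι
  have hιI : ∀ i, ι i ∈ I := fun i => I.orderEmbOfFin_mem hIc i
  have hιI' : ∀ i, ι i ∈ I' := fun i => hII' (hιI i)
  have hιlt : ∀ i, ι i < y0 := fun i => mem_range.1 (mem_filter.1 (hιI' i)).1
  refine ⟨Ys, hYsY'.trans hY', m, r, fun i => t (ι i), ?_, ?_, hmr, ?_, ?_, ?_, ?_⟩
  · exact fun i => h𝒯' (ht1 _ (hιlt i))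
  · intro i j hij
    exact ht2 _ (hιlt i) _ (hιlt j) (fun e => hij (ι.injective e))
  · have : c * Y1.card ≤ c1 / 2 * Y1.card := by gcongr
    linarith
  · have : 2 * γ * Ys.card ≤ 2 * γ * y0 := by gcongr
    linarith
  · have : 6 * γ * ((1 - γ) * y0) ≤ 6 * γ * Ys.card := by gcongr
    linarith
  · intro Z hZ hZm
    have hZY' : Z ⊆ Y' := hZ.trans hYsY'
    have hZm' : (Z.card : ℝ) = m := by exact_mod_cast hZm
    suffices hall : ∀ S : Finset (Fin m), S.card ≤
        (S.biUnion (fun i => Z.filter (fun y => F (t (ι i)) y))).card by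
      obtain ⟨f, hf1, hf2⟩ := (Finset.all_card_le_biUnion_card_iff_exists_injective _).1 hall
      exact ⟨f, hf1, fun i => mem_filter.1 (hf2 i)⟩
    intro S
    set N := S.biUnion (fun i => Z.filter (fun y => F (t (ι i)) y)) with hN
    have hNZ : N ⊆ Z := biUnion_subset.2 (fun i _ => filter_subset _ _)
    by_contra hlt
    push Not at hlt
    have hltr : (N.card : ℝ) < S.card := by exact_mod_cast hlt
    have hSne : S.Nonempty := card_pos.1 (by omega)
    -- S is large
    have hSbig : γ * y0 < S.card := by
      obtain ⟨i, hi⟩ := hSne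
      have h1 : Z.filter (fun y => F (t (ι i)) y) ⊆ N :=
        subset_biUnion_of_mem (fun i => Z.filter (fun y => F (t (ι i)) y)) hi
      have h2 : d0 / 2 * Ys.card ≤ ((Ys.filter (fun y => F (t (ι i)) y)).card : ℝ) :=
        not_lt.1 (mem_filter.1 (hιI' i)).2
      have h3 : Ys.filter (fun y => F (t (ι i)) y) ⊆ Z.filter (fun y => F (t (ι i)) y) ∪ (Ys \ Z) := by
        intro y hy
        rw [mem_filter] at hy
        by_cases hyZ : y ∈ Z
        · exact mem_union_left _ (mem_filter.2 ⟨hyZ, hy.2⟩)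
        · exact mem_union_right _ (mem_sdiff.2 ⟨hy.1, hyZ⟩)
      have h4 : ((Ys.filter (fun y => F (t (ι i)) y)).card : ℝ) ≤ N.card + ((Ys \ Z).card : ℝ) := by
        have := (card_le_card h3).trans (card_union_le _ _)
        have h5 := card_le_card h1
        exact_mod_cast this.trans (by omega)
      rw [cast_card_sdiff hZ] at h4
      have h6 : 10 * γ * ((1 - γ) * y0) ≤ d0 / 2 * Ys.card := by
        refine mul_le_mul (by linarith) hYsge ?_ (by positivity)
        have : (0:ℝ) ≤ 1 - γ := by linarith
        positivity
      linarith
    set P := Z \ N with hP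
    have hPc : (P.card : ℝ) = m - N.card := by rw [hP, cast_card_sdiff hNZ, hZm']
    have hnoF : ∀ i ∈ S, ∀ y ∈ P, ¬ F (t (ι i)) y := by
      intro i hi y hy hF
      have hy' := mem_sdiff.1 hy
      exact hy'.2 (mem_biUnion.2 ⟨i, hi, mem_filter.2 ⟨hy'.1, hF⟩⟩)
    have hPsmall : (P.card : ℝ) < γ * y0 := by
      by_contra hcon
      push Not at hcon
      have hPQ : P ∈ 𝒬 := by
        simp only [h𝒬, mem_filter, mem_powerset]
        exact ⟨sdiff_subset.trans hZY', hcon⟩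
      have h1 := hb P hPQ
      have hPpos : (0:ℝ) < P.card := lt_of_lt_of_le (by positivity) hcon
      have h2 : S.card ≤ ((range y0).filter (fun i => bad P (t i))).card := by
        rw [← card_map ι.toEmbedding]
        apply card_le_card
        intro j hj
        obtain ⟨i, hi, rfl⟩ := mem_map.1 hj
        refine mem_filter.2 ⟨mem_range.2 (hιlt i), ?_⟩
        have : P.filter (fun y => F (t (ι i)) y) = ∅ :=
          filter_eq_empty_iff.2 (fun y hy => hnoF i hi y hy)
        simp only [hbad]
        change ((P.filter (fun y => F (t (ι i)) y)).card : ℝ) < _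
        rw [this]
        simp only [card_empty, Nat.cast_zero]
        positivity
      have h2' : (S.card : ℝ) ≤ ((range y0).filter (fun i => bad P (t i))).card := by exact_mod_cast h2
      linarith
    rcases P.eq_empty_or_nonempty with hPe | ⟨y, hy⟩
    · have : (P.card : ℝ) = 0 := by rw [hPe]; simp
      have hSm : S.card ≤ m := by simpa using card_le_univ S
      have hSm' : (S.card : ℝ) ≤ m := by exact_mod_cast hSm
      linarith
    · have hyYs : y ∈ Ys := hZ (mem_sdiff.1 hy).1
      have hnby : d0 / 4 * y0 ≤ nb y := by
        by_contra hcon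
        push Not at hcon
        exact (mem_sdiff.1 hyYs).2 (mem_filter.2 ⟨hYsY' hyYs, hcon⟩)
      have h1 : (range y0).filter (fun i => F (t i) y) ⊆ (range y0 \ I) ∪ (univ \ S).map ι.toEmbedding := by
        intro j hj
        rw [mem_filter] at hj
        by_cases hjI : j ∈ I
        · apply mem_union_right
          have : j ∈ Set.range ι := by rw [hι, range_orderEmbOfFin]; exact hjI
          obtain ⟨i, rfl⟩ := this
          refine mem_map.2 ⟨i, mem_sdiff.2 ⟨mem_univ _, fun hi => hnoF i hi y hy hj.2⟩, rfl⟩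
        · exact mem_union_left _ (mem_sdiff.2 ⟨hj.1, hjI⟩)
      have h2 := (card_le_card h1).trans (card_union_le _ _)
      rw [card_map] at h2
      have h3 : (nb y : ℝ) ≤ ((range y0 \ I).card : ℝ) + (((univ : Finset (Fin m)) \ S).card : ℝ) := by
        exact_mod_cast h2
      rw [cast_card_sdiff (subset_univ S), cast_card_sdiff (hII'.trans (filter_subset _ _)),
        card_range, hIc, card_univ, Fintype.card_fin] at h3
      linarith

/-- typical cliques -/
noncomputable def cliqT {V : Type} [Fintype V] (J L : SimpleGraph V) (θ : ℝ) (A S1 S2 : Finset V) (k : ℕ) :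
    Finset (Fin k → V) :=
  univ.filter (fun t => (∀ a, t a ∈ A) ∧ (∀ a b, a ≠ b → J.Adj (t a) (t b)) ∧
    θ ^ k * (A.card : ℝ) ≤ ((A.filter (fun v => ∀ a, J.Adj (t a) v)).card : ℝ) ∧
    θ ^ k * (S1.card : ℝ) ≤ ((S1.filter (fun v => ∀ a, L.Adj (t a) v)).card : ℝ) ∧
    θ ^ k * (S2.card : ℝ) ≤ ((S2.filter (fun v => ∀ a, L.Adj (t a) v)).card : ℝ))

set_option maxHeartbeats 2000000 in
theorem cliq_count {V : Type} [Fintype V] (J L : SimpleGraph V) (s θ : ℝ) (hθ0 : 0 < θ) (hθ1 : θ ≤ 1)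
    (hJ : LD J s θ) (hL : LD L s θ) (A S1 S2 : Finset V) (D : ℕ)
    (hA : s ≤ θ ^ D * A.card) (hS1 : s ≤ θ ^ D * S1.card) (hS2 : s ≤ θ ^ D * S2.card)
    (x : ℝ) (hx0 : 0 ≤ x) (hx : x + 3 * s ≤ θ ^ D * A.card) (k : ℕ) (hk : k ≤ D) :
    x ^ k ≤ ((cliqT J L θ A S1 S2 k).card : ℝ) := by
  induction k with
  | zero =>
    have h : (fun a => a.elim0 : Fin 0 → V) ∈ cliqT J L θ A S1 S2 0 := by
      simp [cliqT]; exact Subsingleton.elim _ _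
    rw [pow_zero]
    exact_mod_cast card_pos.2 ⟨_, h⟩
  | succ k ih =>
    have ih := ih (by omega)
    have hpow : ∀ y : ℝ, 0 ≤ y → θ ^ D * y ≤ θ ^ k * y := fun y hy =>
      mul_le_mul_of_nonneg_right (pow_le_pow_of_le_one hθ0.le hθ1 (by omega)) hy
    set bd : SimpleGraph V → Finset V → Finset V := fun J B => (univ : Finset V).filter
      (fun v => ((B.filter (fun w => J.Adj v w)).card : ℝ) < θ * (B.card : ℝ)) with hbd
    set gd : (Fin k → V) → Finset V := fun t =>
      (A.filter (fun v => ∀ a, J.Adj (t a) v)) \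
        (bd J (A.filter (fun v => ∀ a, J.Adj (t a) v)) ∪ (bd L (S1.filter (fun v => ∀ a, L.Adj (t a) v)) ∪
          bd L (S2.filter (fun v => ∀ a, L.Adj (t a) v)))) with hgd
    have hgdc : ∀ t ∈ cliqT J L θ A S1 S2 k, x ≤ ((gd t).card : ℝ) := by
      intro t ht
      obtain ⟨-, h1, h2, h3, h4, h5⟩ := mem_filter.1 ht
      have e1 := hJ _ (hA.trans ((hpow _ (by positivity)).trans h3))
      have e2 := hL _ (hS1.trans ((hpow _ (by positivity)).trans h4))
      have e3 := hL _ (hS2.trans ((hpow _ (by positivity)).trans h5))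
      have e4 : ((A.filter (fun v => ∀ a, J.Adj (t a) v)).card : ℝ) ≤ ((gd t).card : ℝ) +
        (((bd J (A.filter (fun v => ∀ a, J.Adj (t a) v))).card : ℝ) + (((bd L (S1.filter (fun v => ∀ a, L.Adj (t a) v))).card : ℝ)
          + ((bd L (S2.filter (fun v => ∀ a, L.Adj (t a) v))).card : ℝ))) := by
        have f1 := card_le_card_sdiff_add_card (s := A.filter (fun v => ∀ a, J.Adj (t a) v))
          (t := bd J (A.filter (fun v => ∀ a, J.Adj (t a) v)) ∪ (bd L (S1.filter (fun v => ∀ a, L.Adj (t a) v)) ∪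
          bd L (S2.filter (fun v => ∀ a, L.Adj (t a) v))))
        have f2 := card_union_le (bd J (A.filter (fun v => ∀ a, J.Adj (t a) v))) (bd L (S1.filter (fun v => ∀ a, L.Adj (t a) v)) ∪
          bd L (S2.filter (fun v => ∀ a, L.Adj (t a) v)))
        have f3 := card_union_le (bd L (S1.filter (fun v => ∀ a, L.Adj (t a) v))) (bd L (S2.filter (fun v => ∀ a, L.Adj (t a) v)))
        norm_cast
        simp only [hgd]
        omega
      have e5 := hpow _ (Nat.cast_nonneg A.card)
      simp only [hbd] at e4
      linarith
    have himg : ((cliqT J L θ A S1 S2 k).sigma gd).image (fun p => (Fin.cons p.2 p.1 : Fin (k+1) → V))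
        ⊆ cliqT J L θ A S1 S2 (k+1) := by
      intro u hu
      obtain ⟨⟨t, v⟩, hp, rfl⟩ := mem_image.1 hu
      obtain ⟨ht, hv⟩ := mem_sigma.1 hp
      obtain ⟨-, h1, h2, h3, h4, h5⟩ := mem_filter.1 ht
      simp only [hgd, mem_sdiff, mem_union, not_or, mem_filter] at hv
      obtain ⟨⟨hvA, hvJ⟩, hb1, hb2, hb3⟩ := hv
      have key : ∀ (J' : SimpleGraph V) (B : Finset V),
          θ ^ k * (B.card : ℝ) ≤ ((B.filter (fun v => ∀ a, J'.Adj (t a) v)).card : ℝ) →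
          v ∉ bd J' (B.filter (fun v => ∀ a, J'.Adj (t a) v)) →
          θ ^ (k+1) * (B.card : ℝ) ≤
            ((B.filter (fun w => ∀ a, J'.Adj ((Fin.cons v t : Fin (k+1) → V) a) w)).card : ℝ) := by
        intro J' B q1 q2
        simp only [hbd, mem_filter, mem_univ, true_and, not_lt] at q2
        have e : B.filter (fun w => ∀ a, J'.Adj ((Fin.cons v t : Fin (k+1) → V) a) w)
            = (B.filter (fun v => ∀ a, J'.Adj (t a) v)).filter (fun w => J'.Adj v w) := by
          ext w
          simp only [mem_filter, Fin.forall_fin_succ, Fin.cons_zero, Fin.cons_succ]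
          tauto
        rw [e, pow_succ]
        refine le_trans ?_ q2
        calc θ ^ k * θ * (B.card:ℝ) = θ * (θ ^ k * B.card) := by ring
          _ ≤ _ := mul_le_mul_of_nonneg_left q1 hθ0.le
      refine mem_filter.2 ⟨mem_univ _, ?_, ?_, key J A h3 hb1, key L S1 h4 hb2, key L S2 h5 hb3⟩
      · intro a
        refine Fin.cases ?_ (fun a => ?_) a
        · exact hvA
        · exact h1 a
      · intro a b
        refine Fin.cases ?_ (fun a => ?_) a <;> refine Fin.cases ?_ (fun b => ?_) b
        · intro h; exact absurd rfl h
        · intro _; exact (hvJ b).symm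
        · intro _; exact hvJ a
        · intro h
          exact h2 a b (fun e => h (by rw [e]))
    have hinj : Function.Injective
        (fun p : (_ : Fin k → V) × V => (Fin.cons p.2 p.1 : Fin (k+1) → V)) := by
      rintro ⟨t, v⟩ ⟨t', v'⟩ h
      obtain ⟨rfl, rfl⟩ := Fin.cons_injective2 h
      rfl
    have hc := card_le_card himg
    rw [card_image_of_injective _ hinj, card_sigma] at hc
    have hc' : ∑ t ∈ cliqT J L θ A S1 S2 k, ((gd t).card : ℝ) ≤ ((cliqT J L θ A S1 S2 (k+1)).card : ℝ) := by
      exact_mod_cast hc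
    refine le_trans ?_ hc'
    calc x ^ (k+1) = x ^ k * x := pow_succ _ _
      _ ≤ (cliqT J L θ A S1 S2 k).card * x := mul_le_mul_of_nonneg_right ih hx0
      _ = ∑ t ∈ cliqT J L θ A S1 S2 k, x := by simp
      _ ≤ _ := sum_le_sum hgdc

/-- ordered adjacent pairs of a graph -/
theorem two_edges {V : Type} [Fintype V] (G : SimpleGraph V) :
    ((univ : Finset (V × V)).filter (fun p => G.Adj p.1 p.2)).card = 2 * edgeCnt G := by
  have h1 : edgeCnt G = G.edgeFinset.card := by
    unfold edgeCnt
    congr 1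
    ext e
    simp
  rw [h1, ← SimpleGraph.sum_degrees_eq_twice_card_edges]
  rw [card_filter, ← univ_product_univ, sum_product]
  refine sum_congr rfl (fun v _ => ?_)
  rw [← card_filter, ← SimpleGraph.card_neighborFinset_eq_degree]
  congr 1
  ext w
  simp

set_option maxHeartbeats 2000000 in
/-- disjoint typical pairs such that each colour appears on many of them -/
theorem cover_pairs {V C : Type} [Fintype V] [Nonempty V] [Fintype C] (G : C → SimpleGraph V) (a n : ℝ)
    (ha0 : 0 < a) (ha1 : a ≤ 1) (hn : (Fintype.card V : ℝ) = n)
    (hG : ∀ c, a * n ^ 2 ≤ edgeCnt (G c)) (J : SimpleGraph V) (s θ : ℝ) (hs0 : 0 ≤ s) (hθ0 : 0 < θ)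
    (hJ : LD J s θ) (S U0 : Finset V) (hS : s ≤ S.card) (hSθ : s ≤ θ * S.card) (t : ℕ)
    (hsize : 2 * t + U0.card + s ≤ a / 2 * n) (hC : (1 - a / 4) ^ t * (Fintype.card C : ℝ) ≤ 1)
    (ht : 0 < t) (hC0 : 0 < Fintype.card C) :
    ∃ p : ℕ → Fin 2 → V, (∀ i < t, p i 0 ≠ p i 1 ∧ (∀ a, p i a ∉ U0) ∧
        θ ^ 2 * (S.card : ℝ) ≤ ((S.filter (fun v => ∀ a, J.Adj (p i a) v)).card : ℝ)) ∧
      (∀ i < t, ∀ j < t, i ≠ j → ∀ a b, p i a ≠ p j b) ∧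
      ∀ c, a / 4 * t ≤ (((range t).filter (fun i => (G c).Adj (p i 0) (p i 1))).card : ℝ) := by
  set 𝒯 : Finset (Fin 2 → V) := univ.filter (fun p => p 0 ≠ p 1 ∧ (∀ a, p a ∉ U0) ∧
        θ ^ 2 * (S.card : ℝ) ≤ ((S.filter (fun v => ∀ a, J.Adj (p a) v)).card : ℝ)) with h𝒯
  set E : C → Finset (Fin 2 → V) := fun c => univ.filter (fun p => (G c).Adj (p 0) (p 1)) with hE
  have hn0 : 0 < n := by rw [← hn]; exact_mod_cast Fintype.card_pos
  have hEc : ∀ c, 2 * a * n ^ 2 ≤ ((E c).card : ℝ) := by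
    intro c
    have : (E c).card = 2 * edgeCnt (G c) := by
      rw [← two_edges]
      refine card_equiv (finTwoArrowEquiv V) ?_
      intro p
      simp [hE, finTwoArrowEquiv]
    rw [this]; push_cast
    have := hG c
    linarith
  -- atypical pairs
  set b1 : Finset V := univ.filter (fun v => ((S.filter (fun w => J.Adj v w)).card : ℝ) < θ * (S.card : ℝ)) with hb1
  have hb1c : (b1.card : ℝ) ≤ s := hJ S hS
  set b2 : V → Finset V := fun x => univ.filter (fun v => (((S.filter (fun w => J.Adj x w)).filter (fun w => J.Adj v w)).card : ℝ)
      < θ * ((S.filter (fun w => J.Adj x w)).card : ℝ)) with hb2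
  set AT : Finset (Fin 2 → V) := univ.filter (fun p => p 0 ∈ b1 ∨ (p 0 ∉ b1 ∧ p 1 ∈ b2 (p 0))) with hAT
  have hATc : (AT.card : ℝ) ≤ 2 * s * n := by
    have e : AT.card = ((univ : Finset (V × V)).filter (fun p => p.1 ∈ b1 ∨ (p.1 ∉ b1 ∧ p.2 ∈ b2 p.1))).card := by
      refine card_equiv (finTwoArrowEquiv V) ?_
      intro p
      simp [hAT, finTwoArrowEquiv]
    have e2 : (univ : Finset (V × V)).filter (fun p => p.1 ∈ b1 ∨ (p.1 ∉ b1 ∧ p.2 ∈ b2 p.1)) ⊆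
        (b1 ×ˢ univ) ∪ ((univ \ b1).sigma b2).image (fun q => (q.1, q.2)) := by
      rintro ⟨x, y⟩ hp
      simp only [mem_filter, mem_univ, true_and] at hp
      rcases hp with h | h
      · exact mem_union_left _ (by simp [h])
      · apply mem_union_right
        refine mem_image.2 ⟨⟨x, y⟩, ?_, rfl⟩
        simp only [mem_sigma, mem_sdiff, mem_univ, true_and]
        exact h
    have e3 := (card_le_card e2).trans (card_union_le _ _)
    have e4 := card_image_le (s := (univ \ b1).sigma b2) (f := fun q => (q.1, q.2))
    rw [card_sigma] at e4
    rw [card_product, card_univ] at e3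
    have e5 : ∑ x ∈ univ \ b1, ((b2 x).card : ℝ) ≤ s * n := by
      calc ∑ x ∈ univ \ b1, ((b2 x).card : ℝ) ≤ ∑ x ∈ univ \ b1, s := by
            refine sum_le_sum (fun x hx => ?_)
            apply hJ
            simp only [hb1, mem_sdiff, mem_filter, mem_univ, true_and, not_lt] at hx
            exact hSθ.trans hx
        _ = ((univ \ b1).card : ℝ) * s := by simp
        _ ≤ n * s := by
            gcongr
            rw [← hn, ← card_univ]
            exact_mod_cast card_le_card sdiff_subset
        _ = _ := by ring
    have e6 : (AT.card : ℝ) ≤ b1.card * (Fintype.card V : ℝ) + ∑ x ∈ univ \ b1, ((b2 x).card : ℝ) := by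
      rw [e]
      exact_mod_cast e3.trans (by omega)
    rw [hn] at e6
    have : (b1.card : ℝ) * n ≤ s * n := by gcongr
    linarith
  have htyp : ∀ p : Fin 2 → V, p ∉ AT →
      θ ^ 2 * (S.card : ℝ) ≤ ((S.filter (fun v => ∀ a, J.Adj (p a) v)).card : ℝ) := by
    intro p hp
    simp only [hAT, mem_filter, mem_univ, true_and, not_or, not_and] at hp
    have q2 := hp.2 hp.1
    have q1 := hp.1
    simp only [hb1, hb2, mem_filter, mem_univ, true_and, not_lt] at q1 q2
    have e : S.filter (fun v => ∀ a, J.Adj (p a) v)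
        = (S.filter (fun w => J.Adj (p 0) w)).filter (fun w => J.Adj (p 1) w) := by
      ext w
      simp [Fin.forall_fin_two, and_assoc]
    rw [e]
    refine le_trans ?_ q2
    calc θ ^ 2 * (S.card : ℝ) = θ * (θ * S.card) := by ring
      _ ≤ _ := by gcongr
  obtain ⟨p, hp1, hp2, hp3⟩ := select_tuples 𝒯 (univ : Finset C)
    (fun c p => if p ∈ E c then 1 / 2 else 1) (fun c p => by split_ifs <;> norm_num) (1 - a / 2)
    (by linarith) t (by
    intro U hU
    set av := 𝒯.filter (fun t => ∀ a, t a ∉ U) with hav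
    have hUr : (U.card : ℝ) ≤ 2 * t := by exact_mod_cast hU
    have hEav : ∀ c, a * n ^ 2 ≤ ((av.filter (fun p => p ∈ E c)).card : ℝ) := by
      intro c
      have hit := hits_card (V := V) 2 (U ∪ U0)
      rw [hn] at hit
      have hsub : E c ⊆ av.filter (fun p => p ∈ E c) ∪ (AT ∪
          (univ : Finset (Fin 2 → V)).filter (fun t => ∃ a, t a ∈ U ∪ U0)) := by
        intro q hq
        by_cases h1 : q ∈ AT
        · exact mem_union_right _ (mem_union_left _ h1)
        by_cases h2 : ∃ a, q a ∈ U ∪ U0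
        · exact mem_union_right _ (mem_union_right _ (mem_filter.2 ⟨mem_univ _, h2⟩))
        push Not at h2
        apply mem_union_left
        have hadj : (G c).Adj (q 0) (q 1) := (mem_filter.1 hq).2
        refine mem_filter.2 ⟨mem_filter.2 ⟨mem_filter.2 ⟨mem_univ _, hadj.ne, ?_, htyp q h1⟩, ?_⟩, hq⟩
        · exact fun a ha => h2 a (mem_union_right _ ha)
        · exact fun a ha => h2 a (mem_union_left _ ha)
      have h3 : ((E c).card : ℝ) ≤ ((av.filter (fun p => p ∈ E c)).card : ℝ) + (AT.card +
          ((univ : Finset (Fin 2 → V)).filter (fun t => ∃ a, t a ∈ U ∪ U0)).card) := by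
        have := (card_le_card hsub).trans (card_union_le _ _)
        have h4 := card_union_le AT ((univ : Finset (Fin 2 → V)).filter (fun t => ∃ a, t a ∈ U ∪ U0))
        exact_mod_cast this.trans (by omega)
      have h5 : (((univ : Finset (Fin 2 → V)).filter (fun t => ∃ a, t a ∈ U ∪ U0)).card : ℝ) ≤
          2 * (2 * t + U0.card) * n := by
        have hcu : ((U ∪ U0).card : ℝ) ≤ 2 * t + U0.card := by
          have : ((U ∪ U0).card : ℝ) ≤ U.card + U0.card := by exact_mod_cast card_union_le _ _
          linarith
        have : (((univ : Finset (Fin 2 → V)).filter (fun t => ∃ a, t a ∈ U ∪ U0)).card : ℝ) * n ≤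
          2 * (2 * t + U0.card) * n * n := by
          refine hit.trans ?_
          push_cast
          calc 2 * ((U ∪ U0).card : ℝ) * n ^ 2 ≤ 2 * (2 * t + U0.card) * n ^ 2 := by gcongr
            _ = _ := by ring
        exact le_of_mul_le_mul_right this hn0
      have h6 : 2 * (2 * t + U0.card + s) * n ≤ 2 * (a / 2 * n) * n := by gcongr
      have := hEc c
      nlinarith
    have havle : (av.card : ℝ) ≤ n ^ 2 := by
      have : av.card ≤ Fintype.card (Fin 2 → V) := card_le_univ _
      rw [Fintype.card_fun, Fintype.card_fin] at this
      rw [← hn]; exact_mod_cast this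
    constructor
    · obtain ⟨c⟩ := Fintype.card_pos_iff.1 hC0
      have h1 := hEav c
      have h2 : (0:ℝ) < ((av.filter (fun p => p ∈ E c)).card : ℝ) := lt_of_lt_of_le (by positivity) h1
      have h3 : 0 < (av.filter (fun p => p ∈ E c)).card := by exact_mod_cast h2
      exact (card_pos.1 h3).mono (filter_subset _ _)
    · intro c _
      have h1 := hEav c
      have h2 : ∑ p ∈ av, (if p ∈ E c then (1/2 : ℝ) else 1) =
          av.card - 1 / 2 * ((av.filter (fun p => p ∈ E c)).card : ℝ) := by
        have : ∀ p ∈ av, (if p ∈ E c then (1/2 : ℝ) else 1) = 1 - if p ∈ E c then (1/2 : ℝ) else 0 := by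
          intro p _; split_ifs <;> norm_num
        rw [sum_congr rfl this, sum_sub_distrib, ← sum_filter, sum_const, sum_const]
        simp; ring
      rw [h2]
      nlinarith)
  refine ⟨p, ?_, hp2, ?_⟩
  · intro i hi
    exact (mem_filter.1 (hp1 i hi)).2
  · intro c
    by_contra hcon
    push Not at hcon
    set N := ((range t).filter (fun i => (G c).Adj (p i 0) (p i 1))).card with hN
    have h1 : (1/2 : ℝ) ^ N ≤ (1 - a / 2) ^ t * Fintype.card C := by
      rw [card_univ] at hp3
      calc (1/2 : ℝ) ^ N = ∏ i ∈ range t, (if p i ∈ E c then (1/2 : ℝ) else 1) := by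
            rw [prod_ite, prod_const, prod_const, one_pow, mul_one, hN]
            simp [hE]
        _ ≤ ∑ c : C, ∏ i ∈ range t, (if p i ∈ E c then (1/2 : ℝ) else 1) :=
            single_le_sum (f := fun c => ∏ i ∈ range t, (if p i ∈ E c then (1/2 : ℝ) else 1))
              (fun c _ => prod_nonneg (fun i _ => by split_ifs <;> norm_num)) (mem_univ c)
        _ ≤ _ := hp3
    have h2 : (2:ℝ) ^ N ≤ (1 + a / 4) ^ t := by
      have e1 : (2:ℝ) ^ (a/4) ≤ 1 + a / 4 := by
        have := rpow_one_add_le_one_add_mul_self (s := 1) (p := a/4) (by norm_num) (by linarith) (by linarith)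
        norm_num at this
        exact this
      calc (2:ℝ) ^ N = (2:ℝ) ^ (N:ℝ) := (Real.rpow_natCast _ _).symm
        _ ≤ (2:ℝ) ^ (a/4 * t) := Real.rpow_le_rpow_of_exponent_le (by norm_num) hcon.le
        _ = ((2:ℝ) ^ (a/4)) ^ t := by rw [Real.rpow_mul (by norm_num), Real.rpow_natCast]
        _ ≤ _ := pow_le_pow_left₀ (by positivity) e1 _
    have h3 : 1 ≤ (1 + a / 4) ^ t * ((1 - a / 2) ^ t * Fintype.card C) := by
      calc (1:ℝ) = 2 ^ N * (1/2) ^ N := by rw [← mul_pow]; norm_num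
        _ ≤ _ := mul_le_mul h2 h1 (by positivity) (by positivity)
    have h4 : (1 + a / 4) ^ t * ((1 - a / 2) ^ t * Fintype.card C) < (1 - a / 4) ^ t * Fintype.card C := by
      rw [← mul_assoc, ← mul_pow]
      have hCr : (0:ℝ) < Fintype.card C := by exact_mod_cast hC0
      refine mul_lt_mul_of_pos_right ?_ hCr
      refine pow_lt_pow_left₀ ?_ ?_ (by omega)
      · nlinarith
      · have : 0 ≤ (1 + a/4) := by linarith
        have : 0 ≤ (1 - a/2) := by linarith
        positivity
    linarith

/-- a separator with its classes -/
structure HS {W : Type} [Fintype W] (H : SimpleGraph W) (X : Finset W) (cls : W → Finset W) (mu : ℝ) : Prop where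
  hX : (X.card : ℝ) ≤ mu
  mem : ∀ w, w ∉ X → w ∈ cls w
  nX : ∀ w, ∀ u ∈ cls w, u ∉ X
  eq : ∀ w, ∀ u ∈ cls w, cls u = cls w
  adj : ∀ u w, u ∉ X → w ∉ X → H.Adj u w → cls u = cls w
  small : ∀ w, ((cls w).card : ℝ) ≤ mu

theorem HS_of_sep {W : Type} [Fintype W] (H : SimpleGraph W) (μ : ℝ) (h : Separable H μ) :
    ∃ X cls, HS H X cls (μ * (Fintype.card W : ℝ)) := by
  obtain ⟨X, hX, hK⟩ := h
  have hμ : 0 ≤ μ * (Fintype.card W : ℝ) := le_trans (by positivity) hX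
  set K := SimpleGraph.induce ((↑X : Set W)ᶜ) H with hKd
  have hm : ∀ w, w ∉ X → w ∈ ((↑X : Set W)ᶜ) := fun w hw => by simpa using hw
  set cls : W → Finset W := fun w => univ.filter (fun u => ∃ (hu : u ∉ X) (hw : w ∉ X),
    K.connectedComponentMk ⟨u, hm u hu⟩ = K.connectedComponentMk ⟨w, hm w hw⟩) with hcls
  refine ⟨X, cls, hX, ?_, ?_, ?_, ?_, ?_⟩
  · intro w hw
    exact mem_filter.2 ⟨mem_univ _, hw, hw, rfl⟩
  · intro w u hu
    simp only [hcls, mem_filter, mem_univ, true_and] at hu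
    exact hu.1
  · intro w u hu
    simp only [hcls, mem_filter, mem_univ, true_and] at hu
    obtain ⟨h1, h2, h3⟩ := hu
    ext x
    simp only [hcls, mem_filter, mem_univ, true_and]
    constructor
    · rintro ⟨a, b, c⟩; exact ⟨a, h2, c.trans h3⟩
    · rintro ⟨a, b, c⟩; exact ⟨a, h1, c.trans h3.symm⟩
  · intro u w hu hw huw
    have hc : K.connectedComponentMk ⟨u, hm u hu⟩ = K.connectedComponentMk ⟨w, hm w hw⟩ := by
      apply SimpleGraph.ConnectedComponent.sound
      apply SimpleGraph.Adj.reachable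
      simpa [hKd] using huw
    ext x
    simp only [hcls, mem_filter, mem_univ, true_and]
    constructor
    · rintro ⟨a, b, c⟩; exact ⟨a, hw, c.trans hc⟩
    · rintro ⟨a, b, c⟩; exact ⟨a, hu, c.trans hc.symm⟩
  · intro w
    by_cases hw : w ∈ X
    · have : cls w = ∅ := by
        ext x
        simp [hcls, hw]
      rw [this]; simpa using hμ
    · refine le_trans ?_ (hK (K.connectedComponentMk ⟨w, hm w hw⟩))
      have : (K.connectedComponentMk ⟨w, hm w hw⟩).supp.ncard = (cls w).card := by
        rw [← Set.ncard_coe_finset, ← Set.ncard_image_of_injective _ Subtype.val_injective]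
        congr 1
        ext x
        simp only [hcls, Set.mem_image, SimpleGraph.ConnectedComponent.mem_supp_iff, coe_filter, mem_univ,
          true_and, Set.mem_ofPred_eq]
        constructor
        · rintro ⟨y, hy, rfl⟩
          exact ⟨fun h => y.2 (by exact_mod_cast h), hw, hy⟩
        · rintro ⟨a, b, c⟩
          exact ⟨⟨x, hm x a⟩, c, rfl⟩
      rw [this]

/-- closed sets of vertices -/
def Clo {W : Type} (X : Finset W) (cls : W → Finset W) (S : Finset W) : Prop :=
  ∀ w ∈ S, w ∉ X ∧ cls w ⊆ S

theorem Clo.nbr {W : Type} [Fintype W] {H : SimpleGraph W} {X : Finset W} {cls : W → Finset W} {mu : ℝ}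
    (hs : HS H X cls mu) {S : Finset W} (hS : Clo X cls S) {u w : W} (hu : u ∈ S) (huw : H.Adj u w)
    (hw : w ∉ X) : w ∈ S := by
  apply (hS u hu).2
  rw [hs.adj u w (hS u hu).1 hw huw]
  exact hs.mem w hw

theorem Clo.disj {W : Type} [Fintype W] {H : SimpleGraph W} {X : Finset W} {cls : W → Finset W} {mu : ℝ}
    (hs : HS H X cls mu) {S : Finset W} (hS : Clo X cls S) {u : W} (hu : u ∉ S) (huX : u ∉ X) :
    Disjoint (cls u) S := by
  rw [disjoint_left]
  intro x hx hxS
  have := (hS x hxS).2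
  rw [hs.eq u x hx] at this
  exact hu (this (hs.mem u huX))

theorem Clo.union {W : Type} {X : Finset W} {cls : W → Finset W} {S T : Finset W}
    (hS : Clo X cls S) (hT : Clo X cls T) : Clo X cls (S ∪ T) := by
  intro w hw
  rcases mem_union.1 hw with h | h
  · exact ⟨(hS w h).1, (hS w h).2.trans subset_union_left⟩
  · exact ⟨(hT w h).1, (hT w h).2.trans subset_union_right⟩

theorem Clo.cls {W : Type} [Fintype W] {H : SimpleGraph W} {X : Finset W} {cls : W → Finset W} {mu : ℝ}
    (hs : HS H X cls mu) (w : W) : Clo X cls (cls w) := by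
  intro u hu
  exact ⟨hs.nX w u hu, (hs.eq w u hu).subset⟩

/-- ball of radius one -/
noncomputable def ba {W : Type} [Fintype W] (H : SimpleGraph W) (v : W) : Finset W :=
  univ.filter (fun u => u = v ∨ H.Adj v u)

/-- ball of radius two -/
noncomputable def bl {W : Type} [Fintype W] (H : SimpleGraph W) (v : W) : Finset W :=
  (ba H v).biUnion (ba H)

theorem mem_ba {W : Type} [Fintype W] (H : SimpleGraph W) (v u : W) :
    u ∈ ba H v ↔ u = v ∨ H.Adj v u := by simp [ba]

theorem mem_bl {W : Type} [Fintype W] (H : SimpleGraph W) (v u : W) :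
    u ∈ bl H v ↔ ∃ x ∈ ba H v, u ∈ ba H x := by simp [bl]

theorem ba_symm {W : Type} [Fintype W] (H : SimpleGraph W) {v u : W} (h : u ∈ ba H v) : v ∈ ba H u := by
  rw [mem_ba] at *
  rcases h with h | h
  · exact Or.inl h.symm
  · exact Or.inr h.symm

theorem bl_symm {W : Type} [Fintype W] (H : SimpleGraph W) {v u : W} (h : u ∈ bl H v) : v ∈ bl H u := by
  rw [mem_bl] at *
  obtain ⟨x, h1, h2⟩ := h
  exact ⟨x, ba_symm H h2, ba_symm H h1⟩

theorem ba_sub_bl {W : Type} [Fintype W] (H : SimpleGraph W) (v : W) : ba H v ⊆ bl H v := by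
  intro u hu
  rw [mem_bl]
  exact ⟨u, hu, by simp [mem_ba]⟩

theorem self_ba {W : Type} [Fintype W] (H : SimpleGraph W) (v : W) : v ∈ ba H v := by simp [mem_ba]

theorem self_bl {W : Type} [Fintype W] (H : SimpleGraph W) (v : W) : v ∈ bl H v :=
  ba_sub_bl H v (self_ba H v)

theorem ba_card {W : Type} [Fintype W] (H : SimpleGraph W) (Δ : ℕ) (hdeg : ∀ w, degOf H w ≤ Δ) (v : W) :
    (ba H v).card ≤ Δ + 1 := by
  have : ba H v ⊆ insert v (univ.filter (fun w => H.Adj v w)) := by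
    intro u hu
    rw [mem_ba] at hu
    simpa using hu
  refine (card_le_card this).trans ((card_insert_le _ _).trans ?_)
  have := hdeg v
  unfold degOf at this
  omega

theorem bl_card {W : Type} [Fintype W] (H : SimpleGraph W) (Δ : ℕ) (hdeg : ∀ w, degOf H w ≤ Δ) (v : W) :
    (bl H v).card ≤ (Δ + 1) ^ 2 := by
  rw [pow_two]
  refine (card_biUnion_le_card_mul _ _ (Δ + 1) (fun x _ => ba_card H Δ hdeg x)).trans ?_
  exact Nat.mul_le_mul_right _ (ba_card H Δ hdeg v)

theorem bbl_card {W : Type} [Fintype W] (H : SimpleGraph W) (Δ : ℕ) (hdeg : ∀ w, degOf H w ≤ Δ) (v : W) :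
    ((bl H v).biUnion (bl H)).card ≤ (Δ + 1) ^ 4 := by
  have : (Δ + 1) ^ 4 = (Δ + 1) ^ 2 * (Δ + 1) ^ 2 := by ring
  rw [this]
  refine (card_biUnion_le_card_mul _ _ _ (fun x _ => bl_card H Δ hdeg x)).trans ?_
  exact Nat.mul_le_mul_right _ (bl_card H Δ hdeg v)

/-- vertices far from the separator -/
def Iso {W : Type} [Fintype W] (H : SimpleGraph W) (X : Finset W) (v : W) : Prop :=
  ∀ u ∈ bl H v, u ∉ X ∧ ∀ x ∈ X, ¬ H.Adj x u

theorem not_iso_card {W : Type} [Fintype W] (H : SimpleGraph W) (Δ : ℕ) (hdeg : ∀ w, degOf H w ≤ Δ)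
    (X : Finset W) : ((univ : Finset W).filter (fun v => ¬ Iso H X v)).card ≤ X.card * (Δ + 1) ^ 4 := by
  refine (card_le_card ?_).trans
    (card_biUnion_le_card_mul X (fun x => (bl H x).biUnion (bl H)) _ (fun x _ => bbl_card H Δ hdeg x))
  intro v hv
  simp only [mem_filter, mem_univ, true_and, Iso, not_forall] at hv
  obtain ⟨u, hu, h⟩ := hv
  by_cases huX : u ∈ X
  · exact mem_biUnion.2 ⟨u, huX, mem_biUnion.2 ⟨u, self_bl H u, bl_symm H hu⟩⟩
  · simp only [huX, not_false_eq_true, true_and, not_forall, not_not] at h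
    obtain ⟨x, hx, hxu⟩ := h
    refine mem_biUnion.2 ⟨x, hx, mem_biUnion.2 ⟨u, ba_sub_bl H x ?_, bl_symm H hu⟩⟩
    rw [mem_ba]; exact Or.inr hxu

/-- greedy choice of far apart vertices -/
theorem far_subset {W : Type} [Fintype W] (H : SimpleGraph W) (Δ : ℕ) (hdeg : ∀ w, degOf H w ≤ Δ)
    (U : Finset W) : ∃ R ⊆ U, (∀ u ∈ R, ∀ v ∈ R, u ≠ v → Disjoint (bl H u) (bl H v)) ∧
      U.card ≤ R.card * (Δ + 1) ^ 4 := by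
  obtain ⟨R, hR, hmax⟩ := exists_max_image (U.powerset.filter (fun R =>
    ∀ u ∈ R, ∀ v ∈ R, u ≠ v → Disjoint (bl H u) (bl H v))) card ⟨∅, by simp⟩
  simp only [mem_filter, mem_powerset] at hR hmax
  refine ⟨R, hR.1, hR.2, ?_⟩
  refine (card_le_card ?_).trans
    (card_biUnion_le_card_mul R (fun x => (bl H x).biUnion (bl H)) _ (fun x _ => bbl_card H Δ hdeg x))
  intro u hu
  by_contra hcon
  have hfar : ∀ v ∈ R, Disjoint (bl H u) (bl H v) := by
    intro v hv
    rw [disjoint_left]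
    intro x hxu hxv
    exact hcon (mem_biUnion.2 ⟨v, hv, mem_biUnion.2 ⟨x, hxv, bl_symm H hxu⟩⟩)
  have huR : u ∉ R := fun h => hcon (mem_biUnion.2 ⟨u, h, mem_biUnion.2 ⟨u, self_bl H u, self_bl H u⟩⟩)
  have := hmax (insert u R) ⟨insert_subset hu hR.1, by
    intro a ha b hb hab
    rcases mem_insert.1 ha with ha' | ha' <;> rcases mem_insert.1 hb with hb' | hb'
    · exact absurd (ha'.trans hb'.symm) hab
    · rw [ha']; exact hfar b hb'
    · rw [hb']; exact (hfar a ha').symm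
    · exact hR.2 a ha' b hb' hab⟩
  rw [card_insert_of_notMem huR] at this
  omega

theorem iso_bl {W : Type} [Fintype W] {H : SimpleGraph W} {X : Finset W} {cls : W → Finset W} {mu : ℝ}
    (hs : HS H X cls mu) {v : W} (hv : Iso H X v) : bl H v ⊆ cls v := by
  have hvX := (hv v (self_bl H v)).1
  have h1 : ∀ x ∈ ba H v, cls x = cls v := by
    intro x hx
    have hxX := (hv x (ba_sub_bl H v hx)).1
    rw [mem_ba] at hx
    rcases hx with rfl | hx
    · rfl
    · exact (hs.adj v x hvX hxX hx).symm
  intro u hu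
  have huX := (hv u hu).1
  obtain ⟨x, hx, hxu⟩ := (mem_bl H v u).1 hu
  have hxX := (hv x (ba_sub_bl H v hx)).1
  rw [← h1 x hx]
  rw [mem_ba] at hxu
  rcases hxu with rfl | hxu
  · exact hs.mem _ hxX
  · rw [hs.adj x u hxX huX hxu]; exact hs.mem u huX

theorem closed_avg {W : Type} [Fintype W] {H : SimpleGraph W} {X : Finset W} {cls : W → Finset W} {mu : ℝ}
    (hs : HS H X cls mu) (S U : Finset W) (hS : Clo X cls S) (b : ℝ)
    (h : ∀ w ∈ S, (((cls w) ∩ U).card : ℝ) ≤ b * (cls w).card) : ((S ∩ U).card : ℝ) ≤ b * S.card := by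
  have e1 : ∀ w ∈ S, S.filter (fun u => cls u = cls w) = cls w := by
    intro w hw
    ext u
    simp only [mem_filter]
    constructor
    · rintro ⟨h1, h2⟩; rw [← h2]; exact hs.mem u (hS u h1).1
    · intro hu; exact ⟨(hS w hw).2 hu, hs.eq w u hu⟩
  have e2 : ∀ w ∈ S, (S ∩ U).filter (fun u => cls u = cls w) = cls w ∩ U := by
    intro w hw
    ext u
    have := Finset.ext_iff.1 (e1 w hw) u
    simp only [mem_filter] at this
    simp only [mem_filter, mem_inter]
    tauto
  have f1 := card_eq_sum_card_fiberwise (f := cls) (s := S) (t := S.image cls)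
    (fun x hx => by exact_mod_cast mem_image_of_mem cls hx)
  have f2 := card_eq_sum_card_fiberwise (f := cls) (s := S ∩ U) (t := S.image cls)
    (fun x hx => by
      have : x ∈ S := (mem_inter.1 (by exact_mod_cast hx)).1
      exact_mod_cast mem_image_of_mem cls this)
  rw [f1, f2]
  push_cast
  rw [mul_sum]
  refine sum_le_sum (fun K hK => ?_)
  obtain ⟨w, hw, rfl⟩ := mem_image.1 hK
  rw [e1 w hw, e2 w hw]
  exact h w hw

/-- a small closed set meeting `U` in many points -/
theorem closed_pick {W : Type} [Fintype W] {H : SimpleGraph W} {X : Finset W} {cls : W → Finset W} {mu : ℝ}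
    (hs : HS H X cls mu) (U : Finset W) (n ζ q : ℝ) (hn : (Fintype.card W : ℝ) = n) (hζ : 0 < ζ)
    (hn0 : 0 < n) (hUX : Disjoint U X) (hU : ζ * n ≤ U.card) (hq : q ≤ ζ * n / 4) (hq0 : 0 ≤ q) :
    ∃ Q, Clo X cls Q ∧ (∀ P, Clo X cls P → Disjoint U P → Disjoint Q P) ∧ q ≤ (Q ∩ U).card ∧
      (Q.card : ℝ) ≤ 2 / ζ * (q + mu) := by
  have hmu : 0 ≤ mu := le_trans (by positivity) hs.hX
  obtain ⟨Q, hQ, hmax⟩ := exists_max_image ((univ : Finset (Finset W)).filter (fun Q =>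
    Clo X cls Q ∧ (∀ P, Clo X cls P → Disjoint U P → Disjoint Q P) ∧
      (Q.card : ℝ) ≤ 2 / ζ * ((Q ∩ U).card) ∧ ((Q ∩ U).card : ℝ) ≤ q + mu)) card
    ⟨∅, mem_filter.2 ⟨mem_univ _, by simp [Clo], by simp, by simp, by simpa using add_nonneg hq0 hmu⟩⟩
  simp only [mem_filter, mem_univ, true_and] at hQ hmax
  obtain ⟨h1, h2, h3, h4⟩ := hQ
  refine ⟨Q, h1, h2, ?_, h3.trans (by gcongr)⟩
  by_contra hcon
  push Not at hcon
  set S := (univ \ X) \ Q with hSd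
  have hS : Clo X cls S := by
    intro w hw
    simp only [hSd, mem_sdiff, mem_univ, true_and] at hw
    refine ⟨hw.1, ?_⟩
    intro x hx
    simp only [hSd, mem_sdiff, mem_univ, true_and]
    exact ⟨hs.nX w x hx, disjoint_left.1 (h1.disj hs hw.2 hw.1) hx⟩
  have key : ∀ w ∈ S, (((cls w) ∩ U).card : ℝ) ≤ ζ / 2 * (cls w).card := by
    intro w hw
    by_contra hc
    push Not at hc
    simp only [hSd, mem_sdiff, mem_univ, true_and] at hw
    have hd : Disjoint Q (cls w) := (h1.disj hs hw.2 hw.1).symm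
    have hne : (cls w ∩ U).Nonempty := by
      apply card_pos.1
      have : (0:ℝ) < ((cls w ∩ U).card) := lt_of_le_of_lt (by positivity) hc
      exact_mod_cast this
    have hcu : ((Q ∪ cls w) ∩ U).card = (Q ∩ U).card + (cls w ∩ U).card := by
      rw [union_inter_distrib_right, card_union_of_disjoint]
      exact hd.mono inter_subset_left inter_subset_left
    have := hmax (Q ∪ cls w) ⟨h1.union (Clo.cls hs w), ?_, ?_, ?_⟩
    · rw [card_union_of_disjoint hd] at this
      have := card_pos.2 (⟨w, hs.mem w hw.1⟩ : (cls w).Nonempty)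
      omega
    · intro P hP hUP
      rw [disjoint_union_left]
      refine ⟨h2 P hP hUP, ?_⟩
      obtain ⟨x, hx⟩ := hne
      rw [mem_inter] at hx
      have hxP : x ∉ P := disjoint_left.1 hUP hx.2
      have := hP.disj hs hxP (hs.nX w x hx.1)
      rwa [hs.eq w x hx.1] at this
    · rw [hcu, card_union_of_disjoint hd]
      push_cast
      have : ((cls w).card : ℝ) ≤ 2 / ζ * (cls w ∩ U).card := by
        rw [div_mul_eq_mul_div, le_div_iff₀ hζ]; linarith
      rw [mul_add]; linarith
    · rw [hcu]; push_cast
      have : ((cls w ∩ U).card : ℝ) ≤ (cls w).card := by exact_mod_cast card_le_card inter_subset_left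
      have := hs.small w
      linarith
  have h5 := closed_avg hs S U hS (ζ / 2) key
  have h6 : (S.card : ℝ) ≤ n := by rw [← hn]; exact_mod_cast card_le_univ S
  have h7 : (U.card : ℝ) ≤ (Q ∩ U).card + (S ∩ U).card := by
    have : U ⊆ (Q ∩ U) ∪ (S ∩ U) := by
      intro u hu
      have := disjoint_left.1 hUX hu
      simp only [hSd, mem_union, mem_inter, mem_sdiff, mem_univ, true_and]
      tauto
    exact_mod_cast (card_le_card this).trans (card_union_le _ _)
  have h8 : ζ / 2 * (S.card : ℝ) ≤ ζ / 2 * n := by gcongr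
  have h9 : 0 < ζ * n := by positivity
  linarith

/-- a small closed family containing exactly `q` far-apart roots from `U` -/
theorem family {W : Type} [Fintype W] {H : SimpleGraph W} {X : Finset W} {cls : W → Finset W} {mu : ℝ}
    (hs : HS H X cls mu) (Δ : ℕ) (hdeg : ∀ w, degOf H w ≤ Δ)
    (U P : Finset W) (n ζ : ℝ) (q : ℕ) (hn : (Fintype.card W : ℝ) = n) (hζ : 0 < ζ) (hn0 : 0 < n)
    (hP : Clo X cls P) (hU : ((Δ:ℝ) + 1) ^ 4 * (ζ * n + P.card + mu) ≤ U.card) (hq : (q:ℝ) ≤ ζ * n / 4) :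
    ∃ Q R, Clo X cls Q ∧ Disjoint Q P ∧ (Q.card : ℝ) ≤ 2 / ζ * (q + mu) ∧ R ⊆ Q ∧ R ⊆ U ∧ R.card = q ∧
      (∀ u ∈ R, Iso H X u) ∧ (∀ u ∈ R, ∀ v ∈ R, u ≠ v → Disjoint (bl H u) (bl H v)) := by
  obtain ⟨R0, hR0, hfar, hR0c⟩ := far_subset H Δ hdeg (U.filter (fun v => Iso H X v))
  have h1 : U.card ≤ (U.filter (fun v => Iso H X v)).card + X.card * (Δ + 1) ^ 4 := by
    have := not_iso_card H Δ hdeg X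
    have h2 := card_filter_add_card_filter_not (s := U) (fun v => Iso H X v)
    have h3 : (U.filter (fun v => ¬ Iso H X v)).card ≤ ((univ : Finset W).filter (fun v => ¬ Iso H X v)).card :=
      card_le_card (filter_subset_filter _ (subset_univ _))
    omega
  have h2 : (U.card : ℝ) ≤ ((R0.card : ℝ) + X.card) * ((Δ:ℝ) + 1) ^ 4 := by
    have : U.card ≤ (R0.card + X.card) * (Δ + 1) ^ 4 := by
      rw [add_mul]; omega
    exact_mod_cast this
  have hpos : (0:ℝ) < ((Δ:ℝ) + 1) ^ 4 := by positivity
  have h3 : ζ * n + P.card + mu ≤ R0.card + X.card := by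
    have : ((Δ:ℝ) + 1) ^ 4 * (ζ * n + P.card + mu) ≤ ((Δ:ℝ) + 1) ^ 4 * ((R0.card : ℝ) + X.card) := by
      linarith
    exact le_of_mul_le_mul_left this hpos
  have hX := hs.hX
  have hiso : ∀ u ∈ R0, Iso H X u := fun u hu => (mem_filter.1 (hR0 hu)).2
  obtain ⟨Q, hQ1, hQ2, hQ3, hQ4⟩ := closed_pick hs (R0 \ P) n ζ q hn hζ hn0 (by
      rw [disjoint_left]
      intro u hu
      exact (hiso u (mem_sdiff.1 hu).1 u (self_bl H u)).1) (by
      have : (R0.card : ℝ) ≤ (R0 \ P).card + P.card := by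
        exact_mod_cast card_le_card_sdiff_add_card
      linarith) hq (by positivity)
  have hQ3' : q ≤ (Q ∩ (R0 \ P)).card := by exact_mod_cast hQ3
  obtain ⟨R, hR, hRc⟩ := exists_subset_card_eq hQ3'
  have hRR0 : R ⊆ R0 := hR.trans (inter_subset_right.trans sdiff_subset)
  refine ⟨Q, R, hQ1, hQ2 P hP sdiff_disjoint, hQ4, hR.trans inter_subset_left, hRR0.trans (hR0.trans (filter_subset _ _)),
    hRc, fun u hu => hiso u (hRR0 hu), fun u hu v hv => hfar u (hRR0 hu) v (hRR0 hv)⟩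

/-- edges touching a set -/
theorem touch_card {W : Type} [Fintype W] (H : SimpleGraph W) (Δ : ℕ) (hdeg : ∀ w, degOf H w ≤ Δ)
    (S : Finset W) (F : Finset (Sym2 W)) (hF : ∀ e ∈ F, e ∈ H.edgeSet ∧ ∃ x ∈ S, x ∈ e) :
    F.card ≤ Δ * S.card := by
  have : F ⊆ S.biUnion (fun x => (univ.filter (fun w => H.Adj x w)).image (fun w => s(x, w))) := by
    intro e he
    obtain ⟨h1, x, hx, hxe⟩ := hF e he
    obtain ⟨y, rfl⟩ := Sym2.mem_iff_exists.1 hxe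
    refine mem_biUnion.2 ⟨x, hx, mem_image.2 ⟨y, ?_, rfl⟩⟩
    simpa using h1
  refine (card_le_card this).trans ?_
  rw [mul_comm]
  refine card_biUnion_le_card_mul _ _ _ (fun x _ => card_image_le.trans (hdeg x))

/-- colouring a small set of edges which are thick for the colour set `Y` -/
theorem col_edges {V W C : Type} [Nonempty C] (G : C → SimpleGraph V) (θ : ℝ) (Y : Finset C)
    (τ : W → V) (S : Finset (Sym2 W)) (hS : (S.card : ℝ) ≤ θ * Y.card)
    (hT : ∀ e ∈ S, e.map τ ∈ (thick G θ Y).edgeSet) :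
    ∃ f : Sym2 W → C, (∀ e ∈ S, f e ∈ Y ∧ e.map τ ∈ (G (f e)).edgeSet) ∧ Set.InjOn f (S : Set (Sym2 W)) := by
  obtain ⟨f, h1, h2⟩ := list_choice S (fun e => Y.filter (fun c => e.map τ ∈ (G c).edgeSet)) (by
    intro e he
    have h := hT e he
    revert h
    induction e using Sym2.ind with
    | _ x y =>
      intro h
      simp only [Sym2.map_mk, SimpleGraph.mem_edgeSet] at h ⊢
      have := h.2
      exact_mod_cast hS.trans this)
  exact ⟨f, fun e he => mem_filter.1 (h1 e he), h2⟩

/-- the final colouring step -/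
theorem finalK {V W C : Type} [Fintype V] [Fintype W] [Fintype C] [Nonempty C] (G : C → SimpleGraph V)
    (H : SimpleGraph W) (θ : ℝ) (Ds : Finset C) (mc rc : ℕ) (hDs : Ds.card = mc + rc)
    (hrc : (rc : ℝ) ≤ θ * Ds.card) (hE : edgeCnt H = Fintype.card C) (τ : W → V)
    (hτ : Function.Injective τ) (M : Fin mc → Sym2 W) (hM : Function.Injective M)
    (hME : ∀ j, M j ∈ H.edgeSet)
    (hab : ∀ Y' ⊆ Ds, Y'.card = mc → ∃ f : Fin mc → C, Function.Injective f ∧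
      ∀ j, f j ∈ Y' ∧ (M j).map τ ∈ (G (f j)).edgeSet)
    (Bk : Finset (Sym2 W)) (σ : Sym2 W → C) (hB : ∀ e ∈ Bk, e ∈ H.edgeSet ∧ ∀ j, M j ≠ e)
    (hσ : Set.InjOn σ (Bk : Set (Sym2 W))) (hσ2 : ∀ e ∈ Bk, σ e ∉ Ds ∧ e.map τ ∈ (G (σ e)).edgeSet)
    (hBc : Bk.card + Ds.card = Fintype.card C)
    (hJ : ∀ x y, H.Adj x y → (∃ j, M j = s(x, y)) ∨ s(x, y) ∈ Bk ∨ (thick G θ Ds).Adj (τ x) (τ y)) :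
    HasTransversal G H := by
  set EE := (univ : Finset (Sym2 W)).filter (fun e => e ∈ H.edgeSet) with hEE
  set MM := (univ : Finset (Fin mc)).image M with hMM
  set Es := EE \ (Bk ∪ MM) with hEs
  have hMMc : MM.card = mc := by rw [hMM, card_image_of_injective _ hM]; simp
  have hd : Disjoint Bk MM := by
    rw [disjoint_left]
    intro e he h
    obtain ⟨j, _, hj⟩ := mem_image.1 h
    exact (hB e he).2 j hj
  have hsub : Bk ∪ MM ⊆ EE := by
    intro e he
    rw [hEE, mem_filter]
    refine ⟨mem_univ _, ?_⟩
    rcases mem_union.1 he with h | h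
    · exact (hB e h).1
    · obtain ⟨j, _, hj⟩ := mem_image.1 h
      rw [← hj]; exact hME j
  have hEsc : Es.card = rc := by
    have h1 : Es.card = EE.card - (Bk ∪ MM).card := card_sdiff_of_subset hsub
    have h2 : (Bk ∪ MM).card = Bk.card + MM.card := card_union_of_disjoint hd
    have h3 : EE.card = Fintype.card C := hE
    omega
  obtain ⟨f, hf, hfi⟩ := col_edges G θ Ds τ Es (by rw [hEsc]; exact hrc) (by
    intro e he
    rw [hEs, mem_sdiff, mem_union, not_or] at he
    obtain ⟨h1, h2, h3⟩ := he
    revert h1 h2 h3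
    induction e using Sym2.ind with
    | _ x y =>
      intro h1 h2 h3
      have hxy : H.Adj x y := (mem_filter.1 h1).2
      rcases hJ x y hxy with ⟨j, hj⟩ | h | h
      · exact absurd (mem_image.2 ⟨j, mem_univ _, hj⟩) h3
      · exact absurd h h2
      · exact h)
  obtain ⟨g, hg, hg2⟩ := hab (Ds \ Es.image f) sdiff_subset (by
    rw [card_sdiff_of_subset (fun c hc => by
      obtain ⟨e, he, rfl⟩ := mem_image.1 hc
      exact (hf e he).1), card_image_of_injOn hfi]
    omega)
  refine ⟨τ, fun e => if e ∈ Es then f e else if e ∈ Bk then σ e else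
    if h : ∃ j, M j = e then g h.choose else Classical.arbitrary C, hτ, ?_, ?_⟩
  · have hcl : ∀ e ∈ H.edgeSet, e ∈ Es ∨ (e ∉ Es ∧ e ∈ Bk) ∨ (e ∉ Es ∧ e ∉ Bk ∧ ∃ j, M j = e) := by
      intro e he
      by_cases h1 : e ∈ Es
      · exact Or.inl h1
      by_cases h2 : e ∈ Bk
      · exact Or.inr (Or.inl ⟨h1, h2⟩)
      refine Or.inr (Or.inr ⟨h1, h2, ?_⟩)
      by_contra hcon
      apply h1
      rw [hEs, mem_sdiff, mem_union, hEE, mem_filter]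
      refine ⟨⟨mem_univ _, he⟩, ?_⟩
      rintro (h | h)
      · exact h2 h
      · obtain ⟨j, _, hj⟩ := mem_image.1 h
        exact hcon ⟨j, hj⟩
    intro e he e' he' hee
    rcases hcl e he with h | ⟨h, k⟩ | ⟨h, k, l⟩ <;> rcases hcl e' he' with h' | ⟨h', k'⟩ | ⟨h', k', l'⟩
    · simp only [h, h', if_true] at hee
      exact hfi h h' hee
    · simp only [h, h', k', if_true, if_false] at hee
      exact absurd (hee ▸ (hf e h).1) (hσ2 e' k').1
    · simp only [h, h', k', l', if_true, if_false, dif_pos] at hee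
      have := (hg2 l'.choose).1
      rw [← hee] at this
      exact absurd (mem_image_of_mem f h) (mem_sdiff.1 this).2
    · simp only [h, h', k, if_true, if_false] at hee
      exact absurd (hee ▸ (hf e' h').1) (hσ2 e k).1
    · simp only [h, h', k, k', if_true, if_false] at hee
      exact hσ k k' hee
    · simp only [h, h', k, k', l', if_true, if_false, dif_pos] at hee
      have := (mem_sdiff.1 (hg2 l'.choose).1).1
      rw [← hee] at this
      exact absurd this (hσ2 e k).1
    · simp only [h, h', k, l, if_true, if_false, dif_pos] at hee
      have := (hg2 l.choose).1
      rw [hee] at this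
      exact absurd (mem_image_of_mem f h') (mem_sdiff.1 this).2
    · simp only [h, h', k, k', l, if_true, if_false, dif_pos] at hee
      have := (mem_sdiff.1 (hg2 l.choose).1).1
      rw [hee] at this
      exact absurd this (hσ2 e' k').1
    · simp only [h, h', k, k', l, l', if_true, if_false, dif_pos] at hee
      have := hg hee
      rw [← l.choose_spec, ← l'.choose_spec, this]
  · intro x y hxy
    by_cases h1 : s(x, y) ∈ Es
    · simp only [h1, if_true]
      exact (hf _ h1).2
    by_cases h2 : s(x, y) ∈ Bk
    · simp only [h1, h2, if_true, if_false]
      exact (hσ2 _ h2).2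
    have h3 : ∃ j, M j = s(x, y) := by
      by_contra hcon
      apply h1
      rw [hEs, mem_sdiff, mem_union, hEE, mem_filter]
      refine ⟨⟨mem_univ _, hxy⟩, ?_⟩
      rintro (h | h)
      · exact h2 h
      · obtain ⟨j, _, hj⟩ := mem_image.1 h
        exact hcon ⟨j, hj⟩
    simp only [h1, h2, h3, if_false, dif_pos]
    have := (hg2 h3.choose).2
    rw [h3.choose_spec] at this
    exact this

/-- static data of the embedding process -/
structure Ctx {V W C : Type} [Fintype V] [Fintype W] [Fintype C] (G : C → SimpleGraph V)
    (H : SimpleGraph W) where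
  Δ : ℕ
  mc : ℕ
  rc : ℕ
  mv : ℕ
  rv : ℕ
  ny : ℕ
  t : ℕ
  θ : ℝ
  s : ℝ
  mu : ℝ
  ez : ℝ
  ey : ℝ
  Ds : Finset C
  Vs : Finset V
  p : ℕ → Fin 2 → V
  X : Finset W
  cls : W → Finset W
  E0 : Finset W
  QY : Finset W
  XI : Finset W
  τ1 : W → V
  M : Fin mc → Sym2 W
  rI : Fin mv → W
  aY : Fin ny → W
  bY : Fin ny → W
  hΔ : 1 ≤ Δ
  hdeg : ∀ w, degOf H w ≤ Δ
  hθ0 : 0 < θ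
  hθ1 : θ ≤ 1
  hs0 : 0 ≤ s
  hVW : Fintype.card V = Fintype.card W
  hEC : edgeCnt H = Fintype.card C
  hDs : Ds.card = mc + rc
  hrc : (rc : ℝ) ≤ θ * Ds.card
  LDs : LD (thick G θ Ds) s θ
  LDY : ∀ Y : Finset C, ey < Y.card → LD (thick G θ Y) s θ
  hVs : Vs.card = mv + rv
  pne : ∀ i < t, p i 0 ≠ p i 1
  pdisj : ∀ i < t, ∀ j < t, i ≠ j → ∀ a b, p i a ≠ p j b
  pVs : ∀ i < t, ∀ a, p i a ∉ Vs
  pnb : ∀ i < t, θ ^ 2 * (Vs.card : ℝ) ≤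
    ((Vs.filter (fun v => ∀ a, (thick G θ Ds).Adj (p i a) v)).card : ℝ)
  pcol : ∀ c, ey ≤ (((range t).filter (fun i => (G c).Adj (p i 0) (p i 1))).card : ℝ)
  hs : HS H X cls mu
  XE0 : X ⊆ E0
  XXI : X ⊆ XI
  good : ∀ v, v ∉ Vs → (∀ i < t, ∀ a, p i a ≠ v) → v ∉ E0.image τ1 →
    θ * (Vs.card : ℝ) ≤ ((Vs.filter (fun w => (thick G θ Ds).Adj v w)).card : ℝ)
  cand : ∀ w, w ∉ E0 → (∃ x ∈ X, H.Adj x w) → θ ^ Δ * (Vs.card : ℝ) ≤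
    ((Vs.filter (fun v => ∀ x ∈ X, H.Adj x w → (thick G θ Ds).Adj (τ1 x) v)).card : ℝ)
  Minj : Function.Injective M
  ME : ∀ j, M j ∈ H.edgeSet
  ME0 : ∀ j, ∀ x ∈ M j, x ∈ E0
  Mab : ∀ Y' ⊆ Ds, Y'.card = mc → ∃ f : Fin mc → C, Function.Injective f ∧
      ∀ j, f j ∈ Y' ∧ (M j).map τ1 ∈ (G (f j)).edgeSet
  rIinj : Function.Injective rI
  rInb : ∀ i u, H.Adj (rI i) u → u ∈ E0
  rIab : ∀ Y' ⊆ Vs, Y'.card = mv → ∃ f : Fin mv → V, Function.Injective f ∧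
      ∀ i, f i ∈ Y' ∧ ∀ u, H.Adj (rI i) u → (thick G θ Ds).Adj (τ1 u) (f i)
  rIX : ∀ i, rI i ∉ X
  QYc : Clo X cls QY
  QYI : ∀ i, rI i ∉ QY
  aYQ : ∀ i, aY i ∈ QY
  abY : ∀ i, H.Adj (aY i) (bY i)
  aIso : ∀ i, Iso H X (aY i)
  afar : ∀ i j, i ≠ j → Disjoint (bl H (aY i)) (bl H (aY j))
  hny : ey ≤ ny
  -- numerical hypotheses
  n1 : s ≤ θ ^ Δ * (Fintype.card V : ℝ)
  n2 : Δ * s + mu < θ ^ Δ * ez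
  n3 : Δ * s + mu < θ ^ Δ * (θ ^ Δ * Vs.card - Δ * mu)
  n4 : Δ * mu ≤ θ * ey
  n5 : QY.card + Δ * mu + ((Δ : ℝ) + 1) ^ 4 * mu + ((Δ : ℝ) + 1) ^ 4 * (2 * t + ez) ≤ rv
  n6 : Δ * (XI.card + Vs.card + 2 * t + ez) < (rc : ℝ)
  n7 : Δ * s + rv < θ ^ Δ * (θ ^ (Δ + 1) * Vs.card - Δ * mu)
  ez0 : 0 ≤ ez
  ey0 : 0 ≤ ey

namespace Ctx
variable {V W C : Type} [Fintype V] [Fintype W] [Fintype C] {G : C → SimpleGraph V} {H : SimpleGraph W}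

/-- the reserve graph -/
def Js (c : Ctx G H) : SimpleGraph V := thick G c.θ c.Ds

/-- the flexible vertices of `H` -/
noncomputable def RI (c : Ctx G H) : Finset W := univ.image c.rI

/-- the reserved pairs -/
noncomputable def Rp (c : Ctx G H) : Finset V := ((range c.t) ×ˢ univ).image (fun q : ℕ × Fin 2 => c.p q.1 q.2)

/-- the free vertices -/
noncomputable def Fr (c : Ctx G H) (E : Finset W) (τ : W → V) : Finset V :=
  univ \ (c.Vs ∪ c.Rp ∪ E.image τ)

/-- candidates -/
noncomputable def cd (c : Ctx G H) (w : W) : Finset V :=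
  c.Vs.filter (fun v => ∀ x ∈ c.X, H.Adj x w → c.Js.Adj (c.τ1 x) v)

/-- states of the embedding process -/
structure St (c : Ctx G H) (E : Finset W) (τ : W → V) (Bk : Finset (Sym2 W)) (σ : Sym2 W → C) : Prop where
  e0 : c.E0 ⊆ E
  agree : ∀ w ∈ c.E0, τ w = c.τ1 w
  clo : Clo c.X c.cls ((E ∪ c.RI) \ c.X)
  dRI : ∀ i, c.rI i ∉ E
  dQY : Disjoint E c.QY
  inj : Set.InjOn τ (E : Set W)
  edge : ∀ u ∈ E, ∀ w ∈ E, H.Adj u w → (∃ j, c.M j = s(u, w)) ∨ s(u, w) ∈ Bk ∨ c.Js.Adj (τ u) (τ w)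
  bkE : ∀ e ∈ Bk, e ∈ H.edgeSet ∧ (∀ x ∈ e, x ∈ E) ∧ ∀ j, c.M j ≠ e
  sinj : Set.InjOn σ (Bk : Set (Sym2 W))
  scol : ∀ e ∈ Bk, σ e ∉ c.Ds ∧ e.map τ ∈ (G (σ e)).edgeSet
  dP : ∀ w ∈ E, τ w ∉ c.Rp
  vs : ∀ w ∈ E, τ w ∈ c.Vs → ∃ x ∈ c.X, H.Adj x w
  alt : (((univ \ c.Ds) \ Bk.image σ).card : ℝ) ≤ c.ey ∨ ∀ u ∈ E, ∀ w ∈ E, H.Adj u w →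
    (∃ j, c.M j = s(u, w)) ∨ s(u, w) ∈ Bk ∨ u ∈ c.XI ∨ w ∈ c.XI

theorem Rp_card (c : Ctx G H) : c.Rp.card = 2 * c.t := by
  unfold Rp
  rw [card_image_of_injOn]
  · rw [card_product]; simp [mul_comm]
  · rintro ⟨i, a⟩ hi ⟨j, b⟩ hj h
    simp only [coe_product, Set.mem_prod, mem_coe, mem_range] at hi hj
    simp only at h
    by_cases hij : i = j
    · subst hij
      by_cases hab : a = b
      · rw [hab]
      · exfalso
        have := c.pne i hi.1
        fin_cases a <;> fin_cases b <;> simp_all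
    · exact absurd h (c.pdisj i hi.1 j hj.1 hij a b)

theorem mem_Rp (c : Ctx G H) (v : V) : v ∈ c.Rp ↔ ∃ i < c.t, ∃ a, c.p i a = v := by
  unfold Rp
  simp only [mem_image, mem_product, mem_range, mem_univ, and_true, Prod.exists]
  constructor
  · rintro ⟨i, a, h, e⟩; exact ⟨i, h, a, e⟩
  · rintro ⟨i, h, a, e⟩; exact ⟨i, a, h, e⟩

theorem RI_card (c : Ctx G H) : c.RI.card = c.mv := by
  unfold RI
  rw [card_image_of_injective _ c.rIinj]; simp

theorem Rp_Vs (c : Ctx G H) : Disjoint c.Vs c.Rp := by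
  rw [disjoint_left]
  intro v hv h
  obtain ⟨i, hi, a, rfl⟩ := (c.mem_Rp v).1 h
  exact c.pVs i hi a hv

theorem mu0 (c : Ctx G H) : 0 ≤ c.mu := le_trans (by positivity) c.hs.hX

/-- number of vertices adjacent to the separator -/
theorem nX_card (c : Ctx G H) (E : Finset W) :
    ((E.filter (fun w => ∃ x ∈ c.X, H.Adj x w)).card : ℝ) ≤ c.Δ * c.mu := by
  have h1 : (E.filter (fun w => ∃ x ∈ c.X, H.Adj x w)).card ≤ c.X.card * c.Δ := by
    refine (card_le_card ?_).trans (card_biUnion_le_card_mul c.X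
      (fun x => univ.filter (fun w => H.Adj x w)) c.Δ (fun x _ => c.hdeg x))
    intro w hw
    obtain ⟨_, x, hx, hxw⟩ := mem_filter.1 hw
    exact mem_biUnion.2 ⟨x, hx, by simpa using hxw⟩
  have h2 : ((E.filter (fun w => ∃ x ∈ c.X, H.Adj x w)).card : ℝ) ≤ c.X.card * c.Δ := by exact_mod_cast h1
  have h3 := mul_le_mul_of_nonneg_right c.hs.hX (Nat.cast_nonneg (α := ℝ) c.Δ)
  linarith

variable {c : Ctx G H} {E : Finset W} {τ : W → V} {Bk : Finset (Sym2 W)} {σ : Sym2 W → C}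

theorem St.used (S : St c E τ Bk σ) : ((c.Vs ∩ E.image τ).card : ℝ) ≤ c.Δ * c.mu := by
  refine le_trans ?_ (c.nX_card E)
  have : (c.Vs ∩ E.image τ) ⊆ (E.filter (fun w => ∃ x ∈ c.X, H.Adj x w)).image τ := by
    intro v hv
    obtain ⟨h1, h2⟩ := mem_inter.1 hv
    obtain ⟨w, hw, rfl⟩ := mem_image.1 h2
    exact mem_image_of_mem _ (mem_filter.2 ⟨hw, S.vs w hw h1⟩)
  exact_mod_cast (card_le_card this).trans card_image_le

theorem St.cardV (S : St c E τ Bk σ) :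
    Fintype.card V = (c.Fr E τ).card + c.Rp.card + (c.Vs \ E.image τ).card + E.card := by
  have h1 : (c.Fr E τ).card = (univ : Finset V).card - (c.Vs ∪ c.Rp ∪ E.image τ).card :=
    card_sdiff_of_subset (subset_univ _)
  have h2 : c.Vs ∪ c.Rp ∪ E.image τ = ((c.Vs \ E.image τ) ∪ c.Rp) ∪ E.image τ := by
    ext v; simp only [mem_union, mem_sdiff]; tauto
  have h3 : Disjoint ((c.Vs \ E.image τ) ∪ c.Rp) (E.image τ) := by
    rw [disjoint_union_left]
    refine ⟨sdiff_disjoint, ?_⟩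
    rw [disjoint_right]
    intro v hv
    obtain ⟨w, hw, rfl⟩ := mem_image.1 hv
    exact S.dP w hw
  have h4 : Disjoint (c.Vs \ E.image τ) c.Rp := c.Rp_Vs.mono_left sdiff_subset
  rw [h2, card_union_of_disjoint h3, card_union_of_disjoint h4, card_image_of_injOn S.inj] at h1
  have h5 : ((c.Vs \ E.image τ) ∪ c.Rp ∪ E.image τ).card ≤ (univ : Finset V).card := card_le_card (subset_univ _)
  rw [card_union_of_disjoint h3, card_union_of_disjoint h4, card_image_of_injOn S.inj] at h5
  rw [card_univ] at h1 h5
  omega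

theorem St.Vs_card (S : St c E τ Bk σ) :
    (c.mv : ℝ) + c.rv - c.Δ * c.mu ≤ (c.Vs \ E.image τ).card := by
  have h1 := card_sdiff_add_card_inter c.Vs (E.image τ)
  have h2 : ((c.Vs \ E.image τ).card : ℝ) + (c.Vs ∩ E.image τ).card = c.mv + c.rv := by
    have := c.hVs
    exact_mod_cast h1.trans this
  have := S.used
  linarith

/-- neighbours of embedded vertices -/
theorem St.nbr (S : St c E τ Bk σ) {u w : W} (hu : u ∈ E) (hw : w ∉ E) (hwI : w ∉ c.RI) (h : H.Adj u w) :
    u ∈ c.X := by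
  by_contra hX
  have hwX : w ∉ c.X := fun h => hw (S.e0 (c.XE0 h))
  have := S.clo.nbr c.hs (mem_sdiff.2 ⟨mem_union_left _ hu, hX⟩) h hwX
  rcases mem_union.1 (mem_sdiff.1 this).1 with h | h
  · exact hw h
  · exact hwI h

end Ctx

namespace Ctx
variable {V W C : Type} [Fintype V] [Fintype W] [Fintype C] {G : C → SimpleGraph V} {H : SimpleGraph W}
variable {c : Ctx G H} {E : Finset W} {τ : W → V} {Bk : Finset (Sym2 W)} {σ : Sym2 W → C}

theorem St.avail (S : St c E τ Bk σ) (hez : c.ez < (c.Fr E τ).card) :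
    ∃ u, u ∉ E ∧ u ∉ c.QY ∧ u ∉ c.RI := by
  by_contra hcon
  push Not at hcon
  have h1 : (univ : Finset W) ⊆ E ∪ (c.QY ∪ c.RI) := by
    intro u _
    simp only [mem_union]
    have := hcon u
    tauto
  have h2 : Fintype.card W ≤ E.card + (c.QY.card + c.RI.card) := by
    rw [← card_univ]
    exact (card_le_card h1).trans ((card_union_le _ _).trans (by gcongr; exact card_union_le _ _))
  have h3 := S.cardV
  rw [c.hVW] at h3
  rw [c.RI_card] at h2
  have h4 : (c.Fr E τ).card + c.Rp.card + (c.Vs \ E.image τ).card ≤ c.QY.card + c.mv := by omega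
  have h4' : ((c.Fr E τ).card : ℝ) + c.Rp.card + (c.Vs \ E.image τ).card ≤ c.QY.card + c.mv := by
    exact_mod_cast h4
  have h5 := S.Vs_card
  have h6 := c.n5
  have h7 : 0 ≤ ((c.Δ : ℝ) + 1) ^ 4 * c.mu := mul_nonneg (by positivity) c.mu0
  have h8 : 0 ≤ ((c.Δ : ℝ) + 1) ^ 4 * (2 * c.t + c.ez) :=
    mul_nonneg (by positivity) (add_nonneg (by positivity) c.ez0)
  have h9 := c.ez0
  have h10 : (0:ℝ) ≤ c.Rp.card := by positivity
  linarith

theorem cd_card (c : Ctx G H) (w : W) (hw : w ∉ c.E0) (h : ∃ x ∈ c.X, H.Adj x w) :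
    c.θ ^ c.Δ * (c.Vs.card : ℝ) ≤ (c.cd w).card := c.cand w hw h

theorem St.cd_sdiff (S : St c E τ Bk σ) (w : W) (hw : w ∉ c.E0) (h : ∃ x ∈ c.X, H.Adj x w) :
    c.θ ^ c.Δ * (c.Vs.card : ℝ) - c.Δ * c.mu ≤ (c.cd w \ E.image τ).card := by
  have h1 := c.cd_card w hw h
  have h2 := card_sdiff_add_card_inter (c.cd w) (E.image τ)
  have h3 : ((c.cd w ∩ E.image τ).card : ℝ) ≤ c.Δ * c.mu := by
    refine le_trans ?_ S.used
    exact_mod_cast card_le_card (inter_subset_inter_right (filter_subset _ _))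
  have h4 : ((c.cd w \ E.image τ).card : ℝ) + (c.cd w ∩ E.image τ).card = (c.cd w).card := by
    exact_mod_cast h2
  linarith

set_option maxHeartbeats 2000000 in
theorem St.extend [Nonempty V] [Nonempty C] (S : St c E τ Bk σ) (hez : c.ez < (c.Fr E τ).card) :
    ∃ E' τ' Bk' σ', St c E' τ' Bk' σ' ∧ E.card < E'.card := by
  obtain ⟨u, huE, huY, huI⟩ := S.avail hez
  set K := c.cls u with hK
  have huX : u ∉ c.X := fun h => huE (S.e0 (c.XE0 h))
  have hKX : ∀ w ∈ K, w ∉ c.X := c.hs.nX u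
  have hd1 : Disjoint K ((E ∪ c.RI) \ c.X) := S.clo.disj c.hs (by
    intro h
    rcases mem_union.1 (mem_sdiff.1 h).1 with h | h
    · exact huE h
    · exact huI h) huX
  have hKE : ∀ w ∈ K, w ∉ E := fun w hw h =>
    disjoint_left.1 hd1 hw (mem_sdiff.2 ⟨mem_union_left _ h, hKX w hw⟩)
  have hKI : ∀ w ∈ K, w ∉ c.RI := fun w hw h =>
    disjoint_left.1 hd1 hw (mem_sdiff.2 ⟨mem_union_right _ h, hKX w hw⟩)
  have hKY : Disjoint K c.QY := c.QYc.disj c.hs huY huX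
  have hKE0 : ∀ w ∈ K, w ∉ c.E0 := fun w hw h => hKE w hw (S.e0 h)
  set Y := (univ \ c.Ds) \ Bk.image σ with hY
  set JJ : SimpleGraph V := if c.ey < Y.card then thick G c.θ Y else c.Js with hJJ
  have hJJLD : LD JJ c.s c.θ := by
    rw [hJJ]; split_ifs with h
    · exact c.LDY Y h
    · exact c.LDs
  set J : W → W → SimpleGraph V := fun a b => if a ∈ c.X ∨ b ∈ c.X then c.Js else JJ with hJ
  set T : W → Finset V := fun w => if w ∈ K then (if ∃ x ∈ c.X, H.Adj x w then c.cd w \ E.image τ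
    else c.Fr E τ) else univ with hT
  have hΔs : c.s ≤ c.Δ * c.s := by
    have : (1:ℝ) ≤ c.Δ := by exact_mod_cast c.hΔ
    have := mul_le_mul_of_nonneg_right this c.hs0
    linarith
  have hθp : 0 < c.θ ^ c.Δ := pow_pos c.hθ0 _
  have hTK : ∀ w ∈ K, c.Δ * c.s + c.mu < c.θ ^ c.Δ * (T w).card := by
    intro w hw
    simp only [hT, hw, if_true]
    split_ifs with h
    · have h1 := mul_le_mul_of_nonneg_left (S.cd_sdiff w (hKE0 w hw) h) hθp.le
      exact lt_of_lt_of_le c.n3 h1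
    · have h1 := mul_le_mul_of_nonneg_left hez.le hθp.le
      exact lt_of_lt_of_le c.n2 h1
  obtain ⟨τ', t1, t2, t3, t4, -⟩ := gelP H c.Δ c.hdeg J (by
      intro a b; simp only [hJ]; congr 1; rw [or_comm]) c.θ c.s c.hθ0 c.hθ1 (by
      intro a b; simp only [hJ]; split_ifs
      · exact c.LDs
      · exact hJJLD) T E K (by rw [disjoint_right]; exact hKE) τ S.inj (by
      intro w
      by_cases hw : w ∈ K
      · have := hTK w hw
        have := c.mu0
        linarith
      · simp only [hT, hw, if_false, card_univ]
        exact c.n1) (by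
      intro w hw
      refine lt_of_le_of_lt ?_ (hTK w hw)
      have h1 : ((K.filter (fun u => ¬ Disjoint (T u) (T w))).card : ℝ) ≤ K.card := by
        exact_mod_cast card_filter_le _ _
      have h2 := c.hs.small u
      linarith) (by
      intro w hw v hv a ha
      have hvE : v ∉ E.image τ := by
        simp only [hT, hw, if_true] at hv
        split_ifs at hv with h
        · exact (mem_sdiff.1 hv).2
        · simp only [Fr, mem_sdiff, mem_union, not_or] at hv
          exact hv.2.2
      refine ⟨fun h => hvE (h ▸ mem_image_of_mem τ ha), ?_⟩
      intro haw
      have haX := S.nbr ha (hKE w hw) (hKI w hw) haw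
      have hex : ∃ x ∈ c.X, H.Adj x w := ⟨a, haX, haw⟩
      simp only [hT, hw, if_true, hex] at hv
      simp only [hJ, haX, true_or, if_true]
      rw [S.agree a (c.XE0 haX)]
      exact (mem_filter.1 (mem_sdiff.1 hv).1).2 a haX haw)
  -- edges inside the class
  set KK := (univ : Finset (Sym2 W)).filter (fun e => e ∈ H.edgeSet ∧ ∀ x ∈ e, x ∈ K) with hKK
  have hKKc : (KK.card : ℝ) ≤ c.Δ * c.mu := by
    have h1 : KK.card ≤ c.Δ * K.card := touch_card H c.Δ c.hdeg K KK (by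
      intro e he
      obtain ⟨_, h1, h2⟩ := mem_filter.1 he
      refine ⟨h1, ?_⟩
      revert h1 h2
      induction e using Sym2.ind with
      | _ x y => intro h1 h2; exact ⟨x, h2 x (by simp), by simp⟩)
    have h2 : (KK.card : ℝ) ≤ c.Δ * K.card := by exact_mod_cast h1
    have h3 := mul_le_mul_of_nonneg_left (c.hs.small u) (Nat.cast_nonneg (α := ℝ) c.Δ)
    exact h2.trans h3
  have hτE : ∀ w ∈ E, τ' w = τ w := t2
  have hmapE : ∀ e : Sym2 W, (∀ x ∈ e, x ∈ E) → e.map τ' = e.map τ := by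
    intro e
    induction e using Sym2.ind with
    | _ x y =>
      intro h
      simp only [Sym2.map_mk]
      rw [hτE x (h x (by simp)), hτE y (h y (by simp))]
  have hKKE : ∀ e ∈ KK, ∀ x ∈ e, x ∉ E := fun e he x hx => hKE x ((mem_filter.1 he).2.2 x hx)
  have hKKBk : ∀ e ∈ KK, e ∉ Bk := by
    intro e he hb
    revert he hb
    induction e using Sym2.ind with
    | _ x y => intro he hb; exact hKKE _ he x (by simp) ((S.bkE _ hb).2.1 x (by simp))
  have hcol : ∃ f : Sym2 W → C, c.ey < Y.card → (∀ e ∈ KK, f e ∈ Y ∧ e.map τ' ∈ (G (f e)).edgeSet) ∧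
      Set.InjOn f (KK : Set (Sym2 W)) := by
    by_cases hy : c.ey < Y.card
    · obtain ⟨f, hf⟩ := col_edges G c.θ Y τ' KK (by
        have h1 := c.n4
        have h2 := mul_le_mul_of_nonneg_left hy.le c.hθ0.le
        linarith) (by
        intro e he
        obtain ⟨_, h1, h2⟩ := mem_filter.1 he
        revert h1 h2
        induction e using Sym2.ind with
        | _ x y =>
          intro h1 h2
          have hx := h2 x (by simp)
          have hy' := h2 y (by simp)
          have := t4 x hx y (mem_union_right _ hy') h1
          simp only [hJ, hKX x hx, hKX y hy', or_self, if_false, hJJ, hy, if_true] at this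
          exact this)
      exact ⟨f, fun _ => hf⟩
    · exact ⟨σ, fun h => absurd h hy⟩
  obtain ⟨f, hf⟩ := hcol
  set Bk' := if c.ey < Y.card then Bk ∪ KK else Bk with hBk'
  set σ' : Sym2 W → C := fun e => if e ∈ Bk then σ e else f e with hσ'
  have hBsub : Bk ⊆ Bk' := by
    rw [hBk']; split_ifs
    · exact subset_union_left
    · exact Subset.refl _
  have hBcase : ∀ e ∈ Bk', e ∈ Bk ∨ (e ∈ KK ∧ e ∉ Bk ∧ c.ey < Y.card) := by
    intro e he
    rw [hBk'] at he
    split_ifs at he with hy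
    · rcases mem_union.1 he with h | h
      · exact Or.inl h
      · exact Or.inr ⟨h, hKKBk e h, hy⟩
    · exact Or.inl he
  have hMK : ∀ e ∈ KK, ∀ j, c.M j ≠ e := by
    intro e he j hj
    revert he hj
    induction e using Sym2.ind with
    | _ x y =>
      intro he hj
      refine hKKE _ he x (by simp) (S.e0 (c.ME0 j x ?_))
      rw [hj]; simp
  -- classification of edges within the new set
  have hedge : ∀ a ∈ E ∪ K, ∀ b ∈ E ∪ K, H.Adj a b → (a ∈ E ∧ b ∈ E) ∨
      (s(a, b) ∈ KK ∧ JJ.Adj (τ' a) (τ' b)) ∨ ((a ∈ c.X ∨ b ∈ c.X) ∧ c.Js.Adj (τ' a) (τ' b)) := by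
    have key : ∀ a ∈ K, ∀ b ∈ E ∪ K, H.Adj a b → (s(a, b) ∈ KK ∧ JJ.Adj (τ' a) (τ' b)) ∨
        ((a ∈ c.X ∨ b ∈ c.X) ∧ c.Js.Adj (τ' a) (τ' b)) := by
      intro a ha b hb hab
      have h := t4 a ha b hb hab
      rcases mem_union.1 hb with hbE | hbK
      · have hbX := S.nbr hbE (hKE a ha) (hKI a ha) hab.symm
        simp only [hJ, hbX, or_true, if_true] at h
        exact Or.inr ⟨Or.inr hbX, h⟩
      · simp only [hJ, hKX a ha, hKX b hbK, or_self, if_false] at h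
        refine Or.inl ⟨mem_filter.2 ⟨mem_univ _, hab, ?_⟩, h⟩
        intro x hx
        rcases Sym2.mem_iff.1 hx with rfl | rfl
        · exact ha
        · exact hbK
    intro a ha b hb hab
    rcases mem_union.1 ha with haE | haK
    · rcases mem_union.1 hb with hbE | hbK
      · exact Or.inl ⟨haE, hbE⟩
      · rcases key b hbK a ha hab.symm with h | h
        · rw [Sym2.eq_swap]; exact Or.inr (Or.inl ⟨h.1, h.2.symm⟩)
        · exact Or.inr (Or.inr ⟨h.1.symm, h.2.symm⟩)
    · exact Or.inr (key a haK b hb hab)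
  refine ⟨E ∪ K, τ', Bk', σ', ⟨?_, ?_, ?_, ?_, ?_, t1, ?_, ?_, ?_, ?_, ?_, ?_, ?_⟩, ?_⟩
  · exact S.e0.trans subset_union_left
  · intro w hw; rw [hτE w (S.e0 hw), S.agree w hw]
  · have : (E ∪ K ∪ c.RI) \ c.X = ((E ∪ c.RI) \ c.X) ∪ K := by
      ext w
      simp only [mem_sdiff, mem_union]
      have := hKX w
      tauto
    rw [this]
    exact S.clo.union (Clo.cls c.hs u)
  · intro i hi
    rcases mem_union.1 hi with h | h
    · exact S.dRI i h
    · exact hKI _ h (mem_image_of_mem _ (mem_univ i))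
  · rw [disjoint_union_left]; exact ⟨S.dQY, hKY⟩
  · intro a ha b hb hab
    rcases hedge a ha b hb hab with ⟨h1, h2⟩ | ⟨h1, h2⟩ | ⟨_, h⟩
    · rcases S.edge a h1 b h2 hab with h | h | h
      · exact Or.inl h
      · exact Or.inr (Or.inl (hBsub h))
      · rw [hτE a h1, hτE b h2]; exact Or.inr (Or.inr h)
    · by_cases hy : c.ey < Y.card
      · refine Or.inr (Or.inl ?_)
        rw [hBk', if_pos hy]; exact mem_union_right _ h1
      · rw [hJJ, if_neg hy] at h2
        exact Or.inr (Or.inr h2)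
    · exact Or.inr (Or.inr h)
  · intro e he
    rcases hBcase e he with h | ⟨h, _, _⟩
    · obtain ⟨h1, h2, h3⟩ := S.bkE e h
      exact ⟨h1, fun x hx => mem_union_left _ (h2 x hx), h3⟩
    · obtain ⟨_, h1, h2⟩ := mem_filter.1 h
      exact ⟨h1, fun x hx => mem_union_right _ (h2 x hx), hMK e h⟩
  · intro e he e' he' hee
    rcases hBcase e he with h | ⟨h, k, l⟩ <;> rcases hBcase e' he' with h' | ⟨h', k', l'⟩
    · simp only [hσ', h, h', if_true] at hee
      exact S.sinj h h' hee
    · simp only [hσ', h, k', if_true, if_false] at hee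
      have := ((hf l').1 e' h').1
      rw [← hee, hY, mem_sdiff] at this
      exact absurd (mem_image_of_mem σ h) this.2
    · simp only [hσ', h', k, if_true, if_false] at hee
      have := ((hf l).1 e h).1
      rw [hee, hY, mem_sdiff] at this
      exact absurd (mem_image_of_mem σ h') this.2
    · simp only [hσ', k, k', if_false] at hee
      exact (hf l).2 h h' hee
  · intro e he
    rcases hBcase e he with h | ⟨h, k, l⟩
    · simp only [hσ', h, if_true]
      refine ⟨(S.scol e h).1, ?_⟩
      rw [hmapE e (S.bkE e h).2.1]
      exact (S.scol e h).2
    · simp only [hσ', k, if_false]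
      have := (hf l).1 e h
      refine ⟨?_, this.2⟩
      exact (mem_sdiff.1 (mem_sdiff.1 this.1).1).2
  · intro w hw
    rcases mem_union.1 hw with h | h
    · rw [hτE w h]; exact S.dP w h
    · have h1 := t3 w h
      simp only [hT, h, if_true] at h1
      split_ifs at h1 with hx
      · exact disjoint_left.1 c.Rp_Vs (mem_filter.1 (mem_sdiff.1 h1).1).1
      · simp only [Fr, mem_sdiff, mem_union, not_or] at h1
        exact h1.2.1.2
  · intro w hw hv
    rcases mem_union.1 hw with h | h
    · rw [hτE w h] at hv; exact S.vs w h hv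
    · have h1 := t3 w h
      simp only [hT, h, if_true] at h1
      split_ifs at h1 with hx
      · exact hx
      · simp only [Fr, mem_sdiff, mem_union, not_or] at h1
        exact absurd hv h1.2.1.1
  · have himg : Bk.image σ ⊆ Bk'.image σ' := by
      intro x hx
      obtain ⟨e, he, rfl⟩ := mem_image.1 hx
      refine mem_image.2 ⟨e, hBsub he, ?_⟩
      simp only [hσ', he, if_true]
    have hle : ((((univ \ c.Ds) \ Bk'.image σ').card : ℕ) : ℝ) ≤ Y.card := by
      exact_mod_cast card_le_card (sdiff_subset_sdiff (Subset.refl _) himg)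
    by_cases hy : c.ey < Y.card
    · right
      have hold := S.alt.resolve_left (not_le.2 hy)
      intro a ha b hb hab
      rcases hedge a ha b hb hab with ⟨h1, h2⟩ | ⟨h1, h2⟩ | ⟨h | h, _⟩
      · rcases hold a h1 b h2 hab with h | h | h
        · exact Or.inl h
        · exact Or.inr (Or.inl (hBsub h))
        · exact Or.inr (Or.inr h)
      · refine Or.inr (Or.inl ?_)
        rw [hBk', if_pos hy]; exact mem_union_right _ h1
      · exact Or.inr (Or.inr (Or.inl (c.XXI h)))
      · exact Or.inr (Or.inr (Or.inr (c.XXI h)))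
    · left
      exact hle.trans (not_lt.1 hy)
  · rw [card_union_of_disjoint (by rw [disjoint_right]; exact hKE)]
    have := card_pos.2 (⟨u, c.hs.mem u huX⟩ : K.Nonempty)
    omega

theorem St.few_colours (S : St c E τ Bk σ) (hez : (c.Fr E τ).card ≤ c.ez) :
    (((univ \ c.Ds) \ Bk.image σ).card : ℝ) ≤ c.ey := by
  rcases S.alt with h | h
  · exact h
  exfalso
  set EE := (univ : Finset (Sym2 W)).filter (fun e => e ∈ H.edgeSet) with hEE
  set MM := (univ : Finset (Fin c.mc)).image c.M with hMM
  set T := EE \ (Bk ∪ MM) with hT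
  have h1 : T.card ≤ c.Δ * (c.XI ∪ (univ \ E)).card := by
    refine touch_card H c.Δ c.hdeg _ T ?_
    intro e he
    rw [hT, mem_sdiff, mem_union, not_or] at he
    obtain ⟨h1, h2, h3⟩ := he
    have h1' := (mem_filter.1 h1).2
    refine ⟨h1', ?_⟩
    revert h1 h1' h2 h3
    induction e using Sym2.ind with
    | _ x y =>
      intro h1 h2 h3 h1'
      by_cases hx : x ∈ E
      · by_cases hy : y ∈ E
        · rcases h x hx y hy h1' with ⟨j, hj⟩ | h | h | h
          · exact absurd (mem_image.2 ⟨j, mem_univ _, hj⟩) h3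
          · exact absurd h h2
          · exact ⟨x, mem_union_left _ h, by simp⟩
          · exact ⟨y, mem_union_left _ h, by simp⟩
        · exact ⟨y, mem_union_right _ (by simpa using hy), by simp⟩
      · exact ⟨x, mem_union_right _ (by simpa using hx), by simp⟩
  have h2 : (c.XI ∪ (univ \ E)).card ≤ c.XI.card + (univ \ E).card := card_union_le _ _
  have h3 : (univ \ E).card = Fintype.card W - E.card := by
    rw [card_sdiff_of_subset (subset_univ _), card_univ]
  have h4 := S.cardV
  rw [c.hVW] at h4
  have h5 : (c.Vs \ E.image τ).card ≤ c.Vs.card := card_le_card sdiff_subset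
  have h6 : (univ \ E).card ≤ (c.Fr E τ).card + 2 * c.t + c.Vs.card := by
    have := c.Rp_card
    omega
  have h7 : ((c.XI ∪ (univ \ E)).card : ℝ) ≤ c.XI.card + ((c.Fr E τ).card + 2 * c.t + c.Vs.card) := by
    exact_mod_cast h2.trans (by omega)
  have h8 : c.rc ≤ T.card := by
    have e1 : EE.card ≤ T.card + (Bk ∪ MM).card := card_le_card_sdiff_add_card
    have e2 : (Bk ∪ MM).card ≤ Bk.card + MM.card := card_union_le _ _
    have e3 : MM.card ≤ c.mc := card_image_le.trans (by simp)
    have e4 : EE.card = Fintype.card C := c.hEC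
    have e5 : Bk.card + c.Ds.card ≤ Fintype.card C := by
      rw [← card_image_of_injOn S.sinj, ← card_union_of_disjoint, ← card_univ]
      · exact card_le_card (subset_univ _)
      · rw [disjoint_left]
        intro x hx
        obtain ⟨e, he, rfl⟩ := mem_image.1 hx
        exact (S.scol e he).1
    have := c.hDs
    omega
  have h9 : (c.rc : ℝ) ≤ c.Δ * ((c.XI ∪ (univ \ E)).card : ℝ) := by exact_mod_cast h8.trans h1
  have h10 := c.n6
  have h11 : (c.Δ : ℝ) * ((c.XI ∪ (univ \ E)).card : ℝ) ≤ c.Δ * (c.XI.card + c.Vs.card + 2 * c.t + c.ez) := by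
    gcongr
    linarith
  linarith

/-- the growth phase -/
theorem St.grow [Nonempty V] [Nonempty C] (S : St c E τ Bk σ) :
    ∃ E' τ' Bk' σ', St c E' τ' Bk' σ' ∧ ((c.Fr E' τ').card : ℝ) ≤ c.ez := by
  obtain ⟨E', hE', hmax⟩ := exists_max_image ((univ : Finset (Finset W)).filter
    (fun E => ∃ τ Bk σ, St c E τ Bk σ)) card ⟨E, by simp only [mem_filter, mem_univ, true_and]; exact ⟨τ, Bk, σ, S⟩⟩
  simp only [mem_filter, mem_univ, true_and] at hE' hmax
  obtain ⟨τ', Bk', σ', S'⟩ := hE'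
  refine ⟨E', τ', Bk', σ', S', ?_⟩
  by_contra hcon
  push Not at hcon
  obtain ⟨E2, τ2, B2, σ2, S2, h⟩ := S'.extend hcon
  have := hmax E2 ⟨τ2, B2, σ2, S2⟩
  omega

end Ctx

theorem adj_bl {W : Type} [Fintype W] {H : SimpleGraph W} {r x w : W} (h : x ∈ ba H r) (hw : H.Adj x w) :
    w ∈ bl H r := (mem_bl H r w).2 ⟨x, h, (mem_ba H x w).2 (Or.inr hw)⟩

theorem fin2_cases (a : Fin 2) : a = 0 ∨ a = 1 := by
  fin_cases a
  · exact Or.inl rfl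
  · exact Or.inr rfl

/-- an edge is determined by its ends -/
theorem fin2_inj {α : Type} (f : Fin 2 → α) (h : f 0 ≠ f 1) : Function.Injective f := by
  intro a b hab
  rcases fin2_cases a with rfl | rfl <;> rcases fin2_cases b with rfl | rfl
  · rfl
  · exact absurd hab h
  · exact absurd hab.symm h
  · rfl

/-- compatibility sets of planted groups -/
theorem compat_card {V W ι : Type} [Fintype W] [Fintype ι] (H : SimpleGraph W) (J : ι → SimpleGraph V)
    (S : Finset V) (pos root : ι → W) (img : ι → V) (hba : ∀ i, pos i ∈ ba H (root i))
    (hfar : ∀ i i', root i ≠ root i' → Disjoint (bl H (root i)) (bl H (root i'))) (cc : ℝ)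
    (hcS : cc ≤ S.card)
    (hg : ∀ i, cc ≤ ((S.filter (fun v => ∀ i', root i' = root i → (J i').Adj (img i') v)).card : ℝ)) (w : W) :
    cc ≤ ((S.filter (fun v => ∀ i, H.Adj (pos i) w → (J i).Adj (img i) v)).card : ℝ) := by
  by_cases h : ∃ i, H.Adj (pos i) w
  · obtain ⟨i, hi⟩ := h
    refine (hg i).trans ?_
    have : (S.filter (fun v => ∀ i', root i' = root i → (J i').Adj (img i') v)) ⊆
        (S.filter (fun v => ∀ i, H.Adj (pos i) w → (J i).Adj (img i) v)) := by
      intro v hv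
      rw [mem_filter] at hv ⊢
      refine ⟨hv.1, fun i' hi' => hv.2 i' ?_⟩
      by_contra hne
      exact disjoint_left.1 (hfar _ _ hne) (adj_bl (hba i') hi') (adj_bl (hba i) hi)
    exact_mod_cast card_le_card this
  · have : S.filter (fun v => ∀ i, H.Adj (pos i) w → (J i).Adj (img i) v) = S := by
      apply filter_true_of_mem
      intro v _ i hi
      exact absurd ⟨i, hi⟩ h
    rw [this]; exact hcS

namespace Ctx
variable {V W C : Type} [Fintype V] [Fintype W] [Fintype C] {G : C → SimpleGraph V} {H : SimpleGraph W}
variable {c : Ctx G H} {E : Finset W} {τ : W → V} {Bk : Finset (Sym2 W)} {σ : Sym2 W → C}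

set_option maxHeartbeats 2000000 in
/-- data planted before the last embedding phase -/
theorem St.plant [Nonempty V] [Nonempty C] (S : St c E τ Bk σ) (hez : (c.Fr E τ).card ≤ c.ez) :
    ∃ (Y : Finset C) (ι : Type) (_ : Fintype ι) (pos root : ι → W) (img : ι → V)
      (yy : ↥Y → Sym2 W),
      Y = (univ \ c.Ds) \ Bk.image σ ∧
      (∀ i, pos i ∈ ba H (root i)) ∧
      (∀ i i', root i ≠ root i' → Disjoint (bl H (root i)) (bl H (root i'))) ∧
      (∀ i, Iso H c.X (root i)) ∧ (∀ i, ∀ w ∈ bl H (root i), w ∉ E ∧ w ∉ c.RI) ∧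
      Function.Injective pos ∧ Function.Injective img ∧
      univ.image img = c.Fr E τ ∪ c.Rp ∧
      (∀ i, c.θ ^ 2 * (c.Vs.card : ℝ) ≤ ((c.Vs.filter (fun v => ∀ i', root i' = root i →
        c.Js.Adj (img i') v)).card : ℝ)) ∧
      Function.Injective yy ∧
      (∀ y, ∃ i i', yy y = s(pos i, pos i') ∧ H.Adj (pos i) (pos i') ∧
        (G (y : C)).Adj (img i) (img i')) ∧
      (∀ i i', H.Adj (pos i) (pos i') → ∃ y, yy y = s(pos i, pos i')) := by
  set Y := (univ \ c.Ds) \ Bk.image σ with hY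
  have hYc : (Y.card : ℝ) ≤ c.ey := S.few_colours hez
  obtain ⟨iy, hiy, hiyi⟩ := list_choice Y
    (fun y => (range c.t).filter (fun i => (G y).Adj (c.p i 0) (c.p i 1))) (fun y _ => by
      exact_mod_cast hYc.trans (c.pcol y))
  have hiyt : ∀ y : ↥Y, iy y < c.t := fun y => mem_range.1 (mem_filter.1 (hiy y y.2)).1
  have hiyne : ∀ y y' : ↥Y, y ≠ y' → iy y ≠ iy y' := by
    intro y y' h h'
    exact h (Subtype.ext (hiyi y.2 y'.2 h'))
  have hYny : Fintype.card ↥Y ≤ Fintype.card (Fin c.ny) := by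
    rw [Fintype.card_coe, Fintype.card_fin]
    exact_mod_cast hYc.trans c.hny
  obtain ⟨g⟩ := Function.Embedding.nonempty_of_card_le hYny
  set Z := c.Fr E τ ∪ c.Rp with hZ
  set UP := (univ : Finset (↥Y × Fin 2)).image (fun q => c.p (iy q.1) q.2) with hUP
  set Z' := Z \ UP with hZ'
  set U := (univ : Finset W).filter (fun w => w ∉ E ∧ w ∉ c.RI ∧ w ∉ c.QY ∧ Iso H c.X w) with hU
  obtain ⟨R0, hR0, hR0far, hR0c⟩ := far_subset H c.Δ c.hdeg U
  have hcount : Z'.card ≤ R0.card := by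
    have h1 : (univ : Finset W) ⊆ U ∪ (E ∪ (c.RI ∪ (c.QY ∪ univ.filter (fun v => ¬ Iso H c.X v)))) := by
      intro w _
      simp only [hU, mem_union, mem_filter, mem_univ, true_and]
      tauto
    have h2 : Fintype.card W ≤ U.card + (E.card + (c.RI.card + (c.QY.card + c.X.card * (c.Δ + 1) ^ 4))) := by
      rw [← card_univ]
      refine (card_le_card h1).trans ((card_union_le _ _).trans (Nat.add_le_add_left ?_ _))
      refine (card_union_le _ _).trans (Nat.add_le_add_left ?_ _)
      refine (card_union_le _ _).trans (Nat.add_le_add_left ?_ _)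
      exact (card_union_le _ _).trans (Nat.add_le_add_left (not_iso_card H c.Δ c.hdeg c.X) _)
    have h3 := S.cardV
    rw [c.hVW] at h3
    rw [c.RI_card] at h2
    have h4 : (c.Vs \ E.image τ).card ≤ R0.card * (c.Δ + 1) ^ 4 + c.mv + c.QY.card + c.X.card * (c.Δ + 1) ^ 4 := by
      omega
    have h4' : ((c.Vs \ E.image τ).card : ℝ) ≤ R0.card * ((c.Δ:ℝ) + 1) ^ 4 + c.mv + c.QY.card +
        c.X.card * ((c.Δ:ℝ) + 1) ^ 4 := by exact_mod_cast h4
    have h5 := S.Vs_card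
    have h6 := c.n5
    have hp : (0:ℝ) < ((c.Δ:ℝ) + 1) ^ 4 := by positivity
    have h7 : (c.X.card : ℝ) * ((c.Δ:ℝ) + 1) ^ 4 ≤ ((c.Δ:ℝ) + 1) ^ 4 * c.mu := by
      rw [mul_comm]; exact mul_le_mul_of_nonneg_left c.hs.hX hp.le
    have h8 : ((c.Δ:ℝ) + 1) ^ 4 * (2 * c.t + c.ez) ≤ ((c.Δ:ℝ) + 1) ^ 4 * R0.card := by linarith
    have h9 : 2 * (c.t : ℝ) + c.ez ≤ R0.card := le_of_mul_le_mul_left h8 hp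
    have h10 : (Z'.card : ℝ) ≤ c.ez + 2 * c.t := by
      have e1 : Z'.card ≤ (c.Fr E τ).card + c.Rp.card := (card_le_card sdiff_subset).trans (card_union_le _ _)
      rw [c.Rp_card] at e1
      have e2 : (Z'.card : ℝ) ≤ (c.Fr E τ).card + 2 * c.t := by exact_mod_cast e1
      linarith
    have h11 : (Z'.card : ℝ) ≤ R0.card := by linarith
    exact_mod_cast h11
  have hneW : Nonempty W := by
    have : 0 < Fintype.card W := by rw [← c.hVW]; exact Fintype.card_pos
    exact Fintype.card_pos_iff.1 this
  obtain ⟨rz, hrz, hrzi⟩ := list_choice Z' (fun _ => R0) (fun _ _ => hcount)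
  have hrzU : ∀ z : ↥Z', rz z ∉ E ∧ rz z ∉ c.RI ∧ rz z ∉ c.QY ∧ Iso H c.X (rz z) := fun z =>
    (mem_filter.1 (hR0 (hrz z z.2))).2
  have hrzX : ∀ z : ↥Z', rz z ∉ c.X := fun z => ((hrzU z).2.2.2 _ (self_bl H _)).1
  let pos : (↥Y × Fin 2) ⊕ ↥Z' → W := Sum.elim (fun q => if q.2 = 0 then c.aY (g q.1) else c.bY (g q.1)) (fun z => rz z)
  let root : (↥Y × Fin 2) ⊕ ↥Z' → W := Sum.elim (fun q => c.aY (g q.1)) (fun z => rz z)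
  let img : (↥Y × Fin 2) ⊕ ↥Z' → V := Sum.elim (fun q => c.p (iy q.1) q.2) (fun z => z)
  have hba : ∀ i, pos i ∈ ba H (root i) := by
    rintro (⟨y, a⟩ | z)
    · simp only [pos, root, Sum.elim_inl]
      split_ifs
      · exact self_ba H _
      · exact (mem_ba H _ _).2 (Or.inr (c.abY _))
    · exact self_ba H _
  have hblY : ∀ j, bl H (c.aY j) ⊆ c.QY := fun j =>
    (iso_bl c.hs (c.aIso j)).trans (c.QYc _ (c.aYQ j)).2
  have hblz : ∀ z : ↥Z', Disjoint (bl H (rz z)) c.QY := fun z =>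
    (c.QYc.disj c.hs (hrzU z).2.2.1 (hrzX z)).mono_left (iso_bl c.hs (hrzU z).2.2.2)
  have hfar : ∀ i i', root i ≠ root i' → Disjoint (bl H (root i)) (bl H (root i')) := by
    rintro (⟨y, a⟩ | z) (⟨y', a'⟩ | z') h
    · simp only [root, Sum.elim_inl] at h ⊢
      exact c.afar _ _ (fun e => h (by rw [e]))
    · simp only [root, Sum.elim_inl, Sum.elim_inr] at h ⊢
      exact ((hblz z').mono_right (hblY _)).symm
    · simp only [root, Sum.elim_inl, Sum.elim_inr] at h ⊢
      exact (hblz z).mono_right (hblY _)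
    · simp only [root, Sum.elim_inr] at h ⊢
      exact hR0far _ (hrz z z.2) _ (hrz z' z'.2) h
  have hagj : Function.Injective (fun y : ↥Y => c.aY (g y)) := by
    intro y y' h
    by_contra hne
    have := c.afar (g y) (g y') (fun e => hne (g.injective e))
    simp only at h
    rw [h] at this
    exact disjoint_left.1 this (self_bl H _) (self_bl H _)
  have hrzj : Function.Injective (fun z : ↥Z' => rz z) := by
    intro z z' h
    exact Subtype.ext (hrzi z.2 z'.2 h)
  have hposroot : ∀ i i', pos i = pos i' → root i = root i' := by
    intro i i' h
    by_contra hne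
    exact disjoint_left.1 (hfar i i' hne) (ba_sub_bl H _ (hba i)) (h ▸ ba_sub_bl H _ (hba i'))
  have hAQ : ∀ j, c.aY j ∈ c.QY := c.aYQ
  have hposi : Function.Injective pos := by
    intro i i' h
    have hr := hposroot i i' h
    rcases i with ⟨y, a⟩ | z <;> rcases i' with ⟨y', a'⟩ | z'
    · simp only [root, Sum.elim_inl] at hr
      have hyy := hagj hr
      subst hyy
      simp only [pos, Sum.elim_inl] at h
      have hne := (c.abY (g y)).ne
      rw [fin2_inj (fun a : Fin 2 => if a = 0 then c.aY (g y) else c.bY (g y)) (by simpa using hne) h]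
    · simp only [root, Sum.elim_inl, Sum.elim_inr] at hr
      exact absurd (hr ▸ hAQ _) (hrzU z').2.2.1
    · simp only [root, Sum.elim_inl, Sum.elim_inr] at hr
      exact absurd (hr ▸ hAQ _) (hrzU z).2.2.1
    · simp only [root, Sum.elim_inr] at hr
      rw [hrzj hr]
  have hpz : ∀ (z : ↥Z') (y : ↥Y) (a : Fin 2), c.p (iy y) a ≠ z := by
    intro z y a h
    have h1 := (mem_sdiff.1 z.2).2
    exact h1 (mem_image.2 ⟨(y, a), mem_univ _, h⟩)
  have himgi : Function.Injective img := by
    rintro (⟨y, a⟩ | z) (⟨y', a'⟩ | z') h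
    · simp only [img, Sum.elim_inl] at h
      by_cases hy : y = y'
      · subst hy
        have hne := c.pne (iy y) (hiyt y)
        rw [fin2_inj (c.p (iy y)) hne h]
      · exact absurd h (c.pdisj _ (hiyt y) _ (hiyt y') (hiyne y y' hy) a a')
    · simp only [img, Sum.elim_inl, Sum.elim_inr] at h
      exact absurd h (hpz _ _ _)
    · simp only [img, Sum.elim_inl, Sum.elim_inr] at h
      exact absurd h.symm (hpz _ _ _)
    · simp only [img, Sum.elim_inr] at h
      rw [Subtype.ext h]
  have hroots : ∀ i i', root i = root i' → (∃ y a a', i = Sum.inl (y, a) ∧ i' = Sum.inl (y, a')) ∨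
      (∃ z, i = Sum.inr z ∧ i' = Sum.inr z) := by
    rintro (⟨y, a⟩ | z) (⟨y', a'⟩ | z') h
    · simp only [root, Sum.elim_inl] at h
      have hyy := hagj h
      subst hyy
      exact Or.inl ⟨y, a, a', rfl, rfl⟩
    · simp only [root, Sum.elim_inl, Sum.elim_inr] at h
      exact absurd (h ▸ hAQ _) (hrzU z').2.2.1
    · simp only [root, Sum.elim_inl, Sum.elim_inr] at h
      exact absurd (h ▸ hAQ _) (hrzU z).2.2.1
    · simp only [root, Sum.elim_inr] at h
      have := hrzj h
      subst this
      exact Or.inr ⟨z, rfl, rfl⟩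
  refine ⟨Y, (↥Y × Fin 2) ⊕ ↥Z', inferInstance, pos, root, img, fun y => s(c.aY (g y), c.bY (g y)), rfl, hba, hfar,
    ?_, ?_, hposi, himgi, ?_, ?_, ?_, ?_, ?_⟩
  · rintro (⟨y, a⟩ | z)
    · exact c.aIso _
    · exact (hrzU z).2.2.2
  · rintro (⟨y, a⟩ | z) w hw
    · have := hblY _ hw
      refine ⟨fun h => disjoint_left.1 S.dQY h this, fun h => ?_⟩
      obtain ⟨i, _, rfl⟩ := mem_image.1 h
      exact c.QYI i this
    · have h1 := iso_bl c.hs (hrzU z).2.2.2 hw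
      have h2 := S.clo.disj c.hs (u := rz z) (by
        intro h
        rcases mem_union.1 (mem_sdiff.1 h).1 with h | h
        · exact (hrzU z).1 h
        · exact (hrzU z).2.1 h) (hrzX z)
      have hwX := ((hrzU z).2.2.2 w hw).1
      have h3 := disjoint_left.1 h2 h1
      rw [mem_sdiff, mem_union] at h3
      tauto
  · ext v
    simp only [mem_image, mem_univ, true_and]
    constructor
    · rintro ⟨(⟨y, a⟩ | z), rfl⟩
      · exact mem_union_right _ ((c.mem_Rp _).2 ⟨_, hiyt y, a, rfl⟩)
      · exact (mem_sdiff.1 z.2).1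
    · intro hv
      by_cases h : v ∈ UP
      · obtain ⟨⟨y, a⟩, _, h⟩ := mem_image.1 h
        exact ⟨Sum.inl (y, a), h⟩
      · exact ⟨Sum.inr ⟨v, mem_sdiff.2 ⟨hv, h⟩⟩, rfl⟩
  · have hθ2 : c.θ ^ 2 ≤ c.θ := by
      have := c.hθ0; have := c.hθ1; nlinarith
    rintro (⟨y, a⟩ | z)
    · refine (c.pnb (iy y) (hiyt y)).trans ?_
      have : c.Vs.filter (fun v => ∀ a, (thick G c.θ c.Ds).Adj (c.p (iy y) a) v) ⊆
          c.Vs.filter (fun v => ∀ i', root i' = root (Sum.inl (y, a)) → c.Js.Adj (img i') v) := by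
        intro v hv
        rw [mem_filter] at hv ⊢
        refine ⟨hv.1, fun i' hi' => ?_⟩
        rcases hroots _ _ hi' with ⟨y', a1, a2, h1, h2⟩ | ⟨z, h1, h2⟩
        · simp only [Sum.inl.injEq, Prod.mk.injEq] at h2
          rw [h1, ← h2.1]
          exact hv.2 a1
        · exact absurd h2 (by simp)
      exact_mod_cast card_le_card this
    · have key : ∀ N : Finset V, N ⊆ c.Vs.filter (fun v => c.Js.Adj (z : V) v) →
          N ⊆ c.Vs.filter (fun v => ∀ i', root i' = root (Sum.inr z) → c.Js.Adj (img i') v) := by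
        intro N hN v hv
        have := mem_filter.1 (hN hv)
        rw [mem_filter]
        refine ⟨this.1, fun i' hi' => ?_⟩
        rcases hroots _ _ hi' with ⟨y', a1, a2, h1, h2⟩ | ⟨z', h1, h2⟩
        · exact absurd h2 (by simp)
        · simp only [Sum.inr.injEq] at h2
          rw [h1, ← h2]
          exact this.2
      rcases mem_union.1 (mem_sdiff.1 z.2).1 with hz | hz
      · simp only [Fr, mem_sdiff, mem_univ, true_and, mem_union, not_or] at hz
        have hg := c.good z hz.1.1 (fun i hi a h => hz.1.2 ((c.mem_Rp _).2 ⟨i, hi, a, h⟩)) (by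
          intro h
          obtain ⟨w, hw, h⟩ := mem_image.1 h
          refine hz.2 (mem_image.2 ⟨w, S.e0 hw, ?_⟩)
          rw [S.agree w hw, h])
        have h1 : c.θ ^ 2 * (c.Vs.card : ℝ) ≤ c.θ * c.Vs.card := by gcongr
        refine (h1.trans hg).trans ?_
        exact_mod_cast card_le_card (key _ (Subset.refl _))
      · obtain ⟨i, hi, a, h⟩ := (c.mem_Rp _).1 hz
        refine (c.pnb i hi).trans ?_
        refine Nat.cast_le.2 (card_le_card (key _ ?_))
        intro v hv
        rw [mem_filter] at hv ⊢
        refine ⟨hv.1, ?_⟩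
        rw [← h]; exact hv.2 a
  · intro y y' h
    apply hagj
    by_contra hne
    have hd := c.afar (g y) (g y') (fun e => hne (by simp only [e]))
    simp only at h
    have : c.aY (g y) ∈ s(c.aY (g y'), c.bY (g y')) := by rw [← h]; simp
    rcases Sym2.mem_iff.1 this with h | h
    · exact hne h
    · refine disjoint_left.1 hd (self_bl H _) ?_
      rw [h]
      exact ba_sub_bl H _ ((mem_ba H _ _).2 (Or.inr (c.abY _)))
  · intro y
    refine ⟨Sum.inl (y, 0), Sum.inl (y, 1), by simp [pos], ?_, ?_⟩
    · simpa [pos] using c.abY (g y)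
    · exact (mem_filter.1 (hiy y y.2)).2
  · intro i i' h
    have hr : root i = root i' := by
      by_contra hne
      exact disjoint_left.1 (hfar i i' hne) (adj_bl (hba i) h |> fun _ => ba_sub_bl H _ (hba i))
        (adj_bl (hba i') h.symm)
    rcases hroots _ _ hr with ⟨y, a, a', h1, h2⟩ | ⟨z, h1, h2⟩
    · subst h1 h2
      refine ⟨y, ?_⟩
      simp only [pos, Sum.elim_inl] at h ⊢
      rcases fin2_cases a with ha | ha <;> rcases fin2_cases a' with ha' | ha'
      · rw [ha, ha'] at h; exact absurd h H.irrefl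
      · rw [ha, ha']; simp
      · rw [ha, ha', Sym2.eq_swap]; simp
      · rw [ha, ha'] at h; exact absurd h H.irrefl
    · rw [h1, h2] at h
      exact absurd h (H.irrefl)

end Ctx

namespace Ctx
variable {V W C : Type} [Fintype V] [Fintype W] [Fintype C] {G : C → SimpleGraph V} {H : SimpleGraph W}
variable {c : Ctx G H} {E : Finset W} {τ : W → V} {Bk : Finset (Sym2 W)} {σ : Sym2 W → C}

set_option maxHeartbeats 2000000 in
theorem St.finish [Nonempty V] [Nonempty C] (S : St c E τ Bk σ) (hez : (c.Fr E τ).card ≤ c.ez) :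
    HasTransversal G H := by
  obtain ⟨Y, ι, hfι, pos, root, img, yy, hY, hba, hfar, hiso, hout, hposi, himgi, himg, hnb, hyyi, hyy, hadj⟩ :=
    S.plant hez
  have hblpos : ∀ i, pos i ∈ bl H (root i) := fun i => ba_sub_bl H _ (hba i)
  set P2 := (univ : Finset ι).image pos with hP2
  have hP2E : ∀ w ∈ P2, w ∉ E := by
    intro w hw
    obtain ⟨i, _, rfl⟩ := mem_image.1 hw
    exact (hout i _ (hblpos i)).1
  have hP2I : ∀ w ∈ P2, w ∉ c.RI := by
    intro w hw
    obtain ⟨i, _, rfl⟩ := mem_image.1 hw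
    exact (hout i _ (hblpos i)).2
  set τ2 : W → V := fun w => if w ∈ E then τ w else Function.extend pos img τ w with hτ2
  have hτ_2E : ∀ w ∈ E, τ2 w = τ w := fun w hw => by simp only [hτ2, hw, if_true]
  have hτ_2P : ∀ i, τ2 (pos i) = img i := fun i => by
    simp only [hτ2, (hout i _ (hblpos i)).1, if_false]
    exact hposi.extend_apply _ _ _
  have himgZ : ∀ i, img i ∉ c.Vs ∧ img i ∉ E.image τ := by
    intro i
    have : img i ∈ c.Fr E τ ∪ c.Rp := by rw [← himg]; exact mem_image_of_mem _ (mem_univ i)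
    rcases mem_union.1 this with h | h
    · simp only [Fr, mem_sdiff, mem_univ, true_and, mem_union, not_or] at h
      exact ⟨h.1.1, h.2⟩
    · refine ⟨disjoint_right.1 c.Rp_Vs h, fun h' => ?_⟩
      obtain ⟨w, hw, e⟩ := mem_image.1 h'
      exact S.dP w hw (e ▸ h)
  have hτ_2inj : Set.InjOn τ2 ((E ∪ P2 : Finset W) : Set W) := by
    intro a ha b hb hab
    simp only [coe_union, Set.mem_union, mem_coe] at ha hb
    rcases ha with ha | ha <;> rcases hb with hb | hb
    · rw [hτ_2E a ha, hτ_2E b hb] at hab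
      exact S.inj ha hb hab
    · obtain ⟨i, _, rfl⟩ := mem_image.1 hb
      rw [hτ_2E a ha, hτ_2P] at hab
      exact absurd (mem_image.2 ⟨a, ha, hab⟩) (himgZ i).2
    · obtain ⟨i, _, rfl⟩ := mem_image.1 ha
      rw [hτ_2E b hb, hτ_2P] at hab
      exact absurd (mem_image.2 ⟨b, hb, hab.symm⟩) (himgZ i).2
    · obtain ⟨i, _, rfl⟩ := mem_image.1 ha
      obtain ⟨j, _, rfl⟩ := mem_image.1 hb
      rw [hτ_2P, hτ_2P] at hab
      rw [himgi hab]
  set Q2 := (univ : Finset W) \ (E ∪ P2 ∪ c.RI) with hQ2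
  have hRIE : Disjoint (E ∪ P2) c.RI := by
    rw [disjoint_right]
    intro w hw h
    rcases mem_union.1 h with h | h
    · obtain ⟨i, _, rfl⟩ := mem_image.1 hw
      exact S.dRI i h
    · exact hP2I w h hw
  have hEP : Disjoint E P2 := by rw [disjoint_right]; exact hP2E
  have hP2c : P2.card = (c.Fr E τ).card + c.Rp.card := by
    rw [hP2, card_image_of_injective _ hposi, ← card_image_of_injective _ himgi, himg, card_union_of_disjoint]
    rw [disjoint_left]
    intro v hv
    simp only [Fr, mem_sdiff, mem_univ, true_and, mem_union, not_or] at hv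
    exact hv.1.2
  have hQ2c : Q2.card + c.mv = (c.Vs \ E.image τ).card := by
    have h1 : Q2.card = (univ : Finset W).card - (E ∪ P2 ∪ c.RI).card := card_sdiff_of_subset (subset_univ _)
    have h2 : (E ∪ P2 ∪ c.RI).card ≤ (univ : Finset W).card := card_le_card (subset_univ _)
    rw [card_union_of_disjoint hRIE, card_union_of_disjoint hEP, c.RI_card] at h1 h2
    have h3 := S.cardV
    rw [c.hVW] at h3
    rw [card_univ] at h1 h2
    omega
  have hQ2r : (Q2.card : ℝ) ≤ c.rv := by
    have h1 : (c.Vs \ E.image τ).card ≤ c.Vs.card := card_le_card sdiff_subset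
    have := c.hVs
    have : Q2.card ≤ c.rv := by omega
    exact_mod_cast this
  have hθp : 0 < c.θ ^ c.Δ := pow_pos c.hθ0 _
  set cp : W → Finset V := fun w => (c.Vs.filter (fun v => ∀ i, H.Adj (pos i) w → c.Js.Adj (img i) v)) with hcp
  have hθΔ : c.θ ^ (c.Δ + 1) ≤ c.θ ^ 2 := pow_le_pow_of_le_one c.hθ0.le c.hθ1 (by have := c.hΔ; omega)
  have hθΔ' : c.θ ^ (c.Δ + 1) ≤ c.θ ^ c.Δ := pow_le_pow_of_le_one c.hθ0.le c.hθ1 (by omega)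
  have hcpc : ∀ w, c.θ ^ (c.Δ + 1) * c.Vs.card - c.Δ * c.mu ≤ ((cp w \ E.image τ).card : ℝ) := by
    intro w
    have h0 : c.θ ^ 2 * (c.Vs.card : ℝ) ≤ c.Vs.card := by
      have : c.θ ^ 2 ≤ 1 := pow_le_one₀ c.hθ0.le c.hθ1
      have h : (0:ℝ) ≤ c.Vs.card := by positivity
      nlinarith
    have h1 := compat_card H (fun _ => c.Js) c.Vs pos root img hba hfar (c.θ ^ 2 * (c.Vs.card : ℝ)) h0 hnb w
    have h2 := card_sdiff_add_card_inter (cp w) (E.image τ)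
    have h3 : ((cp w ∩ E.image τ).card : ℝ) ≤ c.Δ * c.mu := by
      refine le_trans ?_ S.used
      exact_mod_cast card_le_card (inter_subset_inter_right (filter_subset _ _))
    have h4 : ((cp w \ E.image τ).card : ℝ) + (cp w ∩ E.image τ).card = (cp w).card := by
      exact_mod_cast h2
    have h5 : c.θ ^ (c.Δ + 1) * (c.Vs.card : ℝ) ≤ c.θ ^ 2 * c.Vs.card := by gcongr
    have h6 : c.θ ^ 2 * (c.Vs.card : ℝ) ≤ (cp w).card := h1
    linarith
  set T : W → Finset V := fun w => if w ∈ Q2 then (if ∃ x ∈ c.X, H.Adj x w then c.cd w \ E.image τ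
    else cp w \ E.image τ) else univ with hT
  have hQ2E : ∀ w ∈ Q2, w ∉ E ∧ w ∉ P2 ∧ w ∉ c.RI := by
    intro w hw
    simp only [hQ2, mem_sdiff, mem_univ, true_and, mem_union, not_or] at hw
    exact ⟨hw.1.1, hw.1.2, hw.2⟩
  have hTK : ∀ w ∈ Q2, c.Δ * c.s + c.rv < c.θ ^ c.Δ * (T w).card := by
    intro w hw
    refine lt_of_lt_of_le c.n7 (mul_le_mul_of_nonneg_left ?_ hθp.le)
    simp only [hT, hw, if_true]
    split_ifs with h
    · refine le_trans ?_ (S.cd_sdiff w (fun h => (hQ2E w hw).1 (S.e0 h)) h)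
      have : c.θ ^ (c.Δ + 1) * (c.Vs.card : ℝ) ≤ c.θ ^ c.Δ * c.Vs.card := by gcongr
      linarith
    · exact hcpc w
  have hTV : ∀ w ∈ Q2, ∀ v ∈ T w, v ∈ c.Vs ∧ v ∉ E.image τ := by
    intro w hw v hv
    simp only [hT, hw, if_true] at hv
    split_ifs at hv with h
    · exact ⟨(mem_filter.1 (mem_sdiff.1 hv).1).1, (mem_sdiff.1 hv).2⟩
    · exact ⟨(mem_filter.1 (mem_sdiff.1 hv).1).1, (mem_sdiff.1 hv).2⟩
  have hΔs : c.s ≤ c.Δ * c.s := by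
    have : (1:ℝ) ≤ c.Δ := by exact_mod_cast c.hΔ
    have := mul_le_mul_of_nonneg_right this c.hs0
    linarith
  obtain ⟨τ3, t1, t2, t3, t4, -⟩ := gelP H c.Δ c.hdeg (fun _ _ => c.Js) (fun _ _ => rfl) c.θ c.s c.hθ0 c.hθ1
    (fun _ _ => c.LDs) T (E ∪ P2) Q2 (by
      rw [disjoint_right]
      intro w hw h
      rcases mem_union.1 h with h | h
      · exact (hQ2E w hw).1 h
      · exact (hQ2E w hw).2.1 h) τ2 hτ_2inj (by
      intro w
      by_cases hw : w ∈ Q2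
      · have := hTK w hw
        have h2 : (0:ℝ) ≤ c.rv := by positivity
        linarith
      · simp only [hT, hw, if_false, card_univ]
        exact c.n1) (by
      intro w hw
      refine lt_of_le_of_lt ?_ (hTK w hw)
      have h1 : ((Q2.filter (fun u => ¬ Disjoint (T u) (T w))).card : ℝ) ≤ Q2.card := by
        exact_mod_cast card_filter_le _ _
      linarith) (by
      intro w hw v hv a ha
      obtain ⟨hv1, hv2⟩ := hTV w hw v hv
      rcases mem_union.1 ha with ha | ha
      · rw [hτ_2E a ha]
        refine ⟨fun h => hv2 (h ▸ mem_image_of_mem τ ha), fun haw => ?_⟩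
        have haX := S.nbr ha (hQ2E w hw).1 (hQ2E w hw).2.2 haw
        have hex : ∃ x ∈ c.X, H.Adj x w := ⟨a, haX, haw⟩
        simp only [hT, hw, if_true, hex] at hv
        rw [S.agree a (c.XE0 haX)]
        exact (mem_filter.1 (mem_sdiff.1 hv).1).2 a haX haw
      · obtain ⟨i, _, rfl⟩ := mem_image.1 ha
        rw [hτ_2P]
        refine ⟨fun h => (himgZ i).1 (h ▸ hv1), fun haw => ?_⟩
        have hwbl := adj_bl (hba i) haw
        have hex : ¬ ∃ x ∈ c.X, H.Adj x w := by
          rintro ⟨x, hx, hxw⟩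
          exact (hiso i w hwbl).2 x hx hxw
        simp only [hT, hw, if_true, hex, if_false] at hv
        exact (mem_filter.1 (mem_sdiff.1 hv).1).2 i haw)
  have hτ_3E : ∀ w ∈ E, τ3 w = τ w := fun w hw => (t2 w (mem_union_left _ hw)).trans (hτ_2E w hw)
  have hτ_3P : ∀ i, τ3 (pos i) = img i := fun i =>
    (t2 _ (mem_union_right _ (mem_image_of_mem _ (mem_univ i)))).trans (hτ_2P i)
  have hall : ∀ w, w ∈ E ∪ P2 ∪ Q2 ↔ w ∉ c.RI := by
    intro w
    constructor
    · intro h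
      rcases mem_union.1 h with h | h
      · exact disjoint_left.1 hRIE h
      · exact (hQ2E w h).2.2
    · intro h
      by_cases h' : w ∈ E ∪ P2
      · exact mem_union_left _ h'
      · refine mem_union_right _ ?_
        rw [hQ2, mem_sdiff, mem_union]
        exact ⟨mem_univ _, fun h'' => h''.elim h' h⟩
  set A := E ∪ P2 ∪ Q2 with hA
  have hAc : A.card + c.mv = Fintype.card V := by
    have : A = univ \ c.RI := by ext w; rw [hall]; simp
    rw [this, card_sdiff_of_subset (subset_univ _), c.RI_card, card_univ, c.hVW]
    have : c.RI.card ≤ Fintype.card W := card_le_univ _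
    rw [c.RI_card] at this
    omega
  obtain ⟨f, hfi, hf⟩ := c.rIab (univ \ A.image τ3) (by
    intro v hv
    by_contra hvs
    have hv' := (mem_sdiff.1 hv).2
    by_cases hvE : v ∈ E.image τ
    · obtain ⟨w, hw, rfl⟩ := mem_image.1 hvE
      refine hv' (mem_image.2 ⟨w, ?_, hτ_3E w hw⟩)
      exact mem_union_left _ (mem_union_left _ hw)
    · have : v ∈ univ.image img := by
        rw [himg]
        by_cases hr : v ∈ c.Rp
        · exact mem_union_right _ hr
        · refine mem_union_left _ ?_
          simp only [Fr, mem_sdiff, mem_univ, true_and, mem_union, not_or]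
          exact ⟨⟨hvs, hr⟩, hvE⟩
      obtain ⟨i, _, rfl⟩ := mem_image.1 this
      refine hv' (mem_image.2 ⟨pos i, ?_, hτ_3P i⟩)
      exact mem_union_left _ (mem_union_right _ (mem_image_of_mem _ (mem_univ i)))) (by
    rw [card_sdiff_of_subset (subset_univ _), card_image_of_injOn t1, card_univ]
    omega)
  set τ4 : W → V := fun w => if w ∈ c.RI then Function.extend c.rI f τ3 w else τ3 w with hτ4
  have hτ_4A : ∀ w, w ∉ c.RI → τ4 w = τ3 w := fun w hw => by simp only [hτ4, hw, if_false]
  have hτ_4I : ∀ i, τ4 (c.rI i) = f i := fun i => by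
    have : c.rI i ∈ c.RI := mem_image_of_mem _ (mem_univ i)
    simp only [hτ4, this, if_true]
    exact c.rIinj.extend_apply _ _ _
  have hτ_4E : ∀ w ∈ E, τ4 w = τ w := fun w hw => by
    rw [hτ_4A w (disjoint_left.1 hRIE (mem_union_left _ hw)), hτ_3E w hw]
  have hτ_4P : ∀ i, τ4 (pos i) = img i := fun i => by
    rw [hτ_4A _ (hP2I _ (mem_image_of_mem _ (mem_univ i))), hτ_3P]
  have hτ_4inj : Function.Injective τ4 := by
    intro a b hab
    by_cases ha : a ∈ c.RI <;> by_cases hb : b ∈ c.RI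
    · obtain ⟨i, _, rfl⟩ := mem_image.1 ha
      obtain ⟨j, _, rfl⟩ := mem_image.1 hb
      rw [hτ_4I, hτ_4I] at hab
      rw [hfi hab]
    · obtain ⟨i, _, rfl⟩ := mem_image.1 ha
      rw [hτ_4I, hτ_4A b hb] at hab
      exact absurd (mem_image.2 ⟨b, (hall b).2 hb, hab.symm⟩) (mem_sdiff.1 (hf i).1).2
    · obtain ⟨i, _, rfl⟩ := mem_image.1 hb
      rw [hτ_4I, hτ_4A a ha] at hab
      exact absurd (mem_image.2 ⟨a, (hall a).2 ha, hab⟩) (mem_sdiff.1 (hf i).1).2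
    · rw [hτ_4A a ha, hτ_4A b hb] at hab
      exact t1 ((hall a).2 ha) ((hall b).2 hb) hab
  have hmapE : ∀ e : Sym2 W, (∀ x ∈ e, x ∈ E) → e.map τ4 = e.map τ := by
    intro e
    induction e using Sym2.ind with
    | _ x y =>
      intro h
      simp only [Sym2.map_mk]
      rw [hτ_4E x (h x (by simp)), hτ_4E y (h y (by simp))]
  have hmapE0 : ∀ e : Sym2 W, (∀ x ∈ e, x ∈ c.E0) → e.map τ4 = e.map c.τ1 := by
    intro e
    induction e using Sym2.ind with
    | _ x y =>
      intro h
      simp only [Sym2.map_mk]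
      rw [hτ_4E x (S.e0 (h x (by simp))), hτ_4E y (S.e0 (h y (by simp))), S.agree x (h x (by simp)),
        S.agree y (h y (by simp))]
  -- colours
  set YE := (univ : Finset ↥Y).image yy with hYE
  have hYEout : ∀ y, ∃ x ∈ yy y, x ∉ E := by
    intro y
    obtain ⟨i, i', h1, h2, h3⟩ := hyy y
    exact ⟨pos i, by rw [h1]; simp, hP2E _ (mem_image_of_mem _ (mem_univ i))⟩
  have hyyBk : ∀ y, yy y ∉ Bk := by
    intro y h
    obtain ⟨x, hx, hxE⟩ := hYEout y
    exact hxE ((S.bkE _ h).2.1 x hx)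
  set σ' : Sym2 W → C := fun e => if e ∈ Bk then σ e else
    Function.extend yy (fun y => (y : C)) σ e with hσ'
  have hσ'B : ∀ e ∈ Bk, σ' e = σ e := fun e he => by simp only [hσ', he, if_true]
  have hσ'Y : ∀ y, σ' (yy y) = y := fun y => by
    simp only [hσ', hyyBk y, if_false]
    exact hyyi.extend_apply _ _ _
  have hYmem : ∀ y : ↥Y, (y : C) ∉ c.Ds ∧ (y : C) ∉ Bk.image σ := by
    intro y
    have : (y : C) ∈ (univ \ c.Ds) \ Bk.image σ := hY ▸ y.2
    exact ⟨(mem_sdiff.1 (mem_sdiff.1 this).1).2, (mem_sdiff.1 this).2⟩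
  have hdBY : Disjoint Bk YE := by
    rw [disjoint_right]
    intro e he
    obtain ⟨y, _, rfl⟩ := mem_image.1 he
    exact hyyBk y
  refine finalK G H c.θ c.Ds c.mc c.rc c.hDs c.hrc c.hEC τ4 hτ_4inj c.M c.Minj c.ME ?_ (Bk ∪ YE) σ' ?_ ?_ ?_ ?_ ?_
  · intro Y' hY' hc
    obtain ⟨f, h1, h2⟩ := c.Mab Y' hY' hc
    refine ⟨f, h1, fun j => ⟨(h2 j).1, ?_⟩⟩
    rw [hmapE0 _ (c.ME0 j)]
    exact (h2 j).2
  · intro e he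
    rcases mem_union.1 he with h | h
    · exact ⟨(S.bkE e h).1, (S.bkE e h).2.2⟩
    · obtain ⟨y, _, rfl⟩ := mem_image.1 h
      refine ⟨?_, fun j hj => ?_⟩
      · obtain ⟨i, i', h1, h2, h3⟩ := hyy y
        rw [h1]; exact h2
      · obtain ⟨x, hx, hxE⟩ := hYEout y
        rw [← hj] at hx
        exact hxE (S.e0 (c.ME0 j x hx))
  · intro e he e' he' hee
    simp only [coe_union, Set.mem_union, mem_coe] at he he'
    rcases he with he | he <;> rcases he' with he' | he'
    · rw [hσ'B e he, hσ'B e' he'] at hee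
      exact S.sinj he he' hee
    · obtain ⟨y, _, rfl⟩ := mem_image.1 he'
      rw [hσ'B e he, hσ'Y] at hee
      exact absurd (mem_image.2 ⟨e, he, hee⟩) (hYmem y).2
    · obtain ⟨y, _, rfl⟩ := mem_image.1 he
      rw [hσ'B e' he', hσ'Y] at hee
      exact absurd (mem_image.2 ⟨e', he', hee.symm⟩) (hYmem y).2
    · obtain ⟨y, _, rfl⟩ := mem_image.1 he
      obtain ⟨y', _, rfl⟩ := mem_image.1 he'
      rw [hσ'Y, hσ'Y] at hee
      rw [Subtype.ext hee]
  · intro e he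
    rcases mem_union.1 he with h | h
    · rw [hσ'B e h, hmapE e (S.bkE e h).2.1]
      exact S.scol e h
    · obtain ⟨y, _, rfl⟩ := mem_image.1 h
      rw [hσ'Y]
      refine ⟨(hYmem y).1, ?_⟩
      obtain ⟨i, i', h1, h2, h3⟩ := hyy y
      rw [h1, Sym2.map_mk, hτ_4P, hτ_4P]
      exact h3
  · rw [card_union_of_disjoint hdBY, hYE, card_image_of_injective _ hyyi, card_univ, Fintype.card_coe, hY]
    have h1 : Bk.image σ ⊆ univ \ c.Ds := by
      intro x hx
      obtain ⟨e, he, rfl⟩ := mem_image.1 hx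
      exact mem_sdiff.2 ⟨mem_univ _, (S.scol e he).1⟩
    have h2 := card_le_card h1
    rw [card_sdiff_of_subset h1, card_image_of_injOn S.sinj]
    rw [card_image_of_injOn S.sinj] at h2
    have h3 : (univ \ c.Ds).card = Fintype.card C - c.Ds.card := by
      rw [card_sdiff_of_subset (subset_univ _), card_univ]
    have h4 : c.Ds.card ≤ Fintype.card C := card_le_univ _
    omega
  · have hgood : ∀ x y, H.Adj x y → x ∈ c.RI ∨ x ∈ Q2 ∨ (x ∈ P2 ∧ y ∉ Q2 ∧ y ∉ c.RI) ∨ (x ∈ E ∧ y ∈ E) →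
        (∃ j, c.M j = s(x, y)) ∨ s(x, y) ∈ Bk ∪ YE ∨ (thick G c.θ c.Ds).Adj (τ4 x) (τ4 y) := by
      intro x y hxy h
      have hnR : ∀ i u, H.Adj (c.rI i) u → c.Js.Adj (τ4 (c.rI i)) (τ4 u) := by
        intro i u h
        have hu := c.rInb i u h
        rw [hτ_4I, hτ_4E u (S.e0 hu), S.agree u hu]
        exact ((hf i).2 u h).symm
      rcases h with h | h | ⟨h, hyQ, hyR⟩ | ⟨h, h'⟩
      · obtain ⟨i, _, rfl⟩ := mem_image.1 h
        exact Or.inr (Or.inr (hnR i y hxy))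
      · refine Or.inr (Or.inr ?_)
        by_cases hy : y ∈ c.RI
        · obtain ⟨i, _, rfl⟩ := mem_image.1 hy
          exact (hnR i x hxy.symm).symm
        · rw [hτ_4A y hy, hτ_4A x (hQ2E x h).2.2]
          exact t4 x h y ((hall y).2 hy) hxy
      · obtain ⟨i, _, rfl⟩ := mem_image.1 h
        have hyA := (hall y).2 hyR
        rcases mem_union.1 hyA with hy | hy
        · rcases mem_union.1 hy with hy | hy
          · have hX := S.nbr hy (hP2E _ h) (hP2I _ h) hxy.symm
            exact absurd hX (hiso i y (adj_bl (hba i) hxy)).1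
          · obtain ⟨i', _, rfl⟩ := mem_image.1 hy
            obtain ⟨y, hy⟩ := hadj i i' hxy
            refine Or.inr (Or.inl (mem_union_right _ ?_))
            rw [← hy]; exact mem_image_of_mem _ (mem_univ y)
        · exact absurd hy hyQ
      · rcases S.edge x h y h' hxy with h1 | h1 | h1
        · exact Or.inl h1
        · exact Or.inr (Or.inl (mem_union_left _ h1))
        · rw [hτ_4E x h, hτ_4E y h']; exact Or.inr (Or.inr h1)
    have hswap : ∀ x y, ((∃ j, c.M j = s(y, x)) ∨ s(y, x) ∈ Bk ∪ YE ∨ (thick G c.θ c.Ds).Adj (τ4 y) (τ4 x)) →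
        ((∃ j, c.M j = s(x, y)) ∨ s(x, y) ∈ Bk ∪ YE ∨ (thick G c.θ c.Ds).Adj (τ4 x) (τ4 y)) := by
      intro x y h
      rw [Sym2.eq_swap, SimpleGraph.adj_comm]
      exact h
    have hcl : ∀ x, x ∈ c.RI ∨ x ∈ Q2 ∨ x ∈ P2 ∨ x ∈ E := by
      intro x
      by_cases h : x ∈ c.RI
      · exact Or.inl h
      · have := (hall x).2 h
        rw [hA, mem_union, mem_union] at this
        tauto
    intro x y hxy
    by_cases h1 : x ∈ c.RI
    · exact hgood x y hxy (Or.inl h1)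
    by_cases h2 : x ∈ Q2
    · exact hgood x y hxy (Or.inr (Or.inl h2))
    by_cases h1' : y ∈ c.RI
    · exact hswap x y (hgood y x hxy.symm (Or.inl h1'))
    by_cases h2' : y ∈ Q2
    · exact hswap x y (hgood y x hxy.symm (Or.inr (Or.inl h2')))
    by_cases h3 : x ∈ P2
    · exact hgood x y hxy (Or.inr (Or.inr (Or.inl ⟨h3, h2', h1'⟩)))
    by_cases h3' : y ∈ P2
    · exact hswap x y (hgood y x hxy.symm (Or.inr (Or.inr (Or.inl ⟨h3', h2, h1⟩))))
    have hx : x ∈ E := by have := hcl x; tauto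
    have hy : y ∈ E := by have := hcl y; tauto
    exact hgood x y hxy (Or.inr (Or.inr (Or.inr ⟨hx, hy⟩)))

theorem St.done [Nonempty V] [Nonempty C] (S : St c E τ Bk σ) : HasTransversal G H := by
  obtain ⟨E', τ', Bk', σ', S', h⟩ := S.grow
  exact S'.finish h

end Ctx

set_option maxHeartbeats 2000000 in
/-- the first embedding phase -/
theorem phase1 {V W C ι : Type} [Fintype V] [Nonempty V] [Fintype W] [Fintype C] [Nonempty C] [Fintype ι]
    (G : C → SimpleGraph V) (H : SimpleGraph W) (Δ : ℕ) (hdeg : ∀ w, degOf H w ≤ Δ)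
    (X : Finset W) (cls : W → Finset W) (mu : ℝ) (hs : HS H X cls mu) (θ s : ℝ) (hθ0 : 0 < θ) (hθ1 : θ ≤ 1)
    (Ds C2 : Finset C) (hDC : Disjoint Ds C2) (LDs : LD (thick G θ Ds) s θ) (LD2 : LD (thick G θ C2) s θ)
    (QS QI RI : Finset W) (hQS : Clo X cls QS) (hQI : Clo X cls QI) (hdis : Disjoint QS QI)
    (hRI : RI ⊆ QI) (pos root : ι → W) (img : ι → V) (hba : ∀ i, pos i ∈ ba H (root i))
    (hfar : ∀ i i', root i ≠ root i' → Disjoint (bl H (root i)) (bl H (root i')))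
    (hiso : ∀ i, Iso H X (root i)) (hposi : Function.Injective pos) (himgi : Function.Injective img)
    (hposQ : ∀ i, pos i ∈ QS ∪ QI) (hposR : ∀ i, pos i ∉ RI) (MM : Finset (Sym2 W))
    (hPP : ∀ i i', H.Adj (pos i) (pos i') → s(pos i, pos i') ∈ MM ∨
      (pos i ∉ QS ∧ (thick G θ Ds).Adj (img i) (img i')))
    (cc : ℝ) (hcc : cc ≤ Fintype.card V)
    (hg : ∀ i, cc ≤ (((univ : Finset V).filter (fun v => ∀ i', root i' = root i →
      (if pos i' ∈ QS then thick G θ C2 else thick G θ Ds).Adj (img i') v)).card : ℝ))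
    (Vs UU : Finset V) (hUU : ∀ i, img i ∉ UU) (b : ℝ)
    (hb : b + UU.card + Fintype.card ι ≤ cc) (n1 : s ≤ θ ^ Δ * b) (n2 : s ≤ θ ^ Δ * Vs.card)
    (n3 : Δ * s + mu + QS.card + QI.card < θ ^ Δ * b) (n4 : Δ * (QS.card : ℝ) ≤ θ * C2.card) :
    ∃ (τ : W → V) (Bk : Finset (Sym2 W)) (σ : Sym2 W → C),
      Set.InjOn τ ((X ∪ QS ∪ (QI \ RI) : Finset W) : Set W) ∧ (∀ i, τ (pos i) = img i) ∧
      (∀ w ∈ X ∪ QS ∪ (QI \ RI), τ w ∉ UU) ∧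
      (∀ u ∈ X ∪ QS ∪ (QI \ RI), ∀ w ∈ X ∪ QS ∪ (QI \ RI), H.Adj u w →
        s(u, w) ∈ MM ∨ s(u, w) ∈ Bk ∨ (thick G θ Ds).Adj (τ u) (τ w)) ∧
      (∀ e ∈ Bk, e ∈ H.edgeSet ∧ (∀ x ∈ e, x ∈ X ∪ QS ∪ (QI \ RI)) ∧ e ∉ MM) ∧
      Set.InjOn σ (Bk : Set (Sym2 W)) ∧ (∀ e ∈ Bk, σ e ∉ Ds ∧ e.map τ ∈ (G (σ e)).edgeSet) ∧
      (∀ u ∈ X ∪ QS ∪ (QI \ RI), ∀ w ∈ X ∪ QS ∪ (QI \ RI), H.Adj u w →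
        s(u, w) ∈ MM ∨ s(u, w) ∈ Bk ∨ u ∈ X ∪ QI ∨ w ∈ X ∪ QI) ∧
      (∀ w, w ∉ X ∪ QS ∪ (QI \ RI) → θ ^ Δ * (Vs.card : ℝ) ≤
        ((Vs.filter (fun v => ∀ x ∈ X, H.Adj x w → (thick G θ Ds).Adj (τ x) v)).card : ℝ)) := by
  set E0 := X ∪ QS ∪ (QI \ RI) with hE0
  set P1 := (univ : Finset ι).image pos with hP1
  set Q1 := E0 \ P1 with hQ1
  set J : W → W → SimpleGraph V := fun u w => if u ∈ QS ∧ w ∈ QS then thick G θ C2 else thick G θ Ds with hJ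
  set τ0 : W → V := Function.extend pos img (fun _ => Classical.arbitrary V) with hτ0
  have hτ_0p : ∀ i, τ0 (pos i) = img i := fun i => hposi.extend_apply _ _ _
  set cp : W → Finset V := fun w => univ.filter (fun v => ∀ i, H.Adj (pos i) w →
    (if pos i ∈ QS then thick G θ C2 else thick G θ Ds).Adj (img i) v) with hcp
  have hcpc : ∀ w, cc ≤ ((cp w).card : ℝ) := fun w =>
    compat_card H (fun i => if pos i ∈ QS then thick G θ C2 else thick G θ Ds) univ pos root img hba hfar cc
      (by rw [card_univ]; exact hcc) hg w
  set T : W → Finset V := fun w => if w ∈ Q1 then cp w \ (UU ∪ univ.image img) else Vs with hT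
  have hTc : ∀ w ∈ Q1, b ≤ ((T w).card : ℝ) := by
    intro w hw
    have h1 : (cp w).card ≤ (T w).card + (UU.card + Fintype.card ι) := by
      simp only [hT, hw, if_true]
      refine card_le_card_sdiff_add_card.trans (Nat.add_le_add_left ?_ _)
      refine (card_union_le _ _).trans (Nat.add_le_add_left ?_ _)
      exact card_image_le.trans (by rw [card_univ])
    have h2 : ((cp w).card : ℝ) ≤ (T w).card + (UU.card + Fintype.card ι) := by exact_mod_cast h1
    have := hcpc w
    linarith
  have hpow : 0 < θ ^ Δ := by positivity
  have hQ1c : (Q1.card : ℝ) ≤ mu + QS.card + QI.card := by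
    have h1 : Q1.card ≤ X.card + QS.card + QI.card := by
      refine (card_le_card sdiff_subset).trans ((card_union_le _ _).trans ?_)
      exact Nat.add_le_add (card_union_le _ _) (card_le_card sdiff_subset)
    have h2 : (Q1.card : ℝ) ≤ X.card + QS.card + QI.card := by exact_mod_cast h1
    have := hs.hX
    linarith
  have hPE : P1 ⊆ E0 := by
    intro w hw
    obtain ⟨i, _, rfl⟩ := mem_image.1 hw
    rw [hE0]
    rcases mem_union.1 (hposQ i) with h | h
    · exact mem_union_left _ (mem_union_right _ h)
    · exact mem_union_right _ (mem_sdiff.2 ⟨h, hposR i⟩)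
  have hposX : ∀ i, pos i ∉ X := fun i => (hiso i _ (ba_sub_bl H _ (hba i))).1
  have hposQS : ∀ i w, pos i ∈ QS → H.Adj (pos i) w → w ∈ QS := by
    intro i w hi hw
    exact hQS.nbr hs hi hw (hiso i _ (adj_bl (hba i) hw)).1
  have hXQ1 : X ⊆ Q1 := by
    intro x hx
    refine mem_sdiff.2 ⟨mem_union_left _ (mem_union_left _ hx), fun h => ?_⟩
    obtain ⟨i, _, rfl⟩ := mem_image.1 h
    exact hposX i hx
  have hJpos : ∀ i w, H.Adj (pos i) w → J (pos i) w = if pos i ∈ QS then thick G θ C2 else thick G θ Ds := by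
    intro i w hw
    by_cases h : pos i ∈ QS
    · simp only [hJ, h, hposQS i w h hw, and_self, if_true]
    · simp only [hJ, h, false_and, if_false]
  obtain ⟨τ, hinj, hτE, hτT, hτJ, hτc⟩ := gelP H Δ hdeg J
    (by intro u w; simp only [hJ, and_comm]) θ s hθ0 hθ1
    (by
      intro u w
      simp only [hJ]
      split_ifs
      · exact LD2
      · exact LDs)
    T P1 Q1 disjoint_sdiff τ0
    (by
      intro u hu w hw h
      obtain ⟨i, _, rfl⟩ := mem_image.1 (mem_coe.1 hu)
      obtain ⟨j, _, rfl⟩ := mem_image.1 (mem_coe.1 hw)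
      rw [hτ_0p, hτ_0p] at h
      rw [himgi h])
    (by
      intro w
      by_cases hw : w ∈ Q1
      · exact n1.trans (mul_le_mul_of_nonneg_left (hTc w hw) hpow.le)
      · simp only [hT, hw, if_false]; exact n2)
    (by
      intro w hw
      have h1 : ((Q1.filter (fun u => ¬ Disjoint (T u) (T w))).card : ℝ) ≤ Q1.card := by
        exact_mod_cast card_le_card (filter_subset _ _)
      have h2 := mul_le_mul_of_nonneg_left (hTc w hw) hpow.le
      linarith)
    (by
      intro w hw v hv u hu
      obtain ⟨i, _, rfl⟩ := mem_image.1 hu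
      simp only [hT, hw, if_true, mem_sdiff, mem_union, not_or] at hv
      rw [hτ_0p]
      refine ⟨fun h => hv.2.2 (mem_image.2 ⟨i, mem_univ _, h⟩), fun h => ?_⟩
      rw [hJpos i w h]
      exact (mem_filter.1 hv.1).2 i h)
  have hτp : ∀ i, τ (pos i) = img i := fun i => by
    rw [hτE _ (mem_image_of_mem _ (mem_univ i)), hτ_0p]
  have hEQ : P1 ∪ Q1 = E0 := union_sdiff_of_subset hPE
  rw [hEQ] at hinj hτJ
  -- edges
  have hedge : ∀ u ∈ E0, ∀ w ∈ E0, H.Adj u w → s(u, w) ∈ MM ∨ (J u w).Adj (τ u) (τ w) := by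
    intro u hu w hw h
    by_cases hu1 : u ∈ Q1
    · exact Or.inr (hτJ u hu1 w hw h)
    by_cases hw1 : w ∈ Q1
    · have := hτJ w hw1 u hu h.symm
      refine Or.inr ?_
      have e : J u w = J w u := by simp only [hJ, and_comm]
      rw [e]; exact this.symm
    have hu2 : u ∈ P1 := by
      by_contra hc; exact hu1 (mem_sdiff.2 ⟨hu, hc⟩)
    have hw2 : w ∈ P1 := by
      by_contra hc; exact hw1 (mem_sdiff.2 ⟨hw, hc⟩)
    obtain ⟨i, _, rfl⟩ := mem_image.1 hu2
    obtain ⟨j, _, rfl⟩ := mem_image.1 hw2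
    rcases hPP i j h with h' | ⟨h1, h2⟩
    · exact Or.inl h'
    · refine Or.inr ?_
      rw [hJpos i _ h, if_neg h1, hτp, hτp]; exact h2
  set Bk : Finset (Sym2 W) := univ.filter (fun e => e ∈ H.edgeSet ∧ (∀ x ∈ e, x ∈ QS) ∧ e ∉ MM) with hBk
  have hQSE : QS ⊆ E0 := fun x hx => mem_union_left _ (mem_union_right _ hx)
  obtain ⟨σ, hσ1, hσ2⟩ := col_edges G θ C2 τ Bk (by
    refine le_trans ?_ n4
    have : Bk.card ≤ Δ * QS.card := touch_card H Δ hdeg QS Bk (by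
      intro e he
      obtain ⟨_, h1, h2, h3⟩ := mem_filter.1 he
      refine ⟨h1, ?_⟩
      clear he h1 h3
      revert h2
      induction e using Sym2.ind with
      | _ x y =>
        intro h2
        exact ⟨x, h2 x (by simp), by simp⟩)
    exact_mod_cast this) (by
    intro e he
    obtain ⟨_, h1, h2, h3⟩ := mem_filter.1 he
    clear he
    revert h1 h2 h3
    induction e using Sym2.ind with
    | _ x y =>
      intro h1 h2 h3
      have hx := h2 x (by simp)
      have hy := h2 y (by simp)
      rcases hedge x (hQSE hx) y (hQSE hy) h1 with h | h
      · exact absurd h h3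
      · simp only [hJ, hx, hy, and_self, if_true] at h
        exact h)
  have hBkm : ∀ u w, H.Adj u w → u ∈ QS → w ∈ QS → s(u, w) ∉ MM → s(u, w) ∈ Bk := by
    intro u w h hu hw hM
    refine mem_filter.2 ⟨mem_univ _, h, ?_, hM⟩
    intro x hx
    rcases Sym2.mem_iff.1 hx with h | h
    · rw [h]; exact hu
    · rw [h]; exact hw
  refine ⟨τ, Bk, σ, hinj, hτp, ?_, ?_, ?_, hσ2, ?_, ?_, ?_⟩
  · intro w hw
    by_cases h1 : w ∈ Q1
    · have := hτT w h1
      simp only [hT, h1, if_true, mem_sdiff, mem_union, not_or] at this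
      exact this.2.1
    · have h2 : w ∈ P1 := by
        by_contra hc; exact h1 (mem_sdiff.2 ⟨hw, hc⟩)
      obtain ⟨i, _, rfl⟩ := mem_image.1 h2
      rw [hτp]; exact hUU i
  · intro u hu w hw h
    rcases hedge u hu w hw h with h1 | h1
    · exact Or.inl h1
    by_cases hM : s(u, w) ∈ MM
    · exact Or.inl hM
    by_cases hq : u ∈ QS ∧ w ∈ QS
    · exact Or.inr (Or.inl (hBkm u w h hq.1 hq.2 hM))
    · simp only [hJ, hq, if_false] at h1
      exact Or.inr (Or.inr h1)
  · intro e he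
    obtain ⟨_, h1, h2, h3⟩ := mem_filter.1 he
    exact ⟨h1, fun x hx => hQSE (h2 x hx), h3⟩
  · intro e he
    exact ⟨fun h => disjoint_left.1 hDC h (hσ1 e he).1, (hσ1 e he).2⟩
  · intro u hu w hw h
    by_cases hM : s(u, w) ∈ MM
    · exact Or.inl hM
    by_cases hu1 : u ∈ QS
    · by_cases hw1 : w ∈ QS
      · exact Or.inr (Or.inl (hBkm u w h hu1 hw1 hM))
      · refine Or.inr (Or.inr (Or.inr ?_))
        simp only [hE0, mem_union, mem_sdiff] at hw ⊢
        tauto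
    · refine Or.inr (Or.inr (Or.inl ?_))
      simp only [hE0, mem_union, mem_sdiff] at hu ⊢
      tauto
  · intro w hw
    have hw1 : w ∉ Q1 := fun h => hw (mem_sdiff.1 h).1
    have := hτc w hw1
    simp only [hT, hw1, if_false] at this
    refine this.trans (Nat.cast_le.2 (card_le_card ?_))
    intro v hv
    rw [mem_filter] at hv ⊢
    refine ⟨hv.1, fun x hx hxw => ?_⟩
    have h1 := hv.2 x (hXQ1 hx) hxw
    have hxQ : x ∉ QS := fun h => (hQS x h).1 hx
    simp only [hJ, hxQ, false_and, if_false] at h1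
    exact h1

set_option maxHeartbeats 4000000 in
/-- all prepared data together give a transversal copy -/
theorem assemble {V W C : Type} [Fintype V] [Nonempty V] [Fintype W] [Fintype C] [Nonempty C]
    (G : C → SimpleGraph V) (H : SimpleGraph W) (Δ : ℕ) (hΔ : 1 ≤ Δ) (hdeg : ∀ w, degOf H w ≤ Δ)
    (X : Finset W) (cls : W → Finset W) (mu : ℝ) (hs : HS H X cls mu) (θ s ez ey : ℝ) (hθ0 : 0 < θ) (hθ1 : θ ≤ 1)
    (hs0 : 0 ≤ s) (hVW : Fintype.card V = Fintype.card W) (hEC : edgeCnt H = Fintype.card C)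
    (Ds C2 : Finset C) (hDC : Disjoint Ds C2) (LDs : LD (thick G θ Ds) s θ) (LD2 : LD (thick G θ C2) s θ)
    (LDY : ∀ Y : Finset C, ey < Y.card → LD (thick G θ Y) s θ)
    (mc rc mv rv ny t k : ℕ) (hDs : Ds.card = mc + rc) (hrc : (rc : ℝ) ≤ θ * Ds.card)
    (pm : Fin mc → Fin 2 → V) (pm0 : ∀ j, pm j 0 ≠ pm j 1)
    (pmd : ∀ i j, i ≠ j → ∀ a b, pm i a ≠ pm j b)
    (pmn : ∀ j, θ ^ 2 * (Fintype.card V : ℝ) ≤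
      (((univ : Finset V).filter (fun v => ∀ a, (thick G θ C2).Adj (pm j a) v)).card : ℝ))
    (pma : ∀ Y' ⊆ Ds, Y'.card = mc → ∃ f : Fin mc → C, Function.Injective f ∧
      ∀ j, f j ∈ Y' ∧ (G (f j)).Adj (pm j 0) (pm j 1))
    (Vs : Finset V) (hVs : Vs.card = mv + rv) (ti : Fin mv → Fin k → V) (hk : k ≤ Δ)
    (tiJ : ∀ i a b, a ≠ b → (thick G θ Ds).Adj (ti i a) (ti i b))
    (tid : ∀ i j, i ≠ j → ∀ a b, ti i a ≠ ti j b)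
    (tin : ∀ i, θ ^ k * (Fintype.card V : ℝ) ≤
      (((univ : Finset V).filter (fun v => ∀ a, (thick G θ Ds).Adj (ti i a) v)).card : ℝ))
    (tia : ∀ Y' ⊆ Vs, Y'.card = mv → ∃ f : Fin mv → V, Function.Injective f ∧
      ∀ i, f i ∈ Y' ∧ ∀ a, (thick G θ Ds).Adj (ti i a) (f i))
    (tpm : ∀ i a j b, ti i a ≠ pm j b) (pmVs : ∀ j b, pm j b ∉ Vs) (tiVs : ∀ i a, ti i a ∉ Vs)
    (p : ℕ → Fin 2 → V) (pne : ∀ i < t, p i 0 ≠ p i 1)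
    (pdisj : ∀ i < t, ∀ j < t, i ≠ j → ∀ a b, p i a ≠ p j b)
    (pVs : ∀ i < t, ∀ a, p i a ∉ Vs)
    (ppm : ∀ i < t, ∀ a j b, p i a ≠ pm j b) (pti : ∀ i < t, ∀ a j b, p i a ≠ ti j b)
    (pnb : ∀ i < t, θ ^ 2 * (Vs.card : ℝ) ≤
      ((Vs.filter (fun v => ∀ a, (thick G θ Ds).Adj (p i a) v)).card : ℝ))
    (pcol : ∀ c, ey ≤ (((range t).filter (fun i => (G c).Adj (p i 0) (p i 1))).card : ℝ))
    (B : Finset V) (BVs : ∀ v ∈ B, v ∉ Vs) (Bp : ∀ v ∈ B, ∀ i < t, ∀ a, p i a ≠ v)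
    (Bpm : ∀ v ∈ B, ∀ j b, pm j b ≠ v) (Bti : ∀ v ∈ B, ∀ j b, ti j b ≠ v)
    (Bdeg : ∀ v ∈ B, θ * (Fintype.card V : ℝ) ≤
      (((univ : Finset V).filter (fun w => (thick G θ C2).Adj v w)).card : ℝ))
    (good : ∀ v, v ∉ Vs → (∀ i < t, ∀ a, p i a ≠ v) → (∀ j b, pm j b ≠ v) → (∀ j b, ti j b ≠ v) → v ∉ B →
      θ * (Vs.card : ℝ) ≤ ((Vs.filter (fun w => (thick G θ Ds).Adj v w)).card : ℝ))
    (QM QI QB QY : Finset W) (cM : Clo X cls QM) (cI : Clo X cls QI) (cB : Clo X cls QB) (cY : Clo X cls QY)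
    (dMI : Disjoint QM QI) (dMB : Disjoint QM QB) (dIB : Disjoint QI QB)
    (dYM : Disjoint QM QY) (dYI : Disjoint QI QY) (dYB : Disjoint QB QY)
    (aM bM : Fin mc → W) (aMQ : ∀ j, aM j ∈ QM) (aMi : ∀ j, Iso H X (aM j)) (abM : ∀ j, H.Adj (aM j) (bM j))
    (aMf : ∀ i j, i ≠ j → Disjoint (bl H (aM i)) (bl H (aM j)))
    (rI : Fin mv → W) (rIQ : ∀ j, rI j ∈ QI) (rIi : ∀ j, Iso H X (rI j))
    (rIf : ∀ i j, i ≠ j → Disjoint (bl H (rI i)) (bl H (rI j)))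
    (nI : Fin mv → Fin k → W) (nIi : ∀ i, Function.Injective (nI i))
    (nIa : ∀ i u, H.Adj (rI i) u ↔ ∃ a, nI i a = u)
    (rB : ↥B → W) (rBQ : ∀ j, rB j ∈ QB) (rBi : ∀ j, Iso H X (rB j))
    (rBf : ∀ i j, i ≠ j → Disjoint (bl H (rB i)) (bl H (rB j)))
    (aY bY : Fin ny → W) (aYQ : ∀ j, aY j ∈ QY) (aYi : ∀ j, Iso H X (aY j)) (abY : ∀ j, H.Adj (aY j) (bY j))
    (aYf : ∀ i j, i ≠ j → Disjoint (bl H (aY i)) (bl H (aY j)))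
    (hny : ey ≤ ny)
    (n1 : s ≤ θ ^ Δ * (Fintype.card V : ℝ)) (n2 : Δ * s + mu < θ ^ Δ * ez)
    (n3 : Δ * s + mu < θ ^ Δ * (θ ^ Δ * Vs.card - Δ * mu)) (n4 : Δ * mu ≤ θ * ey)
    (n5 : QY.card + Δ * mu + ((Δ : ℝ) + 1) ^ 4 * mu + ((Δ : ℝ) + 1) ^ 4 * (2 * t + ez) ≤ rv)
    (n6 : Δ * (mu + QI.card + Vs.card + 2 * t + ez) < (rc : ℝ))
    (n7 : Δ * s + rv < θ ^ Δ * (θ ^ (Δ + 1) * Vs.card - Δ * mu)) (ez0 : 0 ≤ ez) (ey0 : 0 ≤ ey)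
    (b : ℝ) (m0 : b + Vs.card + 2 * t + 2 * mc + Δ * mv + B.card ≤ θ ^ (Δ + 1) * (Fintype.card V : ℝ))
    (m1 : s ≤ θ ^ Δ * b) (m2 : s ≤ θ ^ Δ * Vs.card)
    (m3 : Δ * s + mu + (QM.card + QB.card) + QI.card < θ ^ Δ * b)
    (m4 : Δ * ((QM.card : ℝ) + QB.card) ≤ θ * C2.card) :
    HasTransversal G H := by
  let pos : (Fin mc × Fin 2) ⊕ ((Fin mv × Fin k) ⊕ ↥B) → W :=
    Sum.elim (fun q => if q.2 = 0 then aM q.1 else bM q.1) (Sum.elim (fun q => nI q.1 q.2) (fun v => rB v))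
  let root : (Fin mc × Fin 2) ⊕ ((Fin mv × Fin k) ⊕ ↥B) → W :=
    Sum.elim (fun q => aM q.1) (Sum.elim (fun q => rI q.1) (fun v => rB v))
  let img : (Fin mc × Fin 2) ⊕ ((Fin mv × Fin k) ⊕ ↥B) → V :=
    Sum.elim (fun q => pm q.1 q.2) (Sum.elim (fun q => ti q.1 q.2) (fun v => v))
  have hba : ∀ i, pos i ∈ ba H (root i) := by
    rintro (⟨y, a⟩ | (⟨i, a⟩ | z))
    · simp only [pos, root, Sum.elim_inl]
      split_ifs
      · exact self_ba H _
      · exact (mem_ba H _ _).2 (Or.inr (abM _))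
    · exact (mem_ba H _ _).2 (Or.inr ((nIa i _).2 ⟨a, rfl⟩))
    · exact self_ba H _
  have hiso : ∀ i, Iso H X (root i) := by
    rintro (⟨y, a⟩ | (⟨i, a⟩ | z))
    · exact aMi y
    · exact rIi i
    · exact rBi z
  have blM : ∀ j, bl H (aM j) ⊆ QM := fun j => (iso_bl hs (aMi j)).trans (cM _ (aMQ j)).2
  have blI : ∀ j, bl H (rI j) ⊆ QI := fun j => (iso_bl hs (rIi j)).trans (cI _ (rIQ j)).2
  have blB : ∀ j, bl H (rB j) ⊆ QB := fun j => (iso_bl hs (rBi j)).trans (cB _ (rBQ j)).2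
  have hfar : ∀ i i', root i ≠ root i' → Disjoint (bl H (root i)) (bl H (root i')) := by
    rintro (⟨y, a⟩ | (⟨i, a⟩ | z)) (⟨y', a'⟩ | (⟨i', a'⟩ | z')) h
    · exact aMf _ _ (fun e => h (congrArg aM e))
    · exact (dMI.mono_left (blM _)).mono_right (blI _)
    · exact (dMB.mono_left (blM _)).mono_right (blB _)
    · exact (dMI.symm.mono_left (blI _)).mono_right (blM _)
    · exact rIf _ _ (fun e => h (congrArg rI e))
    · exact (dIB.mono_left (blI _)).mono_right (blB _)
    · exact (dMB.symm.mono_left (blB _)).mono_right (blM _)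
    · exact (dIB.symm.mono_left (blB _)).mono_right (blI _)
    · exact rBf _ _ (fun e => h (congrArg rB e))
  have aMj : Function.Injective aM := by
    intro y y' h
    by_contra hne
    have := aMf y y' hne
    rw [h] at this
    exact disjoint_left.1 this (self_bl H _) (self_bl H _)
  have rIj : Function.Injective rI := by
    intro y y' h
    by_contra hne
    have := rIf y y' hne
    rw [h] at this
    exact disjoint_left.1 this (self_bl H _) (self_bl H _)
  have rBj : Function.Injective rB := by
    intro y y' h
    by_contra hne
    have := rBf y y' hne
    rw [h] at this
    exact disjoint_left.1 this (self_bl H _) (self_bl H _)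
  have hroots : ∀ i i', root i = root i' →
      (∃ y a a', i = Sum.inl (y, a) ∧ i' = Sum.inl (y, a')) ∨
      (∃ y a a', i = Sum.inr (Sum.inl (y, a)) ∧ i' = Sum.inr (Sum.inl (y, a'))) ∨
      (∃ z, i = Sum.inr (Sum.inr z) ∧ i' = Sum.inr (Sum.inr z)) := by
    rintro (⟨y, a⟩ | (⟨i, a⟩ | z)) (⟨y', a'⟩ | (⟨i', a'⟩ | z')) h <;>
      simp only [root, Sum.elim_inl, Sum.elim_inr] at h
    · obtain rfl := aMj h
      exact Or.inl ⟨y, a, a', rfl, rfl⟩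
    · exact absurd (h ▸ rIQ _) (disjoint_left.1 dMI (aMQ y))
    · exact absurd (h ▸ rBQ _) (disjoint_left.1 dMB (aMQ y))
    · exact absurd (h ▸ rIQ _) (disjoint_left.1 dMI (aMQ y'))
    · obtain rfl := rIj h
      exact Or.inr (Or.inl ⟨i, a, a', rfl, rfl⟩)
    · exact absurd (h ▸ rBQ _) (disjoint_left.1 dIB (rIQ i))
    · exact absurd (h ▸ rBQ _) (disjoint_left.1 dMB (aMQ y'))
    · exact absurd (h ▸ rBQ _) (disjoint_left.1 dIB (rIQ i'))
    · obtain rfl := rBj h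
      exact Or.inr (Or.inr ⟨z, rfl, rfl⟩)
  have hposroot : ∀ i i', pos i = pos i' → root i = root i' := by
    intro i i' h
    by_contra hne
    exact disjoint_left.1 (hfar i i' hne) (ba_sub_bl H _ (hba i)) (h ▸ ba_sub_bl H _ (hba i'))
  have hposi : Function.Injective pos := by
    intro i i' h
    rcases hroots _ _ (hposroot i i' h) with ⟨y, a, a', rfl, rfl⟩ | ⟨y, a, a', rfl, rfl⟩ | ⟨z, rfl, rfl⟩
    · simp only [pos, Sum.elim_inl] at h
      have hne := (abM y).ne
      rw [fin2_inj (fun a : Fin 2 => if a = 0 then aM y else bM y) (by simpa using hne) h]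
    · simp only [pos, Sum.elim_inl, Sum.elim_inr] at h
      rw [nIi y h]
    · rfl
  have himgi : Function.Injective img := by
    rintro (⟨y, a⟩ | (⟨i, a⟩ | z)) (⟨y', a'⟩ | (⟨i', a'⟩ | z')) h <;>
      simp only [img, Sum.elim_inl, Sum.elim_inr] at h
    · by_cases hy : y = y'
      · subst hy
        rw [fin2_inj (pm y) (pm0 y) h]
      · exact absurd h (pmd _ _ hy a a')
    · exact absurd h.symm (tpm _ _ _ _)
    · exact absurd h (Bpm z' z'.2 _ _)
    · exact absurd h (tpm _ _ _ _)
    · by_cases hy : i = i'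
      · subst hy
        by_cases ha : a = a'
        · rw [ha]
        · exact absurd h (tiJ i a a' ha).ne
      · exact absurd h (tid _ _ hy a a')
    · exact absurd h (Bti z' z'.2 _ _)
    · exact absurd h.symm (Bpm z z.2 _ _)
    · exact absurd h.symm (Bti z z.2 _ _)
    · rw [Subtype.ext h]
  set QS := QM ∪ QB with hQS
  set RI := (univ : Finset (Fin mv)).image rI with hRI
  have dSI : Disjoint QS QI := by rw [hQS, disjoint_union_left]; exact ⟨dMI, dIB.symm⟩
  have hRIQ : RI ⊆ QI := by
    intro w hw
    obtain ⟨i, _, rfl⟩ := mem_image.1 hw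
    exact rIQ i
  have posM : ∀ q, pos (Sum.inl q) ∈ QS := fun q =>
    mem_union_left _ (blM q.1 (ba_sub_bl H _ (hba (Sum.inl q))))
  have posI : ∀ q, pos (Sum.inr (Sum.inl q)) ∈ QI := fun q =>
    blI q.1 (ba_sub_bl H _ (hba (Sum.inr (Sum.inl q))))
  have posB : ∀ z, pos (Sum.inr (Sum.inr z)) ∈ QS := fun z =>
    mem_union_right _ (blB z (ba_sub_bl H _ (hba (Sum.inr (Sum.inr z)))))
  have hposQ : ∀ i, pos i ∈ QS ∪ QI := by
    rintro (q | (q | z))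
    · exact mem_union_left _ (posM q)
    · exact mem_union_right _ (posI q)
    · exact mem_union_left _ (posB z)
  have hposR : ∀ i, pos i ∉ RI := by
    rintro (q | (⟨i, a⟩ | z)) h
    · exact disjoint_left.1 dSI (posM q) (hRIQ h)
    · obtain ⟨j, _, hj⟩ := mem_image.1 h
      simp only [pos, Sum.elim_inl, Sum.elim_inr] at hj
      have hadj : H.Adj (rI i) (nI i a) := (nIa i _).2 ⟨a, rfl⟩
      rw [← hj] at hadj
      by_cases hij : i = j
      · rw [hij] at hadj; exact H.irrefl hadj
      · exact disjoint_left.1 (rIf i j hij) (ba_sub_bl H _ ((mem_ba H _ _).2 (Or.inr hadj))) (self_bl H _)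
    · exact disjoint_left.1 dSI (posB z) (hRIQ h)
  set M : Fin mc → Sym2 W := fun j => s(aM j, bM j) with hM
  set MM : Finset (Sym2 W) := univ.image M with hMM
  have hPP : ∀ i i', H.Adj (pos i) (pos i') → s(pos i, pos i') ∈ MM ∨
      (pos i ∉ QS ∧ (thick G θ Ds).Adj (img i) (img i')) := by
    intro i i' h
    have hr : root i = root i' := by
      by_contra hne
      exact disjoint_left.1 (hfar i i' hne) (ba_sub_bl H _ (hba i)) (adj_bl (hba i') h.symm)
    rcases hroots _ _ hr with ⟨y, a, a', rfl, rfl⟩ | ⟨y, a, a', rfl, rfl⟩ | ⟨z, rfl, rfl⟩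
    · refine Or.inl (mem_image.2 ⟨y, mem_univ _, ?_⟩)
      simp only [pos, Sum.elim_inl, hM] at h ⊢
      rcases fin2_cases a with ha | ha <;> rcases fin2_cases a' with ha' | ha'
      · rw [ha, ha'] at h; exact absurd h H.irrefl
      · rw [ha, ha']; simp
      · rw [ha, ha', Sym2.eq_swap]; simp
      · rw [ha, ha'] at h; exact absurd h H.irrefl
    · refine Or.inr ⟨fun hc => disjoint_left.1 dSI hc (posI _), ?_⟩
      simp only [pos, img, Sum.elim_inl, Sum.elim_inr] at h ⊢
      refine tiJ y a a' ?_
      rintro rfl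
      exact H.irrefl h
    · exact absurd h H.irrefl
  set Rp := ((range t) ×ˢ univ).image (fun q : ℕ × Fin 2 => p q.1 q.2) with hRp
  have memRp : ∀ v, v ∈ Rp ↔ ∃ i < t, ∃ a, p i a = v := by
    intro v
    rw [hRp]
    simp only [mem_image, mem_product, mem_range, mem_univ, and_true, Prod.exists]
    constructor
    · rintro ⟨i, a, h, e⟩; exact ⟨i, h, a, e⟩
    · rintro ⟨i, h, a, e⟩; exact ⟨i, a, h, e⟩
  have hRpc : Rp.card ≤ t * 2 := by
    refine card_image_le.trans ?_
    rw [card_product]; simp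
  set cc := θ ^ (Δ + 1) * (Fintype.card V : ℝ) with hcc
  have hpw : ∀ j ≤ Δ + 1, cc ≤ θ ^ j * (Fintype.card V : ℝ) := fun j hj =>
    mul_le_mul_of_nonneg_right (pow_le_pow_of_le_one hθ0.le hθ1 hj) (by positivity)
  obtain ⟨τ, Bk, σ, hinj, hτp, hτU, hedge, hBk, hσ, hσ2, halt, hcand⟩ := phase1 G H Δ hdeg X cls mu hs θ s hθ0 hθ1
    Ds C2 hDC LDs LD2 QS QI RI (cM.union cB) cI dSI hRIQ pos root img hba hfar hiso hposi himgi hposQ hposR MM hPP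
    cc (by simpa using hpw 0 (by omega))
    (by
      rintro (⟨y, a⟩ | (⟨i, a⟩ | z))
      · refine (hpw 2 (by omega)).trans ((pmn y).trans (Nat.cast_le.2 (card_le_card ?_)))
        intro v hv
        rw [mem_filter] at hv ⊢
        refine ⟨hv.1, fun i' hi' => ?_⟩
        rcases hroots _ _ hi' with ⟨y1, a1, a2, rfl, h2⟩ | ⟨y1, a1, a2, rfl, h2⟩ | ⟨z, rfl, h2⟩
        · rw [if_pos (posM _)]
          obtain ⟨rfl, -⟩ := Prod.mk.inj (Sum.inl_injective h2)
          exact hv.2 a1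
        · exact absurd h2 (by simp)
        · exact absurd h2 (by simp)
      · refine (hpw k (by omega)).trans ((tin i).trans (Nat.cast_le.2 (card_le_card ?_)))
        intro v hv
        rw [mem_filter] at hv ⊢
        refine ⟨hv.1, fun i' hi' => ?_⟩
        rcases hroots _ _ hi' with ⟨y1, a1, a2, rfl, h2⟩ | ⟨y1, a1, a2, rfl, h2⟩ | ⟨z, rfl, h2⟩
        · exact absurd h2 (by simp)
        · rw [if_neg (fun hc => disjoint_left.1 dSI hc (posI _))]
          obtain ⟨rfl, -⟩ := Prod.mk.inj (Sum.inl_injective (Sum.inr_injective h2))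
          exact hv.2 a1
        · exact absurd h2 (by simp)
      · refine (hpw 1 (by omega)).trans ?_
        rw [pow_one]
        refine (Bdeg z z.2).trans (Nat.cast_le.2 (card_le_card ?_))
        intro v hv
        rw [mem_filter] at hv ⊢
        refine ⟨hv.1, fun i' hi' => ?_⟩
        rcases hroots _ _ hi' with ⟨y1, a1, a2, rfl, h2⟩ | ⟨y1, a1, a2, rfl, h2⟩ | ⟨z, rfl, h2⟩
        · exact absurd h2 (by simp)
        · exact absurd h2 (by simp)
        · rw [if_pos (posB _)]
          have := Sum.inr_injective (Sum.inr_injective h2)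
          rw [← this]
          exact hv.2)
    Vs (Vs ∪ Rp)
    (by
      rintro (⟨y, a⟩ | (⟨i, a⟩ | z)) h <;> simp only [img, Sum.elim_inl, Sum.elim_inr] at h <;>
        rcases mem_union.1 h with h | h
      · exact pmVs _ _ h
      · obtain ⟨i', hi, a', h⟩ := (memRp _).1 h
        exact ppm i' hi _ _ _ h
      · exact tiVs _ _ h
      · obtain ⟨i', hi, a', h⟩ := (memRp _).1 h
        exact pti i' hi _ _ _ h
      · exact BVs z z.2 h
      · obtain ⟨i', hi, a', h⟩ := (memRp _).1 h
        exact Bp z z.2 i' hi _ h)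
    b
    (by
      have h1 : ((Vs ∪ Rp).card : ℝ) ≤ Vs.card + t * 2 := by
        exact_mod_cast (card_union_le _ _).trans (Nat.add_le_add_left hRpc _)
      have h2 : (Fintype.card ((Fin mc × Fin 2) ⊕ ((Fin mv × Fin k) ⊕ ↥B)) : ℝ) = mc * 2 + (mv * k + B.card) := by
        simp
      have h3 : (mv : ℝ) * k ≤ mv * Δ := by
        have : (k : ℝ) ≤ Δ := by exact_mod_cast hk
        gcongr
      rw [h2]
      linarith)
    m1 m2
    (by
      have h1 : (QS.card : ℝ) ≤ QM.card + QB.card := by exact_mod_cast card_union_le _ _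
      linarith)
    (by
      have h1 : (QS.card : ℝ) ≤ QM.card + QB.card := by exact_mod_cast card_union_le _ _
      refine le_trans ?_ m4
      gcongr)
  set E0 := X ∪ QS ∪ (QI \ RI) with hE0
  have hposE : ∀ i, pos i ∈ E0 := by
    intro i
    rw [hE0]
    rcases mem_union.1 (hposQ i) with h | h
    · exact mem_union_left _ (mem_union_right _ h)
    · exact mem_union_right _ (mem_sdiff.2 ⟨h, hposR i⟩)
  have hτpm : ∀ j, τ (aM j) = pm j 0 ∧ τ (bM j) = pm j 1 := by
    intro j
    have h0 := hτp (Sum.inl (j, 0))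
    have h1 := hτp (Sum.inl (j, 1))
    simp only [pos, img, Sum.elim_inl] at h0 h1
    simpa using And.intro h0 h1
  have hτti : ∀ j a, τ (nI j a) = ti j a := fun j a => hτp (Sum.inr (Sum.inl (j, a)))
  let c : Ctx G H :=
    { Δ := Δ, mc := mc, rc := rc, mv := mv, rv := rv, ny := ny, t := t, θ := θ, s := s, mu := mu
      ez := ez, ey := ey, Ds := Ds, Vs := Vs, p := p, X := X, cls := cls, E0 := E0, QY := QY, XI := X ∪ QI
      τ1 := τ, M := M, rI := rI, aY := aY, bY := bY, hΔ := hΔ, hdeg := hdeg, hθ0 := hθ0, hθ1 := hθ1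
      hs0 := hs0, hVW := hVW, hEC := hEC, hDs := hDs, hrc := hrc, LDs := LDs, LDY := LDY, hVs := hVs
      pne := pne, pdisj := pdisj, pVs := pVs, pnb := pnb, pcol := pcol, hs := hs
      XE0 := subset_union_left.trans subset_union_left
      XXI := subset_union_left
      good := by
        intro v hv hvp hvE
        refine good v hv hvp ?_ ?_ ?_
        · intro j a h
          exact hvE (mem_image.2 ⟨pos (Sum.inl (j, a)), hposE _, (hτp _).trans h⟩)
        · intro j a h
          exact hvE (mem_image.2 ⟨pos (Sum.inr (Sum.inl (j, a))), hposE _, (hτp _).trans h⟩)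
        · intro h
          exact hvE (mem_image.2 ⟨pos (Sum.inr (Sum.inr ⟨v, h⟩)), hposE _, hτp _⟩)
      cand := fun w hw _ => hcand w hw
      Minj := by
        intro i j h
        by_contra hne
        have hd := aMf i j hne
        simp only [hM] at h
        have : aM i ∈ s(aM j, bM j) := by rw [← h]; simp
        rcases Sym2.mem_iff.1 this with h | h
        · exact hne (aMj h)
        · refine disjoint_left.1 hd (self_bl H _) ?_
          rw [h]
          exact ba_sub_bl H _ ((mem_ba H _ _).2 (Or.inr (abM _)))
      ME := fun j => abM j
      ME0 := by
        intro j x hx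
        have h0 := hposE (Sum.inl (j, 0))
        have h1 := hposE (Sum.inl (j, 1))
        simp only [pos, Sum.elim_inl] at h0 h1
        rcases Sym2.mem_iff.1 hx with h | h
        · rw [h]; simpa using h0
        · rw [h]; simpa using h1
      Mab := by
        intro Y' hY hc
        obtain ⟨f, hf, hf2⟩ := pma Y' hY hc
        refine ⟨f, hf, fun j => ⟨(hf2 j).1, ?_⟩⟩
        simp only [hM, Sym2.map_mk, SimpleGraph.mem_edgeSet]
        rw [(hτpm j).1, (hτpm j).2]
        exact (hf2 j).2
      rIinj := rIj
      rInb := by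
        intro i u h
        obtain ⟨a, rfl⟩ := (nIa i u).1 h
        exact hposE (Sum.inr (Sum.inl (i, a)))
      rIab := by
        intro Y' hY hc
        obtain ⟨f, hf, hf2⟩ := tia Y' hY hc
        refine ⟨f, hf, fun j => ⟨(hf2 j).1, ?_⟩⟩
        intro u h
        obtain ⟨a, rfl⟩ := (nIa j u).1 h
        rw [hτti]
        exact (hf2 j).2 a
      rIX := fun i => (cI _ (rIQ i)).1
      QYc := cY
      QYI := fun i h => disjoint_left.1 dYI (rIQ i) h
      aYQ := aYQ, abY := abY, aIso := aYi, afar := aYf, hny := hny, n1 := n1, n2 := n2, n3 := n3, n4 := n4, n5 := n5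
      n6 := by
        have h1 : ((X ∪ QI).card : ℝ) ≤ X.card + QI.card := by exact_mod_cast card_union_le _ _
        have h2 := hs.hX
        refine lt_of_le_of_lt ?_ n6
        have h3 : ((X ∪ QI).card : ℝ) ≤ mu + QI.card := by linarith
        gcongr
      n7 := n7, ez0 := ez0, ey0 := ey0 }
  have hcRp : ∀ v, v ∈ c.Rp ↔ v ∈ Rp := fun v => (c.mem_Rp v).trans (memRp v).symm
  have hMMiff : ∀ e, e ∈ MM ↔ ∃ j, M j = e := by
    intro e; rw [hMM]; simp
  have hst : c.St E0 τ Bk σ :=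
    { e0 := Subset.refl _
      agree := fun _ _ => rfl
      clo := by
        have he : (E0 ∪ c.RI) \ c.X = QS ∪ QI := by
          have h1 : c.RI = RI := rfl
          have h2 : c.X = X := rfl
          rw [h1, h2]
          ext w
          have e1 : w ∈ RI → w ∈ QI := fun h => hRIQ h
          have e2 : w ∈ QI → w ∉ X := fun h => (cI w h).1
          have e3 : w ∈ QS → w ∉ X := fun h => ((cM.union cB) w h).1
          simp only [hE0, mem_sdiff, mem_union (s := X ∪ QS ∪ (QI \ RI)), mem_union (s := X ∪ QS), mem_union (s := X),
            mem_union (s := QS)]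
          tauto
        rw [he]
        exact (cM.union cB).union cI
      dRI := by
        intro i h
        have h1 : rI i ∈ RI := mem_image_of_mem _ (mem_univ _)
        rcases mem_union.1 h with h | h
        · rcases mem_union.1 h with h | h
          · exact (cI _ (rIQ i)).1 h
          · exact disjoint_left.1 dSI h (rIQ i)
        · exact (mem_sdiff.1 h).2 h1
      dQY := by
        rw [disjoint_left]
        intro w h hY
        have hY' : w ∈ QY := hY
        rcases mem_union.1 h with h | h
        · rcases mem_union.1 h with h | h
          · exact (cY _ hY').1 h
          · rcases mem_union.1 h with h | h
            · exact disjoint_left.1 dYM h hY'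
            · exact disjoint_left.1 dYB h hY'
        · exact disjoint_left.1 dYI (mem_sdiff.1 h).1 hY'
      inj := hinj
      edge := by
        intro u hu w hw h
        rcases hedge u hu w hw h with h | h | h
        · exact Or.inl ((hMMiff _).1 h)
        · exact Or.inr (Or.inl h)
        · exact Or.inr (Or.inr h)
      bkE := by
        intro e he
        obtain ⟨h1, h2, h3⟩ := hBk e he
        exact ⟨h1, h2, fun j hj => h3 ((hMMiff _).2 ⟨j, hj⟩)⟩
      sinj := hσ
      scol := hσ2
      dP := by
        intro w hw h
        exact hτU w hw (mem_union_right _ ((hcRp _).1 h))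
      vs := by
        intro w hw h
        exact absurd (mem_union_left _ h) (hτU w hw)
      alt := by
        refine Or.inr (fun u hu w hw h => ?_)
        rcases halt u hu w hw h with h | h | h
        · exact Or.inl ((hMMiff _).1 h)
        · exact Or.inr (Or.inl h)
        · exact Or.inr (Or.inr h) }
  exact hst.done

set_option maxHeartbeats 1000000 in
/-- the colour absorber -/
theorem absorb_c (θ : ℝ) (hθ0 : 0 < θ) (hθ1 : θ ≤ 1) :
    ∃ c : ℝ, 0 < c ∧ c ≤ 1 ∧ ∀ (V C : Type) [Fintype V] [Nonempty V] (G : C → SimpleGraph V) (s : ℝ)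
      (Y1 C2 : Finset C), LD (thick G θ Y1) s θ → LD (thick G θ C2) s θ → 6 * s ≤ θ ^ 2 * Fintype.card V →
      (Y1.card : ℝ) ≤ c * Fintype.card V → 1 ≤ c * Y1.card →
      ∃ Ds ⊆ Y1, ∃ (mc rc : ℕ) (pm : Fin mc → Fin 2 → V), (∀ j, pm j 0 ≠ pm j 1) ∧
        (∀ i j, i ≠ j → ∀ a b, pm i a ≠ pm j b) ∧
        (∀ j, θ ^ 2 * (Fintype.card V : ℝ) ≤
          (((univ : Finset V).filter (fun v => ∀ a, (thick G θ C2).Adj (pm j a) v)).card : ℝ)) ∧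
        (∀ Y' ⊆ Ds, Y'.card = mc → ∃ f : Fin mc → C, Function.Injective f ∧
          ∀ j, f j ∈ Y' ∧ (G (f j)).Adj (pm j 0) (pm j 1)) ∧
        Ds.card = mc + rc ∧ c * Y1.card ≤ Ds.card ∧ 2 * (θ ^ 5 / 80) * Ds.card ≤ rc ∧
        (rc : ℝ) ≤ θ * Ds.card := by
  have h5 : θ ^ 5 ≤ 1 := pow_le_one₀ hθ0.le hθ1
  have h51 : θ ^ 5 ≤ θ := by simpa using pow_le_pow_of_le_one hθ0.le hθ1 (show 1 ≤ 5 by norm_num)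
  have h5p : 0 < θ ^ 5 := by positivity
  obtain ⟨c, hc0, hc1, hc⟩ := absorber 2 (θ ^ 5 / 4) (θ ^ 5 / 80) (by positivity) (by linarith) (by positivity)
    (by linarith)
  refine ⟨c, hc0, hc1, ?_⟩
  intro V C _ _ G s Y1 C2 hL1 hL2 hs hY1 hY2
  have hn : (0:ℝ) ≤ Fintype.card V := by positivity
  have hcnt := cliq_count (thick G θ Y1) (thick G θ C2) s θ hθ0 hθ1 hL1 hL2 univ univ univ 2
    (by rw [card_univ]; nlinarith [mul_nonneg (sq_nonneg θ) hn])
    (by rw [card_univ]; nlinarith [mul_nonneg (sq_nonneg θ) hn])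
    (by rw [card_univ]; nlinarith [mul_nonneg (sq_nonneg θ) hn])
    (θ ^ 2 * Fintype.card V / 2) (by positivity) (by rw [card_univ]; linarith) 2 le_rfl
  set TT := cliqT (thick G θ Y1) (thick G θ C2) θ univ univ univ 2 with hTT
  obtain ⟨Ds, hDs, m, r, t, ht, htd, hcard, h1, h2, h3, h4⟩ := hc V C TT
    (fun t c => (G c).Adj (t 0) (t 1)) Y1 hY1 hY2 (by
      have : ∀ t ∈ TT, θ * (Y1.card : ℝ) ≤ ((Y1.filter (fun c => (G c).Adj (t 0) (t 1))).card : ℝ) := by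
        intro t ht
        have := (mem_filter.1 ht).2.2.1 0 1 (by decide)
        exact this.2
      have h6 : (TT.card : ℝ) * (θ * Y1.card) ≤ eR (fun (t : Fin 2 → V) c => (G c).Adj (t 0) (t 1)) TT Y1 := by
        unfold eR
        rw [← nsmul_eq_mul]
        refine card_nsmul_le_sum _ _ _ (fun t ht => (this t ht).trans (le_of_eq ?_))
        congr
      refine le_trans ?_ h6
      have h7 : 0 ≤ θ * (Y1.card : ℝ) := by positivity
      have h8 := mul_le_mul_of_nonneg_right hcnt h7
      refine le_trans (le_of_eq ?_) h8
      ring)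
  refine ⟨Ds, hDs, m, r, t, ?_, htd, ?_, h4, hcard, h1, h2, h3.trans ?_⟩
  · intro j
    exact ((mem_filter.1 (ht j)).2.2.1 0 1 (by decide)).ne
  · intro j
    have := (mem_filter.1 (ht j)).2.2.2.2.1
    rwa [card_univ] at this
  · have : (0:ℝ) ≤ Ds.card := by positivity
    have h9 := mul_le_mul_of_nonneg_right (show 6 * (θ ^ 5 / 80) ≤ θ by linarith) this
    exact h9

/-- a uniform version of the absorber -/
theorem absorber_unif (N : ℕ) (d0 γ : ℝ) (hd0 : 0 < d0) (hd1 : d0 ≤ 1) (hγ : 0 < γ)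
    (hγd : γ ≤ d0 / 20) :
    ∃ c : ℝ, 0 < c ∧ c ≤ 1 ∧ ∀ k < N, ∀ (V Y : Type) [Fintype V] [Nonempty V] (TT : Finset (Fin k → V))
      (F : (Fin k → V) → Y → Prop) (Y1 : Finset Y),
      (Y1.card : ℝ) ≤ c * Fintype.card V → 1 ≤ c * Y1.card →
      d0 * (Fintype.card V : ℝ) ^ k * Y1.card ≤ eR F TT Y1 →
      ∃ Ys ⊆ Y1, ∃ (m r : ℕ) (t : Fin m → Fin k → V), (∀ i, t i ∈ TT) ∧
        (∀ i j, i ≠ j → ∀ a b, t i a ≠ t j b) ∧ Ys.card = m + r ∧ c * Y1.card ≤ Ys.card ∧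
        2 * γ * Ys.card ≤ r ∧ (r : ℝ) ≤ 6 * γ * Ys.card ∧
        ∀ Y' ⊆ Ys, Y'.card = m → ∃ f : Fin m → Y, Function.Injective f ∧
          ∀ i, f i ∈ Y' ∧ F (t i) (f i) := by
  induction N with
  | zero => exact ⟨1, one_pos, le_rfl, fun k hk => absurd hk (by omega)⟩
  | succ N ih =>
    obtain ⟨c1, h10, h11, h1⟩ := ih
    obtain ⟨c2, h20, h21, h2⟩ := absorber N d0 γ hd0 hd1 hγ hγd
    refine ⟨min c1 c2, lt_min h10 h20, (min_le_left _ _).trans h11, ?_⟩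
    intro k hk V Y _ _ TT F Y1 e1 e2 e3
    have hn : (0:ℝ) ≤ Fintype.card V := by positivity
    have hy : (0:ℝ) ≤ Y1.card := by positivity
    rcases Nat.lt_succ_iff_lt_or_eq.1 hk with hk | hk
    · obtain ⟨Ys, hYs, m, r, t, a1, a2, a3, a4, a5⟩ := h1 k hk V Y TT F Y1
        (e1.trans (mul_le_mul_of_nonneg_right (min_le_left _ _) hn))
        (e2.trans (mul_le_mul_of_nonneg_right (min_le_left _ _) hy)) e3
      exact ⟨Ys, hYs, m, r, t, a1, a2, a3, (mul_le_mul_of_nonneg_right (min_le_left _ _) hy).trans a4, a5⟩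
    · subst hk
      obtain ⟨Ys, hYs, m, r, t, a1, a2, a3, a4, a5⟩ := h2 V Y TT F Y1
        (e1.trans (mul_le_mul_of_nonneg_right (min_le_right _ _) hn))
        (e2.trans (mul_le_mul_of_nonneg_right (min_le_right _ _) hy)) e3
      exact ⟨Ys, hYs, m, r, t, a1, a2, a3, (mul_le_mul_of_nonneg_right (min_le_right _ _) hy).trans a4, a5⟩

set_option maxHeartbeats 1000000 in
/-- the vertex absorber -/
theorem absorb_v (Δ : ℕ) (θ γ : ℝ) (hθ0 : 0 < θ) (hθ1 : θ ≤ 1) (hγ : 0 < γ)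
    (hγd : γ ≤ (θ ^ (Δ + 1) / 4) ^ Δ / 20) :
    ∃ c : ℝ, 0 < c ∧ c ≤ 1 ∧ ∀ k ≤ Δ, ∀ (V : Type) [Fintype V] [Nonempty V] (J : SimpleGraph V) (s : ℝ)
      (A Y1 : Finset V), LD J s θ → (Fintype.card V : ℝ) ≤ 2 * A.card → 0 ≤ s →
      12 * s ≤ θ ^ Δ * Fintype.card V → s ≤ θ ^ Δ * Y1.card →
      (Y1.card : ℝ) ≤ c * Fintype.card V → 1 ≤ c * Y1.card →
      ∃ Vs ⊆ Y1, ∃ (mv rv : ℕ) (ti : Fin mv → Fin k → V), (∀ i a, ti i a ∈ A) ∧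
        (∀ i a b, a ≠ b → J.Adj (ti i a) (ti i b)) ∧
        (∀ i j, i ≠ j → ∀ a b, ti i a ≠ ti j b) ∧
        (∀ i, θ ^ k * (Fintype.card V : ℝ) ≤
          (((univ : Finset V).filter (fun v => ∀ a, J.Adj (ti i a) v)).card : ℝ)) ∧
        (∀ Y' ⊆ Vs, Y'.card = mv → ∃ f : Fin mv → V, Function.Injective f ∧
          ∀ i, f i ∈ Y' ∧ ∀ a, J.Adj (ti i a) (f i)) ∧
        Vs.card = mv + rv ∧ c * Y1.card ≤ Vs.card ∧ 2 * γ * Vs.card ≤ rv ∧ (rv : ℝ) ≤ 6 * γ * Vs.card := by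
  have hq0 : 0 < θ ^ (Δ + 1) / 4 := by positivity
  have hq1 : θ ^ (Δ + 1) / 4 ≤ 1 := by
    have := pow_le_one₀ (n := Δ + 1) hθ0.le hθ1
    linarith
  obtain ⟨c, hc0, hc1, hc⟩ := absorber_unif (Δ + 1) ((θ ^ (Δ + 1) / 4) ^ Δ) γ (by positivity)
    (pow_le_one₀ hq0.le hq1) hγ hγd
  refine ⟨c, hc0, hc1, ?_⟩
  intro k hk V _ _ J s A Y1 hL hA hs0 hs hsY hY1 hY2
  have hn : (0:ℝ) ≤ Fintype.card V := by positivity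
  have hp : 0 < θ ^ Δ := by positivity
  have hp1 := mul_le_mul_of_nonneg_left hA hp.le
  have hAu : (A.card : ℝ) ≤ Fintype.card V := by exact_mod_cast card_le_univ A
  have hcnt := cliq_count J J s θ hθ0 hθ1 hL hL A univ Y1 Δ
    (by linarith)
    (by rw [card_univ]; linarith)
    hsY
    (θ ^ Δ * Fintype.card V / 4) (by positivity) (by linarith) k hk
  set TT := cliqT J J θ A univ Y1 k with hTT
  obtain ⟨Ds, hDs, m, r, t, ht, htd, hcard, h1, h2, h3, h4⟩ := hc k (by omega) V V TT
    (fun t v => ∀ a, J.Adj (t a) v) Y1 hY1 hY2 (by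
      have : ∀ t ∈ TT, θ ^ k * (Y1.card : ℝ) ≤ ((Y1.filter (fun v => ∀ a, J.Adj (t a) v)).card : ℝ) := by
        intro t ht
        exact (mem_filter.1 ht).2.2.2.2.2
      have h6 : (TT.card : ℝ) * (θ ^ k * Y1.card) ≤ eR (fun (t : Fin k → V) v => ∀ a, J.Adj (t a) v) TT Y1 := by
        unfold eR
        rw [← nsmul_eq_mul]
        refine card_nsmul_le_sum _ _ _ (fun t ht => (this t ht).trans (le_of_eq ?_))
        congr
      refine le_trans ?_ h6
      have h7 : 0 ≤ θ ^ k * (Y1.card : ℝ) := by positivity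
      have h8 := mul_le_mul_of_nonneg_right hcnt h7
      refine le_trans ?_ h8
      have h9 : (θ ^ (Δ + 1) / 4) ^ Δ ≤ (θ ^ (Δ + 1) / 4) ^ k := pow_le_pow_of_le_one hq0.le hq1 hk
      have h10 : (θ ^ Δ * (Fintype.card V : ℝ) / 4) ^ k * (θ ^ k * Y1.card) =
          (θ ^ (Δ + 1) / 4) ^ k * (Fintype.card V : ℝ) ^ k * Y1.card := by
        have : θ ^ (Δ + 1) / 4 = θ ^ Δ / 4 * θ := by ring
        rw [this, mul_pow, mul_div_right_comm, mul_pow]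
        ring
      rw [h10]
      gcongr)
  refine ⟨Ds, hDs, m, r, t, ?_, ?_, htd, ?_, h4, hcard, h1, h2, h3⟩
  · intro j
    exact (mem_filter.1 (ht j)).2.1
  · intro j
    exact (mem_filter.1 (ht j)).2.2.1
  · intro j
    have := (mem_filter.1 (ht j)).2.2.2.2.1
    rwa [card_univ] at this

/-- every vertex has large degree in the thick graph -/
theorem deg_thick {V C : Type} [Fintype V] [Fintype C] (G : C → SimpleGraph V) (a : ℝ) (ha : 0 < a)
    (C2 : Finset C) (v : V) (hV : 0 < Fintype.card V)
    (hdeg : a * (Fintype.card C : ℝ) * Fintype.card V ≤ ∑ c : C, (degOf (G c) v : ℝ))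
    (hC2 : ((univ \ C2).card : ℝ) < a / 2 * Fintype.card C) :
    a / 4 * (Fintype.card V : ℝ) ≤
      (((univ : Finset V).filter (fun w => (thick G (a / 4) C2).Adj v w)).card : ℝ) := by
  set N := (univ : Finset V).filter (fun w => (thick G (a / 4) C2).Adj v w) with hN
  by_contra hcon
  push Not at hcon
  have hn : (0:ℝ) < Fintype.card V := by exact_mod_cast hV
  have h1 : ∑ c : C, (degOf (G c) v : ℝ) = ∑ c ∈ univ \ C2, (degOf (G c) v : ℝ) + ∑ c ∈ C2, (degOf (G c) v : ℝ) :=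
    (sum_sdiff (subset_univ C2)).symm
  have h2 : ∑ c ∈ univ \ C2, (degOf (G c) v : ℝ) ≤ (univ \ C2).card * (Fintype.card V : ℝ) := by
    rw [← nsmul_eq_mul]
    refine sum_le_card_nsmul _ _ _ (fun c _ => ?_)
    have : degOf (G c) v ≤ Fintype.card V := card_le_univ _
    exact_mod_cast this
  have h3 : ∑ c ∈ C2, (degOf (G c) v : ℝ) = ∑ w : V, ((C2.filter (fun c => (G c).Adj v w)).card : ℝ) := by
    have : ∑ c ∈ C2, degOf (G c) v = ∑ w : V, (C2.filter (fun c => (G c).Adj v w)).card :=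
      sum_card_bipartiteAbove_eq_sum_card_bipartiteBelow (fun c w => (G c).Adj v w)
    exact_mod_cast this
  have h4 : ∑ w : V, ((C2.filter (fun c => (G c).Adj v w)).card : ℝ) ≤
      ∑ w : V, ((if w ∈ N then (C2.card : ℝ) else 0) + a / 4 * C2.card) := by
    refine sum_le_sum (fun w _ => ?_)
    have hc2 : (0:ℝ) ≤ a / 4 * C2.card := by positivity
    by_cases hw : w ∈ N
    · rw [if_pos hw]
      have : ((C2.filter (fun c => (G c).Adj v w)).card : ℝ) ≤ C2.card := by
        exact_mod_cast card_le_card (filter_subset _ _)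
      linarith
    · rw [if_neg hw, zero_add]
      by_cases hvw : v = w
      · have : C2.filter (fun c => (G c).Adj v w) = ∅ := by
          rw [filter_eq_empty_iff]
          intro c _ h
          exact h.ne hvw
        rw [this]; simpa using hc2
      · by_contra hc
        push Not at hc
        exact hw (mem_filter.2 ⟨mem_univ _, hvw, hc.le⟩)
  have h5 : ∑ w : V, ((if w ∈ N then (C2.card : ℝ) else 0) + a / 4 * C2.card) =
      N.card * (C2.card : ℝ) + Fintype.card V * (a / 4 * C2.card) := by
    rw [sum_add_distrib, sum_const, card_univ, nsmul_eq_mul, sum_ite_mem, univ_inter, sum_const, nsmul_eq_mul]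
  have h6 : (C2.card : ℝ) ≤ Fintype.card C := by exact_mod_cast card_le_univ C2
  have h7 : (N.card : ℝ) * (C2.card : ℝ) ≤ a / 4 * Fintype.card V * Fintype.card C := by
    have hc : (0:ℝ) ≤ C2.card := by positivity
    calc (N.card : ℝ) * (C2.card : ℝ) ≤ a / 4 * Fintype.card V * C2.card := mul_le_mul_of_nonneg_right hcon.le hc
      _ ≤ _ := by gcongr
  have h8 : (Fintype.card V : ℝ) * (a / 4 * C2.card) ≤ Fintype.card V * (a / 4 * Fintype.card C) := by gcongr
  have h9 : ((univ \ C2).card : ℝ) * (Fintype.card V : ℝ) < a / 2 * Fintype.card C * Fintype.card V :=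
    mul_lt_mul_of_pos_right hC2 hn
  linarith

/-- `family` with an indexed set of roots -/
theorem family_fun {W : Type} [Fintype W] {H : SimpleGraph W} {X : Finset W} {cls : W → Finset W} {mu : ℝ}
    (hs : HS H X cls mu) (Δ : ℕ) (hdeg : ∀ w, degOf H w ≤ Δ)
    (U P : Finset W) (n ζ : ℝ) (ι : Type) [Fintype ι] (hn : (Fintype.card W : ℝ) = n) (hζ : 0 < ζ) (hn0 : 0 < n)
    (hP : Clo X cls P) (hU : ((Δ:ℝ) + 1) ^ 4 * (ζ * n + P.card + mu) ≤ U.card)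
    (hq : (Fintype.card ι:ℝ) ≤ ζ * n / 4) :
    ∃ Q, ∃ r : ι → W, Clo X cls Q ∧ Disjoint Q P ∧ (Q.card : ℝ) ≤ 2 / ζ * (Fintype.card ι + mu) ∧
      (∀ j, r j ∈ Q) ∧ (∀ j, r j ∈ U) ∧
      (∀ j, Iso H X (r j)) ∧ (∀ i j, i ≠ j → Disjoint (bl H (r i)) (bl H (r j))) := by
  obtain ⟨Q, R, h1, h2, h3, h4, h5, h6, h7, h8⟩ := family hs Δ hdeg U P n ζ (Fintype.card ι) hn hζ hn0 hP hU hq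
  have e : ι ≃ ↥R := Fintype.equivOfCardEq (by rw [Fintype.card_coe, h6])
  refine ⟨Q, fun j => (e j : W), h1, h2, h3, fun j => h4 (e j).2, fun j => h5 (e j).2, fun j => h7 _ (e j).2, ?_⟩
  intro i j hij
  refine h8 _ (e i).2 _ (e j).2 (fun h => hij (e.injective (Subtype.ext h)))

theorem edge_le {W : Type} [Fintype W] (H : SimpleGraph W) (Δ : ℕ) (hdeg : ∀ w, degOf H w ≤ Δ) :
    edgeCnt H ≤ Δ * ((univ : Finset W).filter (fun w => 1 ≤ degOf H w)).card := by
  refine touch_card H Δ hdeg _ _ ?_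
  intro e he
  refine ⟨(mem_filter.1 he).2, ?_⟩
  have h := (mem_filter.1 he).2
  clear he
  induction e using Sym2.ind with
  | _ x y =>
    refine ⟨x, ?_, Sym2.mem_mk_left x y⟩
    rw [mem_filter]
    refine ⟨mem_univ _, ?_⟩
    unfold degOf
    exact card_pos.2 ⟨y, mem_filter.2 ⟨mem_univ _, h⟩⟩

theorem deg_class {W : Type} [Fintype W] (H : SimpleGraph W) (Δ : ℕ) (hdeg : ∀ w, degOf H w ≤ Δ) :
    ∃ k ≤ Δ, Fintype.card W ≤ (Δ + 1) * ((univ : Finset W).filter (fun w => degOf H w = k)).card := by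
  by_contra hcon
  push Not at hcon
  have h1 : Fintype.card W = ∑ k ∈ range (Δ + 1), ((univ : Finset W).filter (fun w => degOf H w = k)).card := by
    rw [← card_univ]
    exact card_eq_sum_card_fiberwise (fun w _ => by simpa [Nat.lt_succ_iff] using hdeg w)
  have h2 : (Δ + 1) * ∑ k ∈ range (Δ + 1), ((univ : Finset W).filter (fun w => degOf H w = k)).card
      < ∑ k ∈ range (Δ + 1), Fintype.card W := by
    rw [mul_sum]
    refine sum_lt_sum_of_nonempty ⟨0, by simp⟩ (fun k hk => hcon k (by simpa [Nat.lt_succ_iff] using hk))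
  rw [← h1, sum_const, card_range, smul_eq_mul] at h2
  exact lt_irrefl _ h2

theorem nbr_enum {W : Type} [Fintype W] (H : SimpleGraph W) (k : ℕ) (w : W) (h : degOf H w = k) :
    ∃ f : Fin k → W, Function.Injective f ∧ ∀ u, H.Adj w u ↔ ∃ a, f a = u := by
  have e : Fin k ≃ ↥((univ : Finset W).filter (fun u => H.Adj w u)) :=
    Fintype.equivOfCardEq (by rw [Fintype.card_coe, Fintype.card_fin]; exact h.symm)
  refine ⟨fun a => (e a : W), fun a b hab => e.injective (Subtype.ext hab), fun u => ⟨fun hu => ?_, ?_⟩⟩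
  · exact ⟨e.symm ⟨u, mem_filter.2 ⟨mem_univ _, hu⟩⟩, by simp⟩
  · rintro ⟨a, rfl⟩
    exact (mem_filter.1 (e a).2).2

/-- size of the image of a two index family -/
theorem img_card {V : Type} [Fintype V] (m k : ℕ) (f : Fin m → Fin k → V) :
    ((univ : Finset (Fin m × Fin k)).image (fun q => f q.1 q.2)).card ≤ k * m := by
  refine card_image_le.trans ?_
  simp [mul_comm]

theorem pow_small (θ τ n : ℝ) (Δ t N : ℕ) (hθ0 : 0 < θ) (hθ1 : θ ≤ 1) (hτ : 0 < τ) (hn : 0 < n) (ht : τ * n / 2 ≤ t)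
    (hN : (N : ℝ) ≤ Δ * n) (hbig : 8 * Δ ≤ θ ^ 2 * τ ^ 2 * n) : (1 - θ) ^ t * (N : ℝ) ≤ 1 := by
  have h1 : (1 - θ) ^ t ≤ Real.exp (-(θ * t)) := by
    have : 1 - θ ≤ Real.exp (-θ) := by have := Real.add_one_le_exp (-θ); linarith
    calc (1 - θ) ^ t ≤ (Real.exp (-θ)) ^ t := pow_le_pow_left₀ (by linarith) this t
      _ = Real.exp (-(θ * t)) := by rw [← Real.exp_nat_mul]; congr 1; ring
  have h2 : (N : ℝ) ≤ Real.exp (θ * t) := by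
    have hx : 0 ≤ θ * t := by positivity
    have h3 := Real.quadratic_le_exp_of_nonneg hx
    have h4 : θ * (τ * n / 2) ≤ θ * t := mul_le_mul_of_nonneg_left ht hθ0.le
    have h5 : (θ * (τ * n / 2)) ^ 2 ≤ (θ * t) ^ 2 := pow_le_pow_left₀ (by positivity) h4 2
    have h6 : 8 * (Δ * n) ≤ θ ^ 2 * τ ^ 2 * n * n := by
      have := mul_le_mul_of_nonneg_right hbig hn.le
      linarith
    have h7 : (θ * (τ * n / 2)) ^ 2 = θ ^ 2 * τ ^ 2 * n * n / 4 := by ring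
    rw [h7] at h5
    linarith
  calc (1 - θ) ^ t * (N : ℝ) ≤ Real.exp (-(θ * t)) * Real.exp (θ * t) :=
        mul_le_mul h1 h2 (by positivity) (Real.exp_pos _).le
    _ = 1 := by rw [← Real.exp_add]; simp

theorem floor_half (x : ℝ) (hx : 2 ≤ x) : x / 2 ≤ (⌊x⌋₊ : ℝ) ∧ (⌊x⌋₊ : ℝ) ≤ x := by
  refine ⟨?_, Nat.floor_le (by linarith)⟩
  have := Nat.lt_floor_add_one x
  linarith

theorem ceil_dbl (x : ℝ) (hx : 1 ≤ x) : x ≤ (⌈x⌉₊ : ℝ) ∧ (⌈x⌉₊ : ℝ) ≤ 2 * x := by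
  refine ⟨Nat.le_ceil x, ?_⟩
  have := Nat.ceil_lt_add_one (show 0 ≤ x by linarith)
  linarith

theorem num5 (D L z s T QY t Rv rv : ℝ) (hL : 1 ≤ L) (hD : D ≤ L) (hz : 1 ≤ z) (hs : 0 ≤ s) (hsT : s ≤ T)
    (hQ : QY ≤ 2 * z * (T + s)) (ht : t ≤ T) (h : 20 * L * (z * T) ≤ Rv) (hr : Rv ≤ rv) :
    QY + D * s + L * s + L * (2 * t + T) ≤ rv := by
  have hT : 0 ≤ T := hs.trans hsT
  have h1 : z * s ≤ z * T := mul_le_mul_of_nonneg_left hsT (by linarith)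
  have h2 : 1 * T ≤ z * T := mul_le_mul_of_nonneg_right hz hT
  have h3 : D * s ≤ L * s := mul_le_mul_of_nonneg_right hD hs
  have h4 : L * s ≤ L * (z * T) := mul_le_mul_of_nonneg_left (by linarith) (by linarith)
  have h5 : L * (2 * t + T) ≤ L * (3 * (z * T)) := mul_le_mul_of_nonneg_left (by linarith) (by linarith)
  have h6 : 1 * (z * T) ≤ L * (z * T) := mul_le_mul_of_nonneg_right hL (by linarith)
  linarith

theorem num6 (D z s Kv T QI Vs t Rc rc : ℝ) (hD : 1 ≤ D) (hz : 1 ≤ z) (hs : 0 ≤ s) (hsT : s ≤ T) (hT : T ≤ Kv)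
    (hK : 0 < Kv) (hQ : QI ≤ 2 * z * (Kv + s)) (hV : Vs ≤ Kv) (ht : t ≤ T) (h : 40 * D * (z * Kv) ≤ Rc) (hr : Rc ≤ rc) :
    D * (s + QI + Vs + 2 * t + T) < rc := by
  have h1 : z * s ≤ z * Kv := mul_le_mul_of_nonneg_left (by linarith) (by linarith)
  have h2 : 1 * Kv ≤ z * Kv := mul_le_mul_of_nonneg_right hz hK.le
  have h3 : D * (s + QI + Vs + 2 * t + T) ≤ D * (9 * (z * Kv)) := mul_le_mul_of_nonneg_left (by linarith) (by linarith)
  have h4 : 1 * (z * Kv) ≤ D * (z * Kv) := mul_le_mul_of_nonneg_right hD (by linarith)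
  linarith

theorem num7 (D θ P ω s Vs N1 rv : ℝ) (hω : P * (θ * P) = ω) (hω0 : 0 < ω) (hP0 : 0 ≤ P) (hP1 : P ≤ 1) (hD : 0 ≤ D)
    (hs : 0 ≤ s) (hN : 0 < N1) (hV : N1 ≤ Vs) (hr : rv ≤ ω / 2 * Vs) (h : 100 * D * s ≤ ω * N1) :
    D * s + rv < P * (θ * P * Vs - D * s) := by
  have h1 : ω * N1 ≤ ω * Vs := mul_le_mul_of_nonneg_left hV hω0.le
  have h2 : 0 < ω * N1 := by positivity
  have h3 : P * (D * s) ≤ 1 * (D * s) := mul_le_mul_of_nonneg_right hP1 (by positivity)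
  have h4 : P * (θ * P * Vs - D * s) = (P * (θ * P)) * Vs - P * (D * s) := by ring
  rw [h4, hω]
  linarith

theorem num3 (D θ P ω s Vs N1 : ℝ) (hω : P * (θ * P) = ω) (hω0 : 0 < ω) (hθ1 : θ ≤ 1) (hP0 : 0 ≤ P) (hP1 : P ≤ 1)
    (hD : 1 ≤ D) (hs : 0 ≤ s) (hN : 0 < N1) (hV : N1 ≤ Vs) (h : 100 * D * s ≤ ω * N1) :
    D * s + s < P * (P * Vs - D * s) := by
  have h1 : ω * N1 ≤ ω * Vs := mul_le_mul_of_nonneg_left hV hω0.le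
  have h2 : 0 < ω * N1 := by positivity
  have h3 : P * (D * s) ≤ 1 * (D * s) := mul_le_mul_of_nonneg_right hP1 (by positivity)
  have h4 : P * (P * Vs - D * s) = (P * P) * Vs - P * (D * s) := by ring
  have h5 : ω ≤ P * P := by
    have := mul_le_mul_of_nonneg_right hθ1 (mul_nonneg hP0 hP0)
    linarith
  have h6 : ω * Vs ≤ (P * P) * Vs := mul_le_mul_of_nonneg_right h5 (by linarith)
  have h7 : 1 * s ≤ D * s := mul_le_mul_of_nonneg_right hD hs
  rw [h4]
  linarith

theorem numM3 (D θ P ω δ z s Kc n QM QB QI : ℝ) (hω : P * (θ * P) = ω) (hω0 : 0 < ω) (hD : 1 ≤ D) (hz : 1 ≤ z)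
    (hδ0 : 0 < δ) (hδ : δ ≤ 1) (hn : 0 < n)
    (hs : 0 ≤ s) (hsK : s ≤ Kc) (hM : QM ≤ 4 * (z * Kc)) (hB : QB ≤ 4 * (z * Kc))
    (hI : QI ≤ 4 * (z * Kc)) (h : 100 * D * (z * Kc) ≤ ω * δ * n) :
    D * s + s + (QM + QB) + QI < P * (θ * P * n / 2) := by
  have h0 : P * (θ * P * n / 2) = (P * (θ * P)) * n / 2 := by ring
  rw [h0, hω]
  have h1 : δ * (ω * n) ≤ 1 * (ω * n) := mul_le_mul_of_nonneg_right hδ (by positivity)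
  have h2 : 0 < ω * n := by positivity
  have h3 : 1 * Kc ≤ z * Kc := mul_le_mul_of_nonneg_right hz (by linarith)
  have h4 : D * s ≤ D * (z * Kc) := mul_le_mul_of_nonneg_left (by linarith) (by linarith)
  have h5 : 1 * (z * Kc) ≤ D * (z * Kc) := mul_le_mul_of_nonneg_right hD (by linarith)
  linarith

theorem numM4 (D θ ω δ z Kc n QM QB c2 : ℝ) (hωθ : ω ≤ θ) (hθ : 0 < θ) (hD : 1 ≤ D)
    (hδ0 : 0 < δ) (hn : 0 < n)
    (hM : QM ≤ 4 * (z * Kc)) (hB : QB ≤ 4 * (z * Kc)) (hc : δ * n / 2 ≤ c2)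
    (h : 100 * D * (z * Kc) ≤ ω * δ * n) :
    D * (QM + QB) ≤ θ * c2 := by
  have h1 : ω * (δ * n) ≤ θ * (δ * n) := mul_le_mul_of_nonneg_right hωθ (by positivity)
  have h2 : θ * (δ * n / 2) ≤ θ * c2 := mul_le_mul_of_nonneg_left hc hθ.le
  have h3 : D * (QM + QB) ≤ D * (8 * (z * Kc)) := mul_le_mul_of_nonneg_left (by linarith) (by linarith)
  have h4 : 0 ≤ θ * (δ * n) := by positivity
  linarith

theorem numM0 (D w ω δ z s Kc Kv T n Vs t mc mv bb : ℝ) (hωw : ω ≤ w) (hω0 : 0 < ω) (hD : 1 ≤ D) (hz : 1 ≤ z)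
    (hδ0 : 0 < δ) (hδ : δ ≤ 1) (hn : 0 < n) (hs : 0 ≤ s) (hsT : s ≤ T) (hTK : T ≤ Kv) (hKK : Kv ≤ Kc)
    (hV : Vs ≤ Kv) (ht : t ≤ T) (hmc : mc ≤ Kc) (hmv : mv ≤ Kv) (hb : bb ≤ s)
    (h : 100 * D * (z * Kc) ≤ ω * δ * n) :
    Vs + 2 * t + 2 * mc + D * mv + bb ≤ w * n / 2 := by
  have h1 : δ * (ω * n) ≤ 1 * (ω * n) := mul_le_mul_of_nonneg_right hδ (by positivity)
  have h2 : ω * n ≤ w * n := mul_le_mul_of_nonneg_right hωw hn.le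
  have h3 : 1 * Kc ≤ z * Kc := mul_le_mul_of_nonneg_right hz (by linarith)
  have h4 : D * mv ≤ D * (z * Kc) := mul_le_mul_of_nonneg_left (by linarith) (by linarith)
  have h5 : 1 * (z * Kc) ≤ D * (z * Kc) := mul_le_mul_of_nonneg_right hD (by linarith)
  have h6 : 0 < ω * n := by positivity
  linarith

theorem numP (L ζ u0 z s Kc n p u : ℝ) (hL : 0 ≤ L) (hn : 0 < n) (hu : 2 * L * ζ ≤ u0) (hs : s ≤ z * Kc)
    (hp : p ≤ 12 * (z * Kc)) (hK : 0 ≤ z * Kc) (h : 100 * (z * Kc) ≤ ζ * n) (hU : u0 * n ≤ u) :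
    L * (ζ * n + p + s) ≤ u := by
  have h1 : L * (ζ * n + p + s) ≤ L * (2 * (ζ * n)) := mul_le_mul_of_nonneg_left (by linarith) hL
  have h2 : 2 * L * ζ * n ≤ u0 * n := mul_le_mul_of_nonneg_right hu hn.le
  linarith

/-- the colour absorber property -/
def AbsC (θ c : ℝ) : Prop :=
  ∀ (V C : Type) [Fintype V] [Nonempty V] (G : C → SimpleGraph V) (s : ℝ)
      (Y1 C2 : Finset C), LD (thick G θ Y1) s θ → LD (thick G θ C2) s θ → 6 * s ≤ θ ^ 2 * Fintype.card V →
      (Y1.card : ℝ) ≤ c * Fintype.card V → 1 ≤ c * Y1.card →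
      ∃ Ds ⊆ Y1, ∃ (mc rc : ℕ) (pm : Fin mc → Fin 2 → V), (∀ j, pm j 0 ≠ pm j 1) ∧
        (∀ i j, i ≠ j → ∀ a b, pm i a ≠ pm j b) ∧
        (∀ j, θ ^ 2 * (Fintype.card V : ℝ) ≤
          (((univ : Finset V).filter (fun v => ∀ a, (thick G θ C2).Adj (pm j a) v)).card : ℝ)) ∧
        (∀ Y' ⊆ Ds, Y'.card = mc → ∃ f : Fin mc → C, Function.Injective f ∧
          ∀ j, f j ∈ Y' ∧ (G (f j)).Adj (pm j 0) (pm j 1)) ∧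
        Ds.card = mc + rc ∧ c * Y1.card ≤ Ds.card ∧ 2 * (θ ^ 5 / 80) * Ds.card ≤ rc ∧
        (rc : ℝ) ≤ θ * Ds.card

/-- the vertex absorber property -/
def AbsV (Δ : ℕ) (θ γ c : ℝ) : Prop :=
  ∀ k ≤ Δ, ∀ (V : Type) [Fintype V] [Nonempty V] (J : SimpleGraph V) (s : ℝ)
      (A Y1 : Finset V), LD J s θ → (Fintype.card V : ℝ) ≤ 2 * A.card → 0 ≤ s →
      12 * s ≤ θ ^ Δ * Fintype.card V → s ≤ θ ^ Δ * Y1.card →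
      (Y1.card : ℝ) ≤ c * Fintype.card V → 1 ≤ c * Y1.card →
      ∃ Vs ⊆ Y1, ∃ (mv rv : ℕ) (ti : Fin mv → Fin k → V), (∀ i a, ti i a ∈ A) ∧
        (∀ i a b, a ≠ b → J.Adj (ti i a) (ti i b)) ∧
        (∀ i j, i ≠ j → ∀ a b, ti i a ≠ ti j b) ∧
        (∀ i, θ ^ k * (Fintype.card V : ℝ) ≤
          (((univ : Finset V).filter (fun v => ∀ a, J.Adj (ti i a) v)).card : ℝ)) ∧
        (∀ Y' ⊆ Vs, Y'.card = mv → ∃ f : Fin mv → V, Function.Injective f ∧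
          ∀ i, f i ∈ Y' ∧ ∀ a, J.Adj (ti i a) (f i)) ∧
        Vs.card = mv + rv ∧ c * Y1.card ≤ Vs.card ∧ 2 * γ * Vs.card ≤ rv ∧ (rv : ℝ) ≤ 6 * γ * Vs.card

theorem absC_ex (θ : ℝ) (hθ0 : 0 < θ) (hθ1 : θ ≤ 1) : ∃ c : ℝ, 0 < c ∧ c ≤ 1 ∧ AbsC θ c := absorb_c θ hθ0 hθ1

theorem absV_ex (Δ : ℕ) (θ γ : ℝ) (hθ0 : 0 < θ) (hθ1 : θ ≤ 1) (hγ : 0 < γ)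
    (hγd : γ ≤ (θ ^ (Δ + 1) / 4) ^ Δ / 20) : ∃ c : ℝ, 0 < c ∧ c ≤ 1 ∧ AbsV Δ θ γ c :=
  absorb_v Δ θ γ hθ0 hθ1 hγ hγd

set_option maxHeartbeats 4000000 in
/-- the theorem for fixed sizes -/
theorem core (Δ : ℕ) (hΔ : 1 ≤ Δ) (a θ δ cc cv γ ζ z ω u0 η s n Kc Kv T : ℝ)
    (hθ0 : 0 < θ) (hθ1 : θ ≤ 1 / 4) (haθ : a / 4 = θ) (hω : θ ^ Δ * (θ * θ ^ Δ) = ω)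
    (hδ0 : 0 < δ) (hδ1 : δ ≤ 1) (hcc0 : 0 < cc) (hcc1 : cc ≤ 1) (hcv0 : 0 < cv) (hcv1 : cv ≤ 1)
    (hAC : AbsC θ cc) (hAV : AbsV Δ θ γ cv) (hγ0 : 0 < γ) (hγω : 12 * γ ≤ ω)
    (hζ0 : 0 < ζ) (hz : 1 / ζ = z) (hz1 : 1 ≤ z) (hu0 : 2 * ((Δ : ℝ) + 1) ^ 4 * ζ ≤ u0) (hu1 : u0 * Δ ≤ δ)
    (hu2 : u0 * ((Δ : ℝ) + 1) ≤ 1) (hn0 : 0 < n)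
    (hKc1 : Kc ≤ cc * n) (hA1 : 100 * Δ * (z * Kc) ≤ ω * δ * n) (hA3 : 100 * (z * Kc) ≤ ζ * n)
    (hKc2 : 2 ≤ cc * Kc) (hKv1 : Kv ≤ cv * n) (hKvc : Kv ≤ Kc) (hB1 : 40 * Δ * (z * Kv) ≤ θ ^ 5 / 80 * (cc * Kc))
    (hKv2 : 2 ≤ cv * Kv) (hTK : T ≤ Kv) (hD1 : 20 * ((Δ : ℝ) + 1) ^ 4 * (z * T) ≤ γ * (cv * Kv))
    (hT2 : 2 ≤ T) (hT3 : 1 ≤ θ * T / 2)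
    (hpow : ∀ t N : ℕ, T / 2 ≤ t → (N : ℝ) ≤ Δ * n → (1 - θ) ^ t * (N : ℝ) ≤ 1)
    (hs0 : 0 < s) (hS1 : 100 * Δ * s ≤ ω * (cv * Kv / 2)) (hS2 : 100 * Δ * s ≤ θ ^ 2 * ω * T)
    (hη : η * n ^ 3 ≤ a / 2 * (θ * T / 2) * s * s)
    {V C W : Type} [Fintype V] [Fintype C] [Fintype W] (G : C → SimpleGraph V) (H : SimpleGraph W)
    (hV : (Fintype.card V : ℝ) = n) (hW : (Fintype.card W : ℝ) = n) (hC : δ * n ≤ Fintype.card C)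
    (hdense : ∀ A B : Finset V, ∀ C' : Finset C,
        a * (C'.card : ℝ) * (A.card : ℝ) * (B.card : ℝ) - η * n ^ 3 ≤ ∑ c ∈ C', (pairCount (G c) A B : ℝ))
    (hdv : ∀ v : V, a * (Fintype.card C : ℝ) * n ≤ ∑ c : C, (degOf (G c) v : ℝ))
    (hec : ∀ c : C, a * n ^ 2 ≤ (edgeCnt (G c) : ℝ))
    (X : Finset W) (cls : W → Finset W) (hHS : HS H X cls s)
    (hdeg : ∀ w, degOf H w ≤ Δ) (hEC : edgeCnt H = Fintype.card C) : HasTransversal G H := by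
  -- basic numerical facts
  have ha0 : 0 < a := by linarith
  have ha1 : a ≤ 1 := by linarith
  have hD : (1:ℝ) ≤ Δ := by exact_mod_cast hΔ
  have hP0 : 0 < θ ^ Δ := by positivity
  have hP1 : θ ^ Δ ≤ 1 := pow_le_one₀ hθ0.le (by linarith)
  have hω0 : 0 < ω := by rw [← hω]; positivity
  have hωw : ω ≤ θ * θ ^ Δ := by
    have := mul_le_mul_of_nonneg_right hP1 (show 0 ≤ θ * θ ^ Δ by positivity)
    linarith
  have hωθ : ω ≤ θ := by
    have := mul_le_mul_of_nonneg_left hP1 hθ0.le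
    linarith
  have hωP : ω ≤ θ ^ Δ := by
    have := mul_le_mul_of_nonneg_right (show θ ≤ 1 by linarith) hP0.le
    linarith
  have hL1 : (1:ℝ) ≤ ((Δ:ℝ) + 1) ^ 4 := one_le_pow₀ (by linarith)
  have hLD : (Δ:ℝ) ≤ ((Δ:ℝ) + 1) ^ 4 := by
    have := le_self_pow₀ (show (1:ℝ) ≤ (Δ:ℝ) + 1 by linarith) (show (4:ℕ) ≠ 0 by norm_num)
    linarith
  have hKv0 : 0 < Kv := by linarith
  have hKc0 : 0 < Kc := by linarith
  have hcKc : cc * Kc ≤ Kc := by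
    have := mul_le_mul_of_nonneg_right hcc1 hKc0.le
    linarith
  have hcKv : cv * Kv ≤ Kv := by
    have := mul_le_mul_of_nonneg_right hcv1 hKv0.le
    linarith
  have hzc : Kc ≤ z * Kc := by
    have := mul_le_mul_of_nonneg_right hz1 hKc0.le
    linarith
  have hzv : Kv ≤ z * Kv := by
    have := mul_le_mul_of_nonneg_right hz1 hKv0.le
    linarith
  have hDzc : z * Kc ≤ Δ * (z * Kc) := by
    have := mul_le_mul_of_nonneg_right hD (show 0 ≤ z * Kc by linarith)
    linarith
  have hDzv : z * Kv ≤ Δ * (z * Kv) := by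
    have := mul_le_mul_of_nonneg_right hD (show 0 ≤ z * Kv by linarith)
    linarith
  have hDs : s ≤ Δ * s := by
    have := mul_le_mul_of_nonneg_right hD hs0.le
    linarith
  have hδn : 0 < δ * n := by positivity
  have hδn1 : δ * n ≤ n := by
    have := mul_le_mul_of_nonneg_right hδ1 hn0.le
    linarith
  have hωδ : ω * δ * n ≤ θ * (δ * n) := by
    have := mul_le_mul_of_nonneg_right hωθ hδn.le
    linarith
  have hθδ : θ * (δ * n) ≤ 1 / 4 * (δ * n) := mul_le_mul_of_nonneg_right hθ1 hδn.le
  have hKcδ : 100 * Kc ≤ θ * (δ * n) := by linarith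
  have hθ2 : θ ^ 2 ≤ 1 := pow_le_one₀ hθ0.le (by linarith)
  have hω1 : ω ≤ 1 := by linarith
  have hT0 : 0 < T := by linarith
  have hsT2 : 100 * Δ * s ≤ ω * T := by
    have := mul_le_mul_of_nonneg_right hθ2 (show 0 ≤ ω * T by positivity)
    linarith
  have hsT1 : 100 * s ≤ T := by
    have := mul_le_mul_of_nonneg_right hω1 hT0.le
    linarith
  have hsθ : 100 * s ≤ θ ^ 2 * T := by
    have h1 := mul_le_mul_of_nonneg_right hω1 (show 0 ≤ θ ^ 2 * T by positivity)
    have h2 : θ ^ 2 * ω * T = ω * (θ ^ 2 * T) := by ring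
    linarith
  have hsP : 100 * s ≤ θ ^ Δ * T := by
    have h1 := mul_le_mul_of_nonneg_right hωP hT0.le
    linarith
  have hTn : T ≤ n := by linarith
  have hzs : z * s ≤ z * T := mul_le_mul_of_nonneg_left (by linarith) (by linarith)
  have hzsc : z * s ≤ z * Kc := mul_le_mul_of_nonneg_left (by linarith) (by linarith)
  have hzvc : z * Kv ≤ z * Kc := mul_le_mul_of_nonneg_left (by linarith) (by linarith)
  have h2z : 2 / ζ = 2 * z := by rw [← hz]; ring
  have hθT : θ * T ≤ 1 / 4 * T := mul_le_mul_of_nonneg_right hθ1 hT0.le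
  have hVW : Fintype.card V = Fintype.card W := by
    have : (Fintype.card V : ℝ) = Fintype.card W := by rw [hV, hW]
    exact_mod_cast this
  have hVp : 0 < Fintype.card V := by
    have : (0:ℝ) < Fintype.card V := by rw [hV]; exact hn0
    exact_mod_cast this
  have hCp : 0 < Fintype.card C := by
    have : (0:ℝ) < Fintype.card C := by linarith
    exact_mod_cast this
  haveI : Nonempty V := Fintype.card_pos_iff.1 hVp
  haveI : Nonempty C := Fintype.card_pos_iff.1 hCp
  have hCn : (Fintype.card C : ℝ) ≤ Δ * n := by
    have h1 := edge_le H Δ hdeg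
    have h2 : ((univ : Finset W).filter (fun w => 1 ≤ degOf H w)).card ≤ Fintype.card W := card_le_univ _
    have h3 : Fintype.card C ≤ Δ * Fintype.card W := by
      rw [← hEC]; exact h1.trans (Nat.mul_le_mul_left _ h2)
    rw [← hW]; exact_mod_cast h3
  have LDY : ∀ Y : Finset C, θ * T / 2 < Y.card → LD (thick G θ Y) s θ := by
    intro Y hY
    have := thick_LD G a η n s Y ha0 hs0 hdense (lt_of_le_of_lt hη (by
      have h1 : 0 < a / 2 * s * s := by positivity
      have h2 := mul_lt_mul_of_pos_left hY h1
      linarith))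
    rwa [haθ] at this
  -- the colour absorber
  obtain ⟨fKc1, fKc2⟩ := floor_half Kc (by linarith)
  obtain ⟨Y1, -, hY1⟩ := exists_subset_card_eq (s := (univ : Finset C)) (n := ⌊Kc⌋₊) (by
    rw [card_univ]
    have : (⌊Kc⌋₊ : ℝ) ≤ Fintype.card C := by linarith
    exact_mod_cast this)
  rw [← hY1] at fKc1 fKc2
  have hY1C : (Y1.card : ℝ) + (univ \ Y1).card = Fintype.card C := by
    have := card_sdiff_add_card_eq_card (subset_univ Y1)
    rw [card_univ] at this
    exact_mod_cast (by omega : Y1.card + (univ \ Y1).card = Fintype.card C)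
  obtain ⟨C2, hC2⟩ : ∃ C2, univ \ Y1 = C2 := ⟨_, rfl⟩
  rw [hC2] at hY1C
  have hC2c : δ * n / 2 ≤ C2.card := by linarith
  have LD1 : LD (thick G θ Y1) s θ := LDY _ (by linarith)
  have LD2 : LD (thick G θ C2) s θ := LDY _ (by linarith)
  obtain ⟨Ds, hDsY, mc, rc, pm, pm0, pmd, pmn, pma, hDsc, hDs1, hrc1, hrc2⟩ := hAC V C G s Y1 C2 LD1 LD2
    (by
      rw [hV]
      have := mul_le_mul_of_nonneg_left hTn (sq_nonneg θ)
      linarith) (by rw [hV]; linarith)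
    (by
      have := mul_le_mul_of_nonneg_left fKc1 hcc0.le
      linarith)
  have hDC : Disjoint Ds C2 := by
    rw [← hC2]
    exact disjoint_of_subset_left hDsY disjoint_sdiff
  have hDs2 : cc * Kc / 2 ≤ Ds.card := by
    have := mul_le_mul_of_nonneg_left fKc1 hcc0.le
    linarith
  have hθ5 : θ ^ 5 ≤ 1 := pow_le_one₀ hθ0.le (by linarith)
  have hRc : θ ^ 5 / 80 * (cc * Kc) ≤ rc := by
    have := mul_le_mul_of_nonneg_left hDs2 (show 0 ≤ 2 * (θ ^ 5 / 80) by positivity)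
    linarith
  have LDs : LD (thick G θ Ds) s θ := LDY _ (by
    have h1 := mul_le_mul_of_nonneg_right hθ5 (show 0 ≤ cc * Kc by positivity)
    linarith)
  have hmc : (mc : ℝ) ≤ Kc := by
    have h1 : mc ≤ Ds.card := by omega
    have h2 : Ds.card ≤ Y1.card := card_le_card hDsY
    have h3 : (mc : ℝ) ≤ Y1.card := by exact_mod_cast h1.trans h2
    linarith
  -- the vertex absorber
  obtain ⟨PM, hPM⟩ : ∃ PM : Finset V, (univ : Finset (Fin mc × Fin 2)).image (fun q => pm q.1 q.2) = PM := ⟨_, rfl⟩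
  have hPMc : (PM.card : ℝ) ≤ 2 * mc := by
    have := img_card mc 2 pm
    rw [hPM] at this
    exact_mod_cast this
  have hPMm : ∀ j b, pm j b ∈ PM := by
    intro j b; rw [← hPM]; exact mem_image.2 ⟨(j, b), mem_univ _, rfl⟩
  have hPMd : ((univ \ PM).card : ℝ) + PM.card = n := by
    have := card_sdiff_add_card_eq_card (subset_univ PM)
    rw [card_univ] at this
    rw [← hV]; exact_mod_cast this
  obtain ⟨fKv1, fKv2⟩ := floor_half Kv (by linarith)
  obtain ⟨Z1, hZ1s, hZ1⟩ := exists_subset_card_eq (s := univ \ PM) (n := ⌊Kv⌋₊) (by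
    have : (⌊Kv⌋₊ : ℝ) ≤ (univ \ PM).card := by linarith
    exact_mod_cast this)
  rw [← hZ1] at fKv1 fKv2
  obtain ⟨A, hA⟩ : ∃ A, (univ \ PM) \ Z1 = A := ⟨_, rfl⟩
  have hAc : (A.card : ℝ) + Z1.card = (univ \ PM).card := by
    have := card_sdiff_add_card_eq_card hZ1s
    rw [hA] at this
    exact_mod_cast this
  obtain ⟨k, hk, hkc⟩ := deg_class H Δ hdeg
  have hcvZ : cv * Kv / 2 ≤ cv * Z1.card := by
    have := mul_le_mul_of_nonneg_left fKv1 hcv0.le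
    linarith
  obtain ⟨Vs, hVsZ, mv, rv, ti, tiA, tiJ, tid, tin, tia, hVsc, hVs1, hrv1, hrv2⟩ :=
    hAV k hk V (thick G θ Ds) s A Z1 LDs (by rw [hV]; linarith) hs0.le
      (by
        rw [hV]
        have := mul_le_mul_of_nonneg_left hTn hP0.le
        linarith)
      (by
        have h1 : T / 2 ≤ Z1.card := by linarith
        have := mul_le_mul_of_nonneg_left h1 hP0.le
        linarith)
      (by rw [hV]; linarith) (by linarith)
  have hVsN : cv * Kv / 2 ≤ Vs.card := by linarith
  have hVsK : (Vs.card : ℝ) ≤ Kv := by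
    have : (Vs.card : ℝ) ≤ Z1.card := by exact_mod_cast card_le_card hVsZ
    linarith
  have hmv : (mv : ℝ) ≤ Kv := by
    have : (mv : ℝ) ≤ Vs.card := by exact_mod_cast (by omega : mv ≤ Vs.card)
    linarith
  have hRv : γ * (cv * Kv) ≤ rv := by
    have := mul_le_mul_of_nonneg_left hVsN (show 0 ≤ 2 * γ by positivity)
    linarith
  have hrvω : (rv : ℝ) ≤ ω / 2 * Vs.card := by
    have := mul_le_mul_of_nonneg_right (show 6 * γ ≤ ω / 2 by linarith) (show (0:ℝ) ≤ Vs.card by positivity)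
    linarith
  have hsVs : s ≤ θ ^ Δ * Vs.card := by
    have h1 := mul_le_mul_of_nonneg_left hVsN hω0.le
    have h2 := mul_le_mul_of_nonneg_right hωP (show (0:ℝ) ≤ Vs.card by positivity)
    linarith
  have hsVsθ : s ≤ θ * Vs.card := by
    have h1 := mul_le_mul_of_nonneg_left hVsN hω0.le
    have h2 := mul_le_mul_of_nonneg_right hωθ (show (0:ℝ) ≤ Vs.card by positivity)
    linarith
  have hsVs1 : s ≤ Vs.card := by
    have := mul_le_mul_of_nonneg_right (show θ ≤ 1 by linarith) (show (0:ℝ) ≤ Vs.card by positivity)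
    linarith
  have hVsPM : ∀ v ∈ Vs, v ∉ PM := fun v hv => (mem_sdiff.1 (hZ1s (hVsZ hv))).2
  have hAPM : ∀ v ∈ A, v ∉ PM := by
    intro v hv; rw [← hA] at hv
    exact (mem_sdiff.1 (mem_sdiff.1 hv).1).2
  have hAVs : ∀ v ∈ A, v ∉ Vs := by
    intro v hv h; rw [← hA] at hv
    exact (mem_sdiff.1 hv).2 (hVsZ h)
  obtain ⟨PI, hPI⟩ : ∃ PI : Finset V, (univ : Finset (Fin mv × Fin k)).image (fun q => ti q.1 q.2) = PI := ⟨_, rfl⟩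
  have hPIc : (PI.card : ℝ) ≤ Δ * mv := by
    have := img_card mv k ti
    rw [hPI] at this
    exact_mod_cast this.trans (Nat.mul_le_mul_right _ hk)
  have hPIm : ∀ j b, ti j b ∈ PI := by
    intro j b; rw [← hPI]; exact mem_image.2 ⟨(j, b), mem_univ _, rfl⟩
  -- the pairs
  obtain ⟨fT1, fT2⟩ := floor_half T hT2
  obtain ⟨t, ht⟩ : ∃ t, ⌊T⌋₊ = t := ⟨_, rfl⟩
  rw [ht] at fT1 fT2
  obtain ⟨U0, hU0⟩ : ∃ U0, PM ∪ PI ∪ Vs = U0 := ⟨_, rfl⟩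
  have hU0c : (U0.card : ℝ) ≤ PM.card + PI.card + Vs.card := by
    have h1 := card_union_le (PM ∪ PI) Vs
    have h2 := card_union_le PM PI
    rw [hU0] at h1
    exact_mod_cast (by omega : U0.card ≤ PM.card + PI.card + Vs.card)
  have hM0 : ∀ bb : ℝ, bb ≤ s → (Vs.card : ℝ) + 2 * t + 2 * mc + Δ * mv + bb ≤ θ * θ ^ Δ * n / 2 := fun bb hbb =>
    numM0 Δ (θ * θ ^ Δ) ω δ z s Kc Kv T n Vs.card t mc mv bb hωw hω0 hD hz1 hδ0 hδ1 hn0 hs0.le (by linarith)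
      hTK hKvc hVsK fT2 hmc hmv hbb hA1
  obtain ⟨p, hp1, pdisj, hp3⟩ := cover_pairs G a n ha0 ha1 hV hec (thick G θ Ds) s θ hs0.le hθ0 LDs Vs U0 hsVs1 hsVsθ t
    (by
      have h1 := hM0 s le_rfl
      have h2 := mul_le_mul_of_nonneg_left hP1 (show 0 ≤ θ * n by positivity)
      have h3 : a / 2 * n = 2 * (θ * n) := by rw [← haθ]; ring
      rw [h3]
      have h4 : θ * θ ^ Δ * n = θ * n * θ ^ Δ := by ring
      rw [h4] at h1
      have h5 : 0 ≤ θ * n := by positivity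
      linarith)
    (by rw [haθ]; exact hpow t _ fT1 hCn)
    (by
      have : (0:ℝ) < t := by linarith
      exact_mod_cast this) hCp
  rw [haθ] at hp3
  -- bad vertices
  obtain ⟨B, hB⟩ : ∃ B : Finset V, (univ : Finset V).filter (fun v => (v ∉ Vs ∧ (∀ i < t, ∀ a, p i a ≠ v) ∧
    (∀ j b, pm j b ≠ v) ∧ (∀ j b, ti j b ≠ v)) ∧
    ((Vs.filter (fun w => (thick G θ Ds).Adj v w)).card : ℝ) < θ * Vs.card) = B := ⟨_, rfl⟩
  have hBm : ∀ v ∈ B, v ∉ Vs ∧ (∀ i < t, ∀ a, p i a ≠ v) ∧ (∀ j b, pm j b ≠ v) ∧ (∀ j b, ti j b ≠ v) := by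
    intro v hv; rw [← hB] at hv
    exact (mem_filter.1 hv).2.1
  have hBc : (B.card : ℝ) ≤ s := by
    refine le_trans ?_ (LDs Vs hsVs1)
    have : B ⊆ univ.filter (fun v => ((Vs.filter ((thick G θ Ds).Adj v)).card : ℝ) < θ * Vs.card) := by
      intro v hv; rw [← hB] at hv
      exact mem_filter.2 ⟨mem_univ _, (mem_filter.1 hv).2.2⟩
    exact_mod_cast card_le_card this
  have good : ∀ v, v ∉ Vs → (∀ i < t, ∀ a, p i a ≠ v) → (∀ j b, pm j b ≠ v) → (∀ j b, ti j b ≠ v) → v ∉ B →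
      θ * (Vs.card : ℝ) ≤ ((Vs.filter (fun w => (thick G θ Ds).Adj v w)).card : ℝ) := by
    intro v h1 h2 h3 h4 h5
    by_contra hcon
    push Not at hcon
    exact h5 (by rw [← hB]; exact mem_filter.2 ⟨mem_univ _, ⟨h1, h2, h3, h4⟩, hcon⟩)
  have Bdeg : ∀ v ∈ B, θ * (Fintype.card V : ℝ) ≤
      (((univ : Finset V).filter (fun w => (thick G θ C2).Adj v w)).card : ℝ) := by
    intro v _
    have := deg_thick G a ha0 C2 v hVp (by rw [hV]; exact hdv v) (by
      rw [← hC2, sdiff_sdiff_right_self, inf_eq_inter, univ_inter]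
      have h1 : a / 2 * (Fintype.card C : ℝ) = 2 * (θ * Fintype.card C) := by rw [← haθ]; ring
      rw [h1]
      have h2 := mul_le_mul_of_nonneg_left hC hθ0.le
      linarith)
    rwa [haθ] at this
  -- the families in `H`
  obtain ⟨U1, hU1⟩ : ∃ U1, (univ : Finset W).filter (fun w => 1 ≤ degOf H w) = U1 := ⟨_, rfl⟩
  have hU1c : u0 * n ≤ U1.card := by
    have h1 := edge_le H Δ hdeg
    rw [hU1, hEC] at h1
    have h2 : (Fintype.card C : ℝ) ≤ Δ * U1.card := by exact_mod_cast h1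
    have h3 := mul_le_mul_of_nonneg_right hu1 hn0.le
    have h4 : (Δ:ℝ) * (u0 * n) ≤ Δ * U1.card := by linarith
    exact le_of_mul_le_mul_left h4 (by linarith)
  obtain ⟨Uk, hUk⟩ : ∃ Uk, (univ : Finset W).filter (fun w => degOf H w = k) = Uk := ⟨_, rfl⟩
  have hUkc : u0 * n ≤ Uk.card := by
    rw [hUk] at hkc
    have h2 : (Fintype.card W : ℝ) ≤ (Δ + 1) * Uk.card := by exact_mod_cast hkc
    rw [hW] at h2
    have h3 := mul_le_mul_of_nonneg_right hu2 hn0.le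
    have h4 : ((Δ:ℝ) + 1) * (u0 * n) ≤ (Δ + 1) * Uk.card := by linarith
    exact le_of_mul_le_mul_left h4 (by linarith)
  have hu00 : 0 ≤ u0 := le_trans (by positivity) hu0
  have hUuc : u0 * n ≤ (univ : Finset W).card := by
    rw [card_univ, hW]
    have h3 := mul_le_mul_of_nonneg_right hu2 hn0.le
    have h4 : 0 ≤ u0 * n := by positivity
    have h5 : 0 ≤ u0 * n * Δ := by positivity
    linarith
  have hnum : ∀ pp u : ℝ, pp ≤ 12 * (z * Kc) → u0 * n ≤ u →
      ((Δ:ℝ) + 1) ^ 4 * (ζ * n + pp + s) ≤ u := fun pp u h1 h2 =>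
    numP _ ζ u0 z s Kc n pp u (by linarith) hn0 hu0 (by linarith) h1 (by linarith) hA3 h2
  have hzn : 100 * Kc ≤ ζ * n := by linarith
  obtain ⟨QM, aM, cM, -, QMc, aMQ, aMU, aMi, aMf⟩ := family_fun hHS Δ hdeg U1 ∅ n ζ (Fin mc) hW hζ0 hn0
    (by intro w hw; exact absurd hw (notMem_empty w))
    (hnum _ _ (by rw [card_empty, Nat.cast_zero]; linarith) hU1c) (by rw [Fintype.card_fin]; linarith)
  rw [Fintype.card_fin, h2z] at QMc
  have QMc' : (QM.card : ℝ) ≤ 4 * (z * Kc) := by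
    have := mul_le_mul_of_nonneg_left hmc (show 0 ≤ z by linarith)
    linarith
  obtain ⟨QI, rI, cI, dI, QIc, rIQ, rIU, rIi, rIf⟩ := family_fun hHS Δ hdeg Uk QM n ζ (Fin mv) hW hζ0 hn0
    cM (hnum _ _ (by linarith) hUkc) (by rw [Fintype.card_fin]; linarith)
  rw [Fintype.card_fin, h2z] at QIc
  have QIc1 : (QI.card : ℝ) ≤ 2 * z * (Kv + s) := by
    have := mul_le_mul_of_nonneg_left hmv (show 0 ≤ z by linarith)
    linarith
  have QIc' : (QI.card : ℝ) ≤ 4 * (z * Kc) := by linarith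
  have hMIc : ((QM ∪ QI).card : ℝ) ≤ QM.card + QI.card := by exact_mod_cast card_union_le QM QI
  obtain ⟨QB, rB, cB, dB, QBc, rBQ, -, rBi, rBf⟩ := family_fun hHS Δ hdeg univ (QM ∪ QI) n ζ ↥B hW hζ0 hn0
    (cM.union cI) (hnum _ _ (by linarith) hUuc) (by rw [Fintype.card_coe]; linarith)
  rw [Fintype.card_coe, h2z] at QBc
  have QBc' : (QB.card : ℝ) ≤ 4 * (z * Kc) := by
    have := mul_le_mul_of_nonneg_left hBc (show 0 ≤ z by linarith)
    linarith
  have hMIBc : (((QM ∪ QI) ∪ QB).card : ℝ) ≤ (QM ∪ QI).card + QB.card := by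
    exact_mod_cast card_union_le (QM ∪ QI) QB
  obtain ⟨fy1, fy2⟩ := ceil_dbl (θ * T / 2) hT3
  obtain ⟨ny, hny⟩ : ∃ ny, ⌈θ * T / 2⌉₊ = ny := ⟨_, rfl⟩
  rw [hny] at fy1 fy2
  have hnyT : (ny : ℝ) ≤ T := by linarith
  obtain ⟨QY, aY, cY, dY, QYc, aYQ, aYU, aYi, aYf⟩ := family_fun hHS Δ hdeg U1 ((QM ∪ QI) ∪ QB) n ζ (Fin ny) hW hζ0 hn0
    ((cM.union cI).union cB) (hnum _ _ (by linarith) hU1c) (by rw [Fintype.card_fin]; linarith)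
  rw [Fintype.card_fin, h2z] at QYc
  have QYc1 : (QY.card : ℝ) ≤ 2 * z * (T + s) := by
    have := mul_le_mul_of_nonneg_left hnyT (show 0 ≤ z by linarith)
    linarith
  rw [disjoint_union_right] at dB dY
  rw [disjoint_union_right] at dY
  have hnb : ∀ w ∈ U1, ∃ u, H.Adj w u := by
    intro w hw
    rw [← hU1] at hw
    obtain ⟨u, hu⟩ := card_pos.1 (mem_filter.1 hw).2
    exact ⟨u, (mem_filter.1 hu).2⟩
  choose bM abM using fun j => hnb (aM j) (aMU j)
  choose bY abY using fun j => hnb (aY j) (aYU j)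
  choose nI nIi nIa using fun j => nbr_enum H k (rI j) (by
    have := rIU j
    rw [← hUk] at this
    exact (mem_filter.1 this).2)
  have hΔs : 100 * Δ * s ≤ θ * (θ * T) := by
    have h1 := mul_le_mul_of_nonneg_right hω1 (show 0 ≤ θ ^ 2 * T by positivity)
    have h2 : θ ^ 2 * ω * T = ω * (θ ^ 2 * T) := by ring
    have h3 : θ ^ 2 * T = θ * (θ * T) := by ring
    linarith
  have hpU : ∀ i < t, ∀ a, p i a ∉ PM ∧ p i a ∉ PI ∧ p i a ∉ Vs := by
    intro i hi a
    have := (hp1 i hi).2.1 a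
    rw [← hU0, mem_union, mem_union] at this
    push Not at this
    exact ⟨this.1.1, this.1.2, this.2⟩
  have hpw : θ ^ (Δ + 1) = θ * θ ^ Δ := by ring
  exact assemble G H Δ hΔ hdeg X cls s hHS θ s T (θ * T / 2) hθ0 (by linarith) hs0.le hVW hEC Ds C2 hDC LDs LD2 LDY
    mc rc mv rv ny t k hDsc hrc2 pm pm0 pmd pmn pma Vs hVsc ti hk tiJ tid tin tia
    (fun i a j b h => hAPM _ (tiA i a) (h ▸ hPMm j b)) (fun j b h => hVsPM _ h (hPMm j b))
    (fun i a => hAVs _ (tiA i a)) p (fun i hi => (hp1 i hi).1) pdisj (fun i hi a => (hpU i hi a).2.2)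
    (fun i hi a j b h => (hpU i hi a).1 (h ▸ hPMm j b)) (fun i hi a j b h => (hpU i hi a).2.1 (h ▸ hPIm j b))
    (fun i hi => (hp1 i hi).2.2)
    (fun c => le_trans (by
      have := mul_le_mul_of_nonneg_left fT1 hθ0.le
      linarith) (hp3 c))
    B (fun v hv => (hBm v hv).1) (fun v hv => (hBm v hv).2.1) (fun v hv => (hBm v hv).2.2.1)
    (fun v hv => (hBm v hv).2.2.2) Bdeg good QM QI QB QY cM cI cB cY dI.symm dB.1.symm dB.2.symm
    dY.1.1.symm dY.1.2.symm dY.2.symm aM bM aMQ aMi abM aMf rI rIQ rIi rIf nI nIi nIa rB rBQ rBi rBf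
    aY bY aYQ aYi abY aYf fy1
    (by
      rw [hV]
      have := mul_le_mul_of_nonneg_left hTn hP0.le
      linarith)
    (by
      have h1 := mul_le_mul_of_nonneg_right hωP hT0.le
      have h2 : 0 < θ ^ Δ * T := by positivity
      linarith)
    (num3 Δ θ (θ ^ Δ) ω s Vs.card (cv * Kv / 2) hω hω0 (by linarith) hP0.le hP1 hD hs0.le (by linarith) hVsN hS1)
    (by
      have h2 : 0 < θ * (θ * T) := by positivity
      linarith)
    (num5 Δ (((Δ:ℝ) + 1) ^ 4) z s T QY.card t _ rv hL1 hLD hz1 hs0.le (by linarith) QYc1 fT2 hD1 hRv)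
    (num6 Δ z s Kv T QI.card Vs.card t _ rc hD hz1 hs0.le (by linarith) hTK hKv0 QIc1 hVsK fT2 hB1 hRc)
    (by
      rw [hpw]
      exact num7 Δ θ (θ ^ Δ) ω s Vs.card (cv * Kv / 2) rv hω hω0 hP0.le hP1 (by linarith) hs0.le (by linarith)
        hVsN hrvω hS1)
    hT0.le (by linarith) (θ * θ ^ Δ * n / 2)
    (by
      rw [hpw, hV]
      have := hM0 B.card hBc
      linarith)
    (by
      have h0 : θ ^ Δ * (θ * θ ^ Δ * n / 2) = ω * n / 2 := by rw [← hω]; ring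
      rw [h0]
      have := mul_le_mul_of_nonneg_left hTn hω0.le
      linarith)
    hsVs
    (numM3 Δ θ (θ ^ Δ) ω δ z s Kc n QM.card QB.card QI.card hω hω0 hD hz1 hδ0 hδ1 hn0 hs0.le (by linarith)
      QMc' QBc' QIc' hA1)
    (numM4 Δ θ ω δ z Kc n QM.card QB.card C2.card hωθ hθ0 hD hδ0 hn0 QMc' QBc' hC2c hA1)

set_option maxHeartbeats 2000000 in
theorem stmt0_aux (Δ : ℕ) (hΔ : 1 ≤ Δ) (d δ α : ℝ) (hd : 0 < d) (hδ : 0 < δ) (hα : 0 < α) :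
    ∃ (η μ : ℝ) (n₀ : ℕ), 0 < η ∧ 0 < μ ∧
    ∀ n : ℕ, n₀ ≤ n →
    ∀ (V : Type) [Fintype V] (C : Type) [Fintype C] (G : C → SimpleGraph V),
      Fintype.card V = n →
      δ * (n : ℝ) ≤ (Fintype.card C : ℝ) →
      (∀ A B : Finset V, ∀ C' : Finset C,
        d * (C'.card : ℝ) * (A.card : ℝ) * (B.card : ℝ) - η * (n : ℝ) ^ 3 ≤
          ∑ c ∈ C', (pairCount (G c) A B : ℝ)) →
      (∀ v : V, α * (Fintype.card C : ℝ) * (n : ℝ) ≤ ∑ c : C, (degOf (G c) v : ℝ)) →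
      (∀ c : C, α * (n : ℝ) ^ 2 ≤ (edgeCnt (G c) : ℝ)) →
      ∀ (W : Type) [Fintype W] (H : SimpleGraph W),
        Fintype.card W = n → Separable H μ → (∀ w, degOf H w ≤ Δ) →
        edgeCnt H = Fintype.card C →
        HasTransversal G H := by
  obtain ⟨a, ha⟩ : ∃ a, min d (min α 1) = a := ⟨_, rfl⟩
  have ha0 : 0 < a := by rw [← ha]; exact lt_min hd (lt_min hα one_pos)
  have had : a ≤ d := by rw [← ha]; exact min_le_left _ _
  have haα : a ≤ α := by rw [← ha]; exact (min_le_right _ _).trans (min_le_left _ _)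
  have ha1 : a ≤ 1 := by rw [← ha]; exact (min_le_right _ _).trans (min_le_right _ _)
  clear ha
  obtain ⟨θ, haθ⟩ : ∃ θ, a / 4 = θ := ⟨_, rfl⟩
  have hθ0 : 0 < θ := by linarith
  have hθ1 : θ ≤ 1 / 4 := by linarith
  obtain ⟨δ', hδ'⟩ : ∃ δ', min δ 1 = δ' := ⟨_, rfl⟩
  have hδ0 : 0 < δ' := by rw [← hδ']; exact lt_min hδ one_pos
  have hδ1 : δ' ≤ 1 := by rw [← hδ']; exact min_le_right _ _
  have hδδ : δ' ≤ δ := by rw [← hδ']; exact min_le_left _ _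
  clear hδ'
  obtain ⟨ω, hω⟩ : ∃ ω, θ ^ Δ * (θ * θ ^ Δ) = ω := ⟨_, rfl⟩
  have hω0 : 0 < ω := by rw [← hω]; positivity
  have hω1 : ω ≤ 1 := by
    rw [← hω]
    have h1 : θ ^ Δ ≤ 1 := pow_le_one₀ hθ0.le (by linarith)
    exact mul_le_one₀ h1 (by positivity) (mul_le_one₀ (by linarith) (by positivity) h1)
  have hD : (1:ℝ) ≤ Δ := by exact_mod_cast hΔ
  have hD0 : (0:ℝ) < Δ := by linarith
  have hL1 : (1:ℝ) ≤ ((Δ:ℝ) + 1) ^ 4 := one_le_pow₀ (by linarith)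
  obtain ⟨L, hL⟩ : ∃ L, ((Δ:ℝ) + 1) ^ 4 = L := ⟨_, rfl⟩
  rw [hL] at hL1
  have hL0 : 0 < L := by linarith
  obtain ⟨u0, hu⟩ : ∃ u0, min (δ' / Δ) (1 / ((Δ:ℝ) + 1)) = u0 := ⟨_, rfl⟩
  have hu00 : 0 < u0 := by rw [← hu]; exact lt_min (by positivity) (by positivity)
  have hu1 : u0 * Δ ≤ δ' := by rw [← le_div_iff₀ hD0, ← hu]; exact min_le_left _ _
  have hu2 : u0 * ((Δ:ℝ) + 1) ≤ 1 := by rw [← le_div_iff₀ (by linarith), ← hu]; exact min_le_right _ _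
  clear hu
  have hu3 : u0 ≤ 1 := by
    have : 0 ≤ u0 * Δ := by positivity
    linarith
  obtain ⟨ζ, hζ⟩ : ∃ ζ, u0 / (2 * L) = ζ := ⟨_, rfl⟩
  have hζ0 : 0 < ζ := by rw [← hζ]; positivity
  have hζu : 2 * L * ζ = u0 := by rw [← hζ]; field_simp
  have hζ1 : ζ ≤ 1 := by
    have := mul_le_mul_of_nonneg_right hL1 hζ0.le
    linarith
  obtain ⟨z, hz⟩ : ∃ z, 1 / ζ = z := ⟨_, rfl⟩
  have hz1 : 1 ≤ z := by rw [← hz]; exact (one_le_div hζ0).2 hζ1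
  have hz0 : 0 < z := by linarith
  have hzζ : z * ζ = 1 := by rw [← hz]; field_simp
  obtain ⟨cc, hcc0, hcc1, hAC⟩ := absC_ex θ hθ0 (by linarith)
  obtain ⟨κc, hκc⟩ : ∃ κc, min cc (ζ ^ 2 * ω * δ' / (100 * Δ)) = κc := ⟨_, rfl⟩
  have hκc0 : 0 < κc := by rw [← hκc]; exact lt_min hcc0 (by positivity)
  have hκc1 : κc ≤ cc := by rw [← hκc]; exact min_le_left _ _
  have hκc2 : 100 * Δ * κc ≤ ζ ^ 2 * ω * δ' := by
    rw [mul_comm, ← le_div_iff₀ (by positivity), ← hκc]; exact min_le_right _ _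
  clear hκc
  have hA : 100 * Δ * (z * κc) ≤ ζ * (ω * δ') := by
    have h1 := mul_le_mul_of_nonneg_left hκc2 hz0.le
    have h2 : z * (ζ ^ 2 * ω * δ') = (z * ζ) * (ζ * (ω * δ')) := by ring
    rw [h2, hzζ] at h1
    linarith
  have hωδ0 : 0 < ω * δ' := by positivity
  have hωδ1 : ω * δ' ≤ 1 := mul_le_one₀ hω1 hδ0.le hδ1
  have hA1 : 100 * Δ * (z * κc) ≤ ω * δ' := by
    have := mul_le_mul_of_nonneg_right hζ1 hωδ0.le
    linarith
  have hA3 : 100 * (z * κc) ≤ ζ := by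
    have h1 := mul_le_mul_of_nonneg_left hωδ1 hζ0.le
    have h2 := mul_le_mul_of_nonneg_right hD (show 0 ≤ z * κc by positivity)
    linarith
  obtain ⟨γ, hγ⟩ : ∃ γ, min ((θ ^ (Δ + 1) / 4) ^ Δ / 20) (ω / 12) = γ := ⟨_, rfl⟩
  have hγ0 : 0 < γ := by rw [← hγ]; exact lt_min (by positivity) (by positivity)
  have hγ1 : γ ≤ (θ ^ (Δ + 1) / 4) ^ Δ / 20 := by rw [← hγ]; exact min_le_left _ _
  have hγ2 : 12 * γ ≤ ω := by
    have : γ ≤ ω / 12 := by rw [← hγ]; exact min_le_right _ _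
    linarith
  clear hγ
  obtain ⟨cv, hcv0, hcv1, hAV⟩ := absV_ex Δ θ γ hθ0 (by linarith) hγ0 hγ1
  obtain ⟨κv, hκv⟩ : ∃ κv, min cv (min κc (θ ^ 5 / 80 * (cc * κc) / (40 * Δ * z))) = κv := ⟨_, rfl⟩
  have hκv0 : 0 < κv := by rw [← hκv]; exact lt_min hcv0 (lt_min hκc0 (by positivity))
  have hκv1 : κv ≤ cv := by rw [← hκv]; exact min_le_left _ _
  have hκv2 : κv ≤ κc := by rw [← hκv]; exact (min_le_right _ _).trans (min_le_left _ _)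
  have hκv3 : 40 * Δ * (z * κv) ≤ θ ^ 5 / 80 * (cc * κc) := by
    have : κv * (40 * Δ * z) ≤ θ ^ 5 / 80 * (cc * κc) := by
      rw [← le_div_iff₀ (by positivity), ← hκv]; exact (min_le_right _ _).trans (min_le_right _ _)
    linarith
  clear hκv
  obtain ⟨τ, hτ⟩ : ∃ τ, min κv (γ * (cv * κv) / (20 * L * z)) = τ := ⟨_, rfl⟩
  have hτ0 : 0 < τ := by rw [← hτ]; exact lt_min hκv0 (by positivity)
  have hτ1 : τ ≤ κv := by rw [← hτ]; exact min_le_left _ _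
  have hτ2 : 20 * L * (z * τ) ≤ γ * (cv * κv) := by
    have : τ * (20 * L * z) ≤ γ * (cv * κv) := by
      rw [← le_div_iff₀ (by positivity), ← hτ]; exact min_le_right _ _
    linarith
  clear hτ
  obtain ⟨σ, hσ⟩ : ∃ σ, min (ω * (cv * κv / 2)) (θ ^ 2 * ω * τ) / (100 * Δ) = σ := ⟨_, rfl⟩
  have hσ0 : 0 < σ := by
    rw [← hσ]; exact div_pos (lt_min (by positivity) (by positivity)) (by positivity)
  have hσ3 : 100 * Δ * σ = min (ω * (cv * κv / 2)) (θ ^ 2 * ω * τ) := by rw [← hσ]; field_simp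
  have hσ1 : 100 * Δ * σ ≤ ω * (cv * κv / 2) := by rw [hσ3]; exact min_le_left _ _
  have hσ2 : 100 * Δ * σ ≤ θ ^ 2 * ω * τ := by rw [hσ3]; exact min_le_right _ _
  clear hσ hσ3
  obtain ⟨N, hN⟩ : ∃ N : ℝ, 2 / (cc * κc) + 2 / (cv * κv) + 2 / τ + 2 / (θ * τ) + 8 * Δ / (θ ^ 2 * τ ^ 2) + 1 = N :=
    ⟨_, rfl⟩
  have e1 : 0 < 2 / (cc * κc) := by positivity
  have e2 : 0 < 2 / (cv * κv) := by positivity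
  have e3 : 0 < 2 / τ := by positivity
  have e4 : 0 < 2 / (θ * τ) := by positivity
  have e5 : 0 < 8 * Δ / (θ ^ 2 * τ ^ 2) := by positivity
  refine ⟨a / 2 * (θ * τ / 2) * σ * σ, σ, ⌈N⌉₊, by positivity, hσ0, ?_⟩
  intro n hn V _ C _ G hV hC hdense hdv hec W _ H hW hsep hdeg hEC
  have hNn : N ≤ n := (Nat.le_ceil N).trans (by exact_mod_cast hn)
  have hn0 : (0:ℝ) < n := by linarith
  have f1 : 2 ≤ cc * (κc * n) := by
    have : 2 / (cc * κc) ≤ n := by linarith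
    rw [div_le_iff₀ (by positivity)] at this
    linarith
  have f2 : 2 ≤ cv * (κv * n) := by
    have : 2 / (cv * κv) ≤ n := by linarith
    rw [div_le_iff₀ (by positivity)] at this
    linarith
  have f3 : 2 ≤ τ * n := by
    have : 2 / τ ≤ n := by linarith
    rw [div_le_iff₀ (by positivity)] at this
    linarith
  have f4 : 1 ≤ θ * (τ * n) / 2 := by
    have : 2 / (θ * τ) ≤ n := by linarith
    rw [div_le_iff₀ (by positivity)] at this
    linarith
  have f5 : 8 * Δ ≤ θ ^ 2 * τ ^ 2 * n := by
    have : 8 * Δ / (θ ^ 2 * τ ^ 2) ≤ n := by linarith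
    rw [div_le_iff₀ (by positivity)] at this
    linarith
  have hWn : (Fintype.card W : ℝ) = n := by exact_mod_cast hW
  obtain ⟨X, cls, hHS⟩ := HS_of_sep H σ hsep
  rw [hWn] at hHS
  have mn : ∀ {x y : ℝ}, x ≤ y → x * n ≤ y * n := fun h => mul_le_mul_of_nonneg_right h hn0.le
  refine core Δ hΔ a θ δ' cc cv γ ζ z ω u0 (a / 2 * (θ * τ / 2) * σ * σ) (σ * n) n (κc * n) (κv * n) (τ * n)
    hθ0 hθ1 haθ hω hδ0 hδ1 hcc0 hcc1 hcv0 hcv1 hAC hAV hγ0 hγ2 hζ0 hz hz1 (by rw [hL]; exact hζu.le) hu1 hu2 hn0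
    (mn hκc1) ?_ ?_ f1 (mn hκv1) (mn hκv2) ?_ f2 (mn hτ1) ?_ f3 f4 ?_ (by positivity) ?_ ?_ ?_ G H
    (by exact_mod_cast hV) hWn ?_ ?_ ?_ ?_ X cls hHS hdeg hEC
  · have := mn hA1
    linarith
  · have := mn hA3
    linarith
  · have := mn hκv3
    linarith
  · have := mn hτ2
    rw [hL]
    linarith
  · intro t M ht hM
    exact pow_small θ τ n Δ t M hθ0 (by linarith) hτ0 hn0 ht hM f5
  · have := mn hσ1
    linarith
  · have := mn hσ2
    linarith
  · apply le_of_eq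
    ring
  · exact (mn hδδ).trans hC
  · intro A B C'
    refine le_trans ?_ (hdense A B C')
    have : a * ((C'.card : ℝ) * A.card * B.card) ≤ d * ((C'.card : ℝ) * A.card * B.card) :=
      mul_le_mul_of_nonneg_right had (by positivity)
    linarith
  · intro v
    refine le_trans ?_ (hdv v)
    have : a * ((Fintype.card C : ℝ) * n) ≤ α * ((Fintype.card C : ℝ) * n) :=
      mul_le_mul_of_nonneg_right haα (by positivity)
    linarith
  · intro c
    exact le_trans (mul_le_mul_of_nonneg_right haα (by positivity)) (hec c)

/-! ## Statement 0 -/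

theorem stmt0 (Δ : ℕ) (hΔ : 1 ≤ Δ) (d δ α : ℝ) (hd : 0 < d) (hδ : 0 < δ) (hα : 0 < α) :
    ∃ (η μ : ℝ) (n₀ : ℕ), 0 < η ∧ 0 < μ ∧
    ∀ n : ℕ, n₀ ≤ n →
    ∀ (V : Type) [Fintype V] (C : Type) [Fintype C] (G : C → SimpleGraph V),
      Fintype.card V = n →
      δ * (n : ℝ) ≤ (Fintype.card C : ℝ) →
      (∀ A B : Finset V, ∀ C' : Finset C,
        d * (C'.card : ℝ) * (A.card : ℝ) * (B.card : ℝ) - η * (n : ℝ) ^ 3 ≤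
          ∑ c ∈ C', (pairCount (G c) A B : ℝ)) →
      (∀ v : V, α * (Fintype.card C : ℝ) * (n : ℝ) ≤ ∑ c : C, (degOf (G c) v : ℝ)) →
      (∀ c : C, α * (n : ℝ) ^ 2 ≤ (edgeCnt (G c) : ℝ)) →
      ∀ (W : Type) [Fintype W] (H : SimpleGraph W),
        Fintype.card W = n → Separable H μ → (∀ w, degOf H w ≤ Δ) →
        edgeCnt H = Fintype.card C →
        HasTransversal G H := by
  exact stmt0_aux Δ hΔ d δ α hd hδ hα
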